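/- Let Ω ⊂ ℝ² be a bounded open set with 𝓗¹(∂Ω) < ∞ whose boundary has finitely many connected components. Then the limit lim_{r→0⁺} (1/r) ∫₀^r L(t) dt exists and equals P(Ω) + 2 𝓗¹(∂Ω ∩ Ω^{(1)}), where L(t) = 𝓗¹({ x ∈ Ω : dist(x, ∂Ω) = t }). -/

import Mathlib

open MeasureTheory Metric Set Filter Topology Bornology ENNReal

noncomputable section

abbrev E2 := EuclideanSpace ℝ (Fin 2)

/-- divergence of a vector field on ℝ² -/
def divg (φ : E2 → E2) (x : E2) : ℝ := ∑ i, fderiv ℝ φ x (EuclideanSpace.single i 1) i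

/-- the set of admissible values in De Giorgi's definition of perimeter -/
def perimSet (Ω : Set E2) : Set ℝ :=
  {r | ∃ φ : E2 → E2, ContDiff ℝ 1 φ ∧ HasCompactSupport φ ∧ (∀ x, ‖φ x‖ ≤ 1) ∧
        r = ∫ x in Ω, divg φ x}

/-- De Giorgi perimeter -/
def perimeter (Ω : Set E2) : ℝ := sSup (perimSet Ω)

def HasFinitePerimeter (Ω : Set E2) : Prop := BddAbove (perimSet Ω)

/-- torsional rigidity via the variational formula -/
def torsion (Ω : Set E2) : ℝ :=
  sSup ({0} ∪ {r | ∃ u : E2 → ℝ, ContDiff ℝ 1 u ∧ HasCompactSupport u ∧ tsupport u ⊆ Ω ∧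
      (∫ x in Ω, ‖fderiv ℝ u x‖ ^ 2) ≠ 0 ∧
      r = (∫ x in Ω, u x) ^ 2 / ∫ x in Ω, ‖fderiv ℝ u x‖ ^ 2})

def inradius (Ω : Set E2) : ℝ := sSup ((fun x => infDist x (frontier Ω)) '' Ω)

def innerParallel (Ω : Set E2) (t : ℝ) : Set E2 := {x ∈ Ω | t < infDist x (frontier Ω)}

def boundedComponents (s : Set E2) : Set (Set E2) :=
  {C | ∃ x ∈ s, C = connectedComponentIn s x ∧ IsBounded C}

/-- `s` has at most `k` bounded connected components -/
def nBddCompLe (s : Set E2) (k : ℕ) : Prop :=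
  (boundedComponents s).Finite ∧ (boundedComponents s).ncard ≤ k

/-- the class 𝒜ₖ -/
def memA (k : ℕ) (Ω : Set E2) : Prop :=
  Ω.Nonempty ∧ IsOpen Ω ∧ IsBounded Ω ∧ nBddCompLe Ωᶜ k

/-- points of density `t` of `s` -/
def densityPts (s : Set E2) (t : ℝ≥0∞) : Set E2 :=
  {x | Tendsto (fun r => volume (s ∩ ball x r) / volume (ball x r)) (𝓝[>] (0:ℝ)) (𝓝 t)}

/-- area of the interior parallel set -/
def Afun (Ω : Set E2) (t : ℝ) : ℝ := (volume (innerParallel Ω t)).toReal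

/-- length of the interior parallel -/
def Lfun (Ω : Set E2) (t : ℝ) : ℝ :=
  (μH[1] ({x ∈ Ω | infDist x (frontier Ω) = t})).toReal

/-- a bounded open set with Lipschitz boundary -/
def IsLipschitzDomain (Ω : Set E2) : Prop :=
  ∀ x ∈ frontier Ω, ∃ (g : E2 ≃ₗᵢ[ℝ] E2) (f : ℝ → ℝ) (K : NNReal) (ε : ℝ),
    0 < ε ∧ LipschitzWith K f ∧
    Ω ∩ ball x ε = {y ∈ ball x ε | f ((g (y - x)) 0) < (g (y - x)) 1}

/-- the scale-free shape functional F_q -/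
def Fq (q : ℝ) (Ω : Set E2) : ℝ :=
  perimeter Ω * torsion Ω ^ q / (volume Ω).toReal ^ (2 * q + 1 / 2)

end


/-! ### Frames -/

/-- an orthonormal frame of the plane -/
abbrev Fr := OrthonormalBasis (Fin 2) ℝ E2

noncomputable def cp (B : Fr) (x : E2) : ℝ := B.repr x 0
noncomputable def cq (B : Fr) (x : E2) : ℝ := B.repr x 1
noncomputable def mkp (B : Fr) (s y : ℝ) : E2 := s • B 0 + y • B 1

lemma mkp_cp_cq (B : Fr) (x : E2) : mkp B (cp B x) (cq B x) = x := by
  have := B.sum_repr x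
  simpa [Fin.sum_univ_two, mkp, cp, cq] using this

lemma cp_mkp (B : Fr) (s y : ℝ) : cp B (mkp B s y) = s := by
  simp [cp, mkp]

lemma cq_mkp (B : Fr) (s y : ℝ) : cq B (mkp B s y) = y := by
  simp [cq, mkp]

lemma cp_add (B : Fr) (x y : E2) : cp B (x + y) = cp B x + cp B y := by simp [cp]
lemma cq_add (B : Fr) (x y : E2) : cq B (x + y) = cq B x + cq B y := by simp [cq]
lemma cp_sub (B : Fr) (x y : E2) : cp B (x - y) = cp B x - cp B y := by simp [cp]
lemma cq_sub (B : Fr) (x y : E2) : cq B (x - y) = cq B x - cq B y := by simp [cq]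
lemma cp_smul (B : Fr) (c : ℝ) (y : E2) : cp B (c • y) = c * cp B y := by simp [cp]
lemma cq_smul (B : Fr) (c : ℝ) (y : E2) : cq B (c • y) = c * cq B y := by simp [cq]

lemma cp_B0 (B : Fr) : cp B (B 0) = 1 := by simp [cp]
lemma cq_B0 (B : Fr) : cq B (B 0) = 0 := by simp [cq]
lemma cp_B1 (B : Fr) : cp B (B 1) = 0 := by simp [cp]
lemma cq_B1 (B : Fr) : cq B (B 1) = 1 := by simp [cq]

lemma norm_sq_fr (B : Fr) (x : E2) : ‖x‖ ^ 2 = cp B x ^ 2 + cq B x ^ 2 := by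
  have h : ‖B.repr x‖ = ‖x‖ := B.repr.norm_map x
  rw [← h, EuclideanSpace.norm_sq_eq]
  simp [Fin.sum_univ_two, cp, cq]

lemma abs_cp_le (B : Fr) (x : E2) : |cp B x| ≤ ‖x‖ := by
  refine abs_le_of_sq_le_sq ?_ (norm_nonneg _)
  nlinarith [norm_sq_fr B x, sq_nonneg (cq B x)]

lemma abs_cq_le (B : Fr) (x : E2) : |cq B x| ≤ ‖x‖ := by
  refine abs_le_of_sq_le_sq ?_ (norm_nonneg _)
  nlinarith [norm_sq_fr B x, sq_nonneg (cp B x)]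

lemma norm_le_fr (B : Fr) (x : E2) : ‖x‖ ≤ |cp B x| + |cq B x| := by
  apply le_of_sq_le_sq _ (by positivity)
  rw [norm_sq_fr B x, ← sq_abs (cp B x), ← sq_abs (cq B x)]
  nlinarith [abs_nonneg (cp B x), abs_nonneg (cq B x)]

lemma cp_lip (B : Fr) : LipschitzWith 1 (cp B) := by
  apply LipschitzWith.of_dist_le_mul
  intro x y
  rw [Real.dist_eq, dist_eq_norm, ← cp_sub]
  simpa using abs_cp_le B (x - y)

lemma cq_lip (B : Fr) : LipschitzWith 1 (cq B) := by
  apply LipschitzWith.of_dist_le_mul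
  intro x y
  rw [Real.dist_eq, dist_eq_norm, ← cq_sub]
  simpa using abs_cq_le B (x - y)

lemma continuous_mkp (B : Fr) : Continuous (fun z : ℝ × ℝ => mkp B z.1 z.2) := by
  unfold mkp; fun_prop

lemma continuous_mkp_left (B : Fr) (s : ℝ) : Continuous (fun y : ℝ => mkp B s y) := by
  unfold mkp; fun_prop

lemma mkp_add_smul (B : Fr) (x : E2) (h : ℝ) :
    mkp B (cp B x) (cq B x + h) = x + h • B 1 := by
  conv_rhs => rw [← mkp_cp_cq B x]
  simp only [mkp, add_smul]; abel

/-- the frame coordinates as a measurable equivalence -/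
noncomputable def frEquiv (B : Fr) : E2 ≃ᵐ ℝ × ℝ :=
  B.measurableEquiv.trans ((MeasurableEquiv.toLp 2 (Fin 2 → ℝ)).symm.trans
    MeasurableEquiv.finTwoArrow)

lemma frEquiv_apply (B : Fr) (x : E2) : frEquiv B x = (cp B x, cq B x) := rfl

lemma frEquiv_mp (B : Fr) : MeasurePreserving (frEquiv B) volume volume := by
  have h1 : MeasurePreserving (fun x : E2 => MeasurableEquiv.finTwoArrow (WithLp.ofLp x))
      volume volume :=
    (volume_preserving_finTwoArrow ℝ).comp (PiLp.volume_preserving_ofLp (Fin 2))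
  exact h1.comp B.measurePreserving_measurableEquiv

lemma frEquiv_symm_apply (B : Fr) (z : ℝ × ℝ) : (frEquiv B).symm z = mkp B z.1 z.2 := by
  rw [MeasurableEquiv.symm_apply_eq, frEquiv_apply, cp_mkp, cq_mkp]

lemma mkp_mp (B : Fr) : MeasurePreserving (fun z : ℝ × ℝ => mkp B z.1 z.2) volume volume := by
  have := (frEquiv_mp B).symm
  have h2 : (fun z : ℝ × ℝ => mkp B z.1 z.2) = (frEquiv B).symm := by
    ext1 z; rw [frEquiv_symm_apply]
  rw [h2]; exact this

/-- Fubini in a frame -/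
lemma volume_fr (B : Fr) {S : Set E2} (hS : MeasurableSet S) :
    volume S = ∫⁻ s, volume {y : ℝ | mkp B s y ∈ S} := by
  rw [← (mkp_mp B).measure_preimage hS.nullMeasurableSet]
  rw [Measure.volume_eq_prod, Measure.prod_apply ((mkp_mp B).measurable hS)]
  rfl

lemma measurable_slice (B : Fr) {S : Set E2} (hS : MeasurableSet S) :
    Measurable (fun s => volume {y : ℝ | mkp B s y ∈ S}) :=
  measurable_measure_prodMk_left ((mkp_mp B).measurable hS)

lemma exists_frame (a : E2) (ha : ‖a‖ = 1) : ∃ B : Fr, B 0 = a := by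
  have hv : Orthonormal ℝ (({0} : Set (Fin 2)).domRestrict (fun _ : Fin 2 => a)) := by
    constructor
    · intro i; simpa using ha
    · intro i j hij
      exact absurd (Subsingleton.elim i j) hij
  obtain ⟨B, hB⟩ := hv.exists_orthonormalBasis_extension_of_card_eq (by simp)
  exact ⟨B, hB 0 rfl⟩

noncomputable def swapFr (B : Fr) : Fr := B.reindex (Equiv.swap 0 1)

lemma swapFr_0 (B : Fr) : swapFr B 0 = B 1 := by simp [swapFr]
lemma swapFr_1 (B : Fr) : swapFr B 1 = B 0 := by simp [swapFr]
lemma cp_swapFr (B : Fr) (x : E2) : cp (swapFr B) x = cq B x := by simp [swapFr, cp, cq]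
lemma cq_swapFr (B : Fr) (x : E2) : cq (swapFr B) x = cp B x := by simp [swapFr, cp, cq]

/-! ### Hausdorff measure helpers -/

lemma hausdorff_le_of_expand {X Y : Type*} [MetricSpace X] [MeasurableSpace X] [BorelSpace X]
    [MetricSpace Y] [MeasurableSpace Y] [BorelSpace Y] (f : X → Y) (s : Set X) (K : NNReal)
    (h : ∀ x ∈ s, ∀ y ∈ s, dist x y ≤ K * dist (f x) (f y)) {d : ℝ} (hd : 0 ≤ d) :
    μH[d] s ≤ (K : ℝ≥0∞) ^ d * μH[d] (f '' s) := by
  rcases s.eq_empty_or_nonempty with rfl | ⟨x0, hx0⟩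
  · simp
  have : Nonempty X := ⟨x0⟩
  have hinj : InjOn f s := by
    intro x hx y hy hxy
    have := h x hx y hy
    rw [hxy, dist_self, mul_zero] at this
    exact dist_le_zero.mp this
  have hg : LipschitzOnWith K (Function.invFunOn f s) (f '' s) := by
    apply LipschitzOnWith.of_dist_le_mul
    rintro _ ⟨x, hx, rfl⟩ _ ⟨y, hy, rfl⟩
    rw [hinj.leftInvOn_invFunOn hx, hinj.leftInvOn_invFunOn hy]
    exact h x hx y hy
  have := hg.hausdorffMeasure_image_le hd
  rwa [hinj.leftInvOn_invFunOn.image_image] at this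

/-- covers realizing the Hausdorff measure -/
lemma exists_cover {X : Type*} [MetricSpace X] [MeasurableSpace X] [BorelSpace X]
    (d : ℝ) (A : Set X) (hA : μH[d] A ≠ ⊤) (n : ℕ) :
    ∃ t : ℕ → Set X, A ⊆ ⋃ i, t i ∧ (∀ i, ediam (t i) ≤ ((n : ℝ≥0∞) + 1)⁻¹) ∧
      ∑' i, (⨆ _ : (t i).Nonempty, ediam (t i) ^ d) ≤ μH[d] A + ((n : ℝ≥0∞) + 1)⁻¹ := by
  have hpos : (0 : ℝ≥0∞) < ((n : ℝ≥0∞) + 1)⁻¹ := by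
    apply ENNReal.inv_pos.mpr; finiteness
  have h1 : (⨅ (t : ℕ → Set X) (_ : A ⊆ ⋃ n, t n) (_ : ∀ i, ediam (t i) ≤ ((n : ℝ≥0∞) + 1)⁻¹),
      ∑' i, ⨆ _ : (t i).Nonempty, ediam (t i) ^ d) ≤ μH[d] A := by
    rw [Measure.hausdorffMeasure_apply d A]
    exact le_iSup₂ (f := fun (r : ℝ≥0∞) (_ : 0 < r) =>
        ⨅ (t : ℕ → Set X) (_ : A ⊆ ⋃ n, t n) (_ : ∀ n, ediam (t n) ≤ r),
          ∑' n, ⨆ _ : (t n).Nonempty, ediam (t n) ^ d) _ hpos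
  have h2 : μH[d] A < μH[d] A + ((n : ℝ≥0∞) + 1)⁻¹ := ENNReal.lt_add_right hA hpos.ne'
  have h3 := lt_of_le_of_lt h1 h2
  simp only [iInf_lt_iff] at h3
  obtain ⟨t, h4, h5, h6⟩ := h3
  exact ⟨t, h4, h5, h6.le⟩

/-- interval hull of a set of reals -/
lemma exists_interval (S : Set ℝ) :
    ∃ I : Set ℝ, MeasurableSet I ∧ S ⊆ I ∧ volume I ≤ ediam S ∧ (S = ∅ → I = ∅) := by
  rcases S.eq_empty_or_nonempty with rfl | ⟨x, hx⟩
  · exact ⟨∅, MeasurableSet.empty, subset_rfl, by simp, fun _ => rfl⟩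
  refine ⟨closure S, measurableSet_closure, subset_closure, ?_, ?_⟩
  · rw [← ediam_closure S]; exact Real.volume_le_diam _
  · rintro rfl; exact absurd hx (by simp)

lemma tendsto_inv_nat_add_one : Tendsto (fun n : ℕ => ((n : ℝ≥0∞) + 1)⁻¹) atTop (𝓝 0) := by
  have := ENNReal.tendsto_inv_nat_nhds_zero.comp (tendsto_add_atTop_nat 1)
  refine this.congr ?_
  intro n; simp

/-- Eilenberg inequality for counting -/
lemma eilenberg_count {X : Type*} [MetricSpace X] [MeasurableSpace X] [BorelSpace X]
    (A : Set X) (hA : μH[1] A ≠ ⊤) (u : X → ℝ) (K : NNReal)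
    (hu : LipschitzOnWith K u A) :
    ∃ G : ℝ → ℝ≥0∞, Measurable G ∧
      (∀ s, ∀ F : Finset X, ↑F ⊆ A ∩ u ⁻¹' {s} → (F.card : ℝ≥0∞) ≤ G s) ∧
      ∫⁻ s, G s ≤ K * μH[1] A := by
  choose t ht hd hs using fun n => exists_cover 1 A hA n
  choose I hIm hI hIv hIe using fun n i => exists_interval (u '' (t n i ∩ A))
  let g : ℕ → ℝ → ℝ≥0∞ := fun n s => ∑' i, (I n i).indicator (fun _ => 1) s
  have hg : ∀ n, Measurable (g n) := fun n =>
    Measurable.tsum (fun i => measurable_const.indicator (hIm n i))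
  refine ⟨fun s => liminf (fun n => g n s) atTop, Measurable.liminf hg, ?_, ?_⟩
  · intro s F hF
    apply le_liminf_of_le (by isBoundedDefault)
    -- separation
    obtain ⟨δ, hδ, hsep⟩ : ∃ δ : ℝ≥0∞, 0 < δ ∧ ∀ x ∈ F, ∀ y ∈ F, x ≠ y → δ ≤ edist x y := by
      classical
      by_cases hne : ((F ×ˢ F).filter (fun z => z.1 ≠ z.2)).Nonempty
      · refine ⟨((F ×ˢ F).filter (fun z => z.1 ≠ z.2)).inf' hne (fun z => edist z.1 z.2), ?_, ?_⟩
        · rw [Finset.lt_inf'_iff]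
          intro z hz
          rw [Finset.mem_filter] at hz
          exact edist_pos.mpr hz.2
        · intro x hx y hy hxy
          exact Finset.inf'_le (fun z : X × X => edist z.1 z.2) (b := (x, y))
            (by simp [hx, hy, hxy])
      · refine ⟨1, one_pos, ?_⟩
        intro x hx y hy hxy
        exact absurd ⟨(x, y), by simp [hx, hy, hxy]⟩ hne
    have hev : ∀ᶠ n : ℕ in atTop, ((n : ℝ≥0∞) + 1)⁻¹ < δ :=
      tendsto_inv_nat_add_one.eventually_lt_const hδ
    filter_upwards [hev] with n hn
    have hex : ∀ x : X, ∃ i, x ∈ F → x ∈ t n i := by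
      intro x
      by_cases hx : x ∈ F
      · obtain ⟨i, hi⟩ := mem_iUnion.mp (ht n (hF hx).1)
        exact ⟨i, fun _ => hi⟩
      · exact ⟨0, fun h => absurd h hx⟩
    choose i hi using hex
    have hinj : Set.InjOn i F := by
      intro x hx y hy hxy
      by_contra hne
      have h1 := hsep x hx y hy hne
      have h2 : edist x y ≤ ediam (t n (i x)) :=
        edist_le_ediam_of_mem (hi x hx) (hxy ▸ hi y hy)
      exact absurd (h1.trans (h2.trans (hd n _))) (not_le.mpr hn)
    classical
    calc (F.card : ℝ≥0∞) = ((F.image i).card : ℝ≥0∞) := by rw [Finset.card_image_of_injOn hinj]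
      _ = ∑ j ∈ F.image i, (1 : ℝ≥0∞) := by simp
      _ = ∑ j ∈ F.image i, (I n j).indicator (fun _ => 1) s := by
        apply Finset.sum_congr rfl
        intro j hj
        obtain ⟨x, hx, rfl⟩ := Finset.mem_image.mp hj
        rw [indicator_of_mem]
        apply hI
        exact ⟨x, ⟨hi x hx, (hF hx).1⟩, (hF hx).2⟩
      _ ≤ _ := ENNReal.sum_le_tsum _
  · calc ∫⁻ s, liminf (fun n => g n s) atTop ≤ liminf (fun n => ∫⁻ s, g n s) atTop :=
          lintegral_liminf_le hg
      _ ≤ liminf (fun n : ℕ => K * (μH[1] A + ((n : ℝ≥0∞) + 1)⁻¹)) atTop := by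
        refine liminf_le_liminf (Eventually.of_forall ?_)
        intro n
        simp only [g]
        rw [lintegral_tsum (fun i => (measurable_const.indicator (hIm n i)).aemeasurable)]
        refine le_trans ?_ (mul_le_mul_right (hs n) _)
        rw [← ENNReal.tsum_mul_left]
        apply ENNReal.tsum_le_tsum
        intro i
        rw [lintegral_indicator_const (hIm n i), one_mul]
        by_cases hne : (t n i ∩ A).Nonempty
        · have hne' : (t n i).Nonempty := hne.mono inter_subset_left
          simp only [hne', iSup_pos, ENNReal.rpow_one]
          refine (hIv n i).trans ?_
          have h3 : LipschitzOnWith K u (t n i ∩ A) := hu.mono inter_subset_right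
          rw [ediam_image_le_iff]
          intro x hx y hy
          refine (h3 hx hy).trans ?_
          gcongr
          exact edist_le_ediam_of_mem hx.1 hy.1
        · rw [not_nonempty_iff_eq_empty] at hne
          rw [hIe n i (by rw [hne, image_empty])]
          simp
      _ = K * μH[1] A := by
        apply Tendsto.liminf_eq
        have h1 : Tendsto (fun n : ℕ => μH[1] A + ((n : ℝ≥0∞) + 1)⁻¹) atTop (𝓝 (μH[1] A + 0)) :=
          tendsto_const_nhds.add tendsto_inv_nat_add_one
        rw [add_zero] at h1
        exact ENNReal.Tendsto.const_mul h1 (Or.inr ENNReal.coe_ne_top)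

/-- Eilenberg inequality, null sets -/
lemma eilenberg_null (A : Set E2) (hA : μH[2] A = 0) (u : E2 → ℝ) (K : NNReal)
    (hu : LipschitzWith K u) :
    ∀ᵐ s, μH[1] (A ∩ u ⁻¹' {s}) = 0 := by
  choose t ht hd hs using fun n => exists_cover 2 A (by simp [hA]) n
  choose I hIm hI hIv hIe using fun n i => exists_interval (u '' (t n i))
  let g : ℕ → ℝ → ℝ≥0∞ := fun n s => ∑' i, (I n i).indicator (fun _ => ediam (t n i)) s
  have hg : ∀ n, Measurable (g n) := fun n =>
    Measurable.tsum (fun i => measurable_const.indicator (hIm n i))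
  have h1 : ∀ s, μH[1] (A ∩ u ⁻¹' {s}) ≤ liminf (fun n => g n s) atTop := by
    intro s
    refine (Measure.hausdorffMeasure_le_liminf_tsum 1 (A ∩ u ⁻¹' {s}) (l := atTop)
      (fun n : ℕ => ((n : ℝ≥0∞) + 1)⁻¹) tendsto_inv_nat_add_one
      (fun n i => t n i ∩ u ⁻¹' {s}) ?_ ?_).trans ?_
    · apply Eventually.of_forall
      intro n i
      exact (ediam_mono inter_subset_left).trans (hd n i)
    · apply Eventually.of_forall
      intro n
      rw [← iUnion_inter]
      exact inter_subset_inter_left _ (ht n)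
    · refine liminf_le_liminf (Eventually.of_forall ?_)
      intro n
      apply ENNReal.tsum_le_tsum
      intro i
      rw [ENNReal.rpow_one]
      by_cases hne : (t n i ∩ u ⁻¹' {s}).Nonempty
      · obtain ⟨x, hx, hxs⟩ := hne
        rw [indicator_of_mem (hI n i ⟨x, hx, hxs⟩)]
        exact ediam_mono inter_subset_left
      · rw [not_nonempty_iff_eq_empty] at hne
        rw [hne]; simp
  have h2 : ∫⁻ s, liminf (fun n => g n s) atTop = 0 := by
    rw [← nonpos_iff_eq_zero]
    calc ∫⁻ s, liminf (fun n => g n s) atTop ≤ liminf (fun n => ∫⁻ s, g n s) atTop :=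
          lintegral_liminf_le hg
      _ ≤ liminf (fun n : ℕ => K * (0 + ((n : ℝ≥0∞) + 1)⁻¹)) atTop := by
        refine liminf_le_liminf (Eventually.of_forall ?_)
        intro n
        simp only [g]
        rw [lintegral_tsum (fun i => (measurable_const.indicator (hIm n i)).aemeasurable)]
        have := hs n
        rw [hA] at this
        refine le_trans ?_ (mul_le_mul_right this _)
        rw [← ENNReal.tsum_mul_left]
        apply ENNReal.tsum_le_tsum
        intro i
        rw [lintegral_indicator_const (hIm n i)]
        by_cases hne : (t n i).Nonempty
        · simp only [hne, iSup_pos]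
          have h3 : volume (I n i) ≤ K * ediam (t n i) :=
            (hIv n i).trans (hu.ediam_image_le _)
          calc ediam (t n i) * volume (I n i) ≤ ediam (t n i) * (K * ediam (t n i)) := by gcongr
            _ = K * ediam (t n i) ^ (2 : ℝ) := by
              rw [ENNReal.rpow_two]; ring
        · rw [not_nonempty_iff_eq_empty] at hne
          rw [hne]; simp
      _ = 0 := by
        apply Tendsto.liminf_eq
        have h1 : Tendsto (fun n : ℕ => (0 : ℝ≥0∞) + ((n : ℝ≥0∞) + 1)⁻¹) atTop (𝓝 (0 + 0)) :=
          tendsto_const_nhds.add tendsto_inv_nat_add_one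
        rw [add_zero] at h1
        simpa using ENNReal.Tendsto.const_mul h1 (Or.inr (ENNReal.coe_ne_top (r := K)))
  rw [lintegral_eq_zero_iff (Measurable.liminf hg)] at h2
  filter_upwards [h2] with s hs'
  have := h1 s
  rw [hs'] at this
  exact le_antisymm this bot_le

/-! ### Volume and two dimensional Hausdorff measure -/

lemma exists_vol_eq : ∃ c : NNReal, c ≠ 0 ∧ (volume : Measure E2) = c • μH[2] := by
  have h : (Module.finrank ℝ E2 : ℝ) = 2 := by simp
  have : Measure.IsAddHaarMeasure (μH[2] : Measure E2) := by
    rw [← h]; infer_instance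
  refine ⟨Measure.addHaarScalarFactor (volume : Measure E2) μH[2], ?_, ?_⟩
  · exact (Measure.addHaarScalarFactor_pos_of_isAddHaarMeasure _ _).ne'
  · exact Measure.isAddLeftInvariant_eq_smul _ _

lemma haus2_null_iff (A : Set E2) : μH[2] A = 0 ↔ volume A = 0 := by
  obtain ⟨c, hc, h⟩ := exists_vol_eq
  rw [h]; simp [hc]

lemma volume_null_of_haus1 (A : Set E2) (hA : μH[1] A ≠ ⊤) : volume A = 0 := by
  rw [← haus2_null_iff]
  rcases Measure.hausdorffMeasure_zero_or_top (show (1 : ℝ) < 2 by norm_num) A with h | h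
  · exact h
  · exact absurd h hA

lemma volume_image_le (f : E2 → E2) (s : Set E2) (K : NNReal) (h : LipschitzOnWith K f s) :
    volume (f '' s) ≤ (K : ℝ≥0∞) ^ 2 * volume s := by
  obtain ⟨c, hc, hv⟩ := exists_vol_eq
  have := h.hausdorffMeasure_image_le (d := 2) (by norm_num)
  rw [ENNReal.rpow_two] at this
  rw [hv]
  simp only [Measure.smul_apply, ENNReal.smul_def, smul_eq_mul]
  calc (c : ℝ≥0∞) * μH[2] (f '' s) ≤ c * (K ^ 2 * μH[2] s) := by gcongr
    _ = _ := by ring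

lemma volume_le_image (f : E2 → E2) (s : Set E2) (K : NNReal)
    (h : ∀ x ∈ s, ∀ y ∈ s, dist x y ≤ K * dist (f x) (f y)) :
    volume s ≤ (K : ℝ≥0∞) ^ 2 * volume (f '' s) := by
  obtain ⟨c, hc, hv⟩ := exists_vol_eq
  have := hausdorff_le_of_expand f s K h (d := 2) (by norm_num)
  rw [ENNReal.rpow_two] at this
  rw [hv]
  simp only [Measure.smul_apply, ENNReal.smul_def, smul_eq_mul]
  calc (c : ℝ≥0∞) * μH[2] s ≤ c * (K ^ 2 * μH[2] (f '' s)) := by gcongr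
    _ = _ := by ring


/-! ### Coarea formula for the distance function -/

lemma grad_dist_norm (Γ : Set E2) (hΓ : IsClosed Γ) (hne : Γ.Nonempty) (x : E2) (hx : x ∉ Γ)
    (A : E2 →L[ℝ] ℝ) (hA : HasFDerivAt (fun z => infDist z Γ) A x) : ‖A‖ = 1 := by
  apply le_antisymm
  · have := hA.le_of_lipschitz (lipschitz_infDist_pt Γ)
    simpa using this
  obtain ⟨y, hy, hxy⟩ := hΓ.exists_infDist_eq_dist hne x
  have hd : 0 < dist x y := dist_pos.mpr (fun h => hx (h ▸ hy))
  set ℓ := dist x y with hℓ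
  have hnorm : ‖y - x‖ = ℓ := by rw [hℓ, dist_comm, dist_eq_norm]
  set v : E2 := ℓ⁻¹ • (y - x) with hv
  have hvn : ‖v‖ = 1 := by
    rw [hv, norm_smul, hnorm, Real.norm_eq_abs, abs_of_pos (inv_pos.mpr hd)]
    field_simp
  have hlev : ∀ s ∈ Icc (0 : ℝ) ℓ, infDist (x + s • v) Γ = ℓ - s := by
    intro s hs
    apply le_antisymm
    · refine (infDist_le_dist_of_mem hy).trans ?_
      have : x + s • v - y = (-(1 - s / ℓ)) • (y - x) := by
        rw [hv, smul_smul, neg_smul, sub_smul, one_smul, div_eq_mul_inv]; abel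
      rw [dist_eq_norm, this, norm_smul, hnorm, Real.norm_eq_abs, abs_neg, abs_of_nonneg]
      · field_simp; exact le_rfl
      · rw [sub_nonneg, div_le_one hd]; exact hs.2
    · have h1 : infDist x Γ ≤ infDist (x + s • v) Γ + dist x (x + s • v) :=
        infDist_le_infDist_add_dist
      have h2 : dist x (x + s • v) = s := by
        rw [dist_eq_norm]
        simp [norm_smul, hvn, abs_of_nonneg hs.1]
      rw [hxy, h2] at h1
      linarith
  have h1 : HasDerivAt (fun s : ℝ => infDist (x + s • v) Γ) (A v) 0 := by
    have hl : HasDerivAt (fun s : ℝ => x + s • v) v 0 := by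
      simpa using ((hasDerivAt_id (0 : ℝ)).smul_const v).const_add x
    have hA' : HasFDerivAt (fun z => infDist z Γ) A (x + (0 : ℝ) • v) := by simpa using hA
    exact hA'.comp_hasDerivAt (0 : ℝ) hl
  have h2 : HasDerivWithinAt (fun s : ℝ => infDist (x + s • v) Γ) (-1) (Icc 0 ℓ) 0 := by
    have : HasDerivWithinAt (fun s : ℝ => ℓ - s) (-1) (Icc 0 ℓ) 0 := by
      simpa using ((hasDerivAt_id (0 : ℝ)).const_sub ℓ).hasDerivWithinAt
    apply this.congr
    · exact hlev
    · exact hlev 0 ⟨le_rfl, hd.le⟩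
  have h3 : A v = -1 :=
    (uniqueDiffOn_Icc hd 0 ⟨le_rfl, hd.le⟩).eq_deriv _ h1.hasDerivWithinAt h2
  have h4 := A.le_opNorm v
  rw [h3, hvn] at h4
  simpa using h4

lemma coarea_piece (B : Fr) (P : Set E2) (hP : MeasurableSet P) (f : E2 → ℝ) (hf : Continuous f)
    (δ : NNReal) (hδ : δ < 1)
    (h : ∀ x ∈ P, ∀ y ∈ P, |f x - f y - cp B (x - y)| ≤ δ * ‖x - y‖) :
    ∃ m : ℝ → ℝ≥0∞, Measurable m ∧
      (∀ s, m s ≤ μH[1] (P ∩ f ⁻¹' {s}) ∧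
        μH[1] (P ∩ f ⁻¹' {s}) ≤ ((1 - δ)⁻¹ : NNReal) * m s) ∧
      ∫⁻ s, m s ≤ ((1 + δ : NNReal) : ℝ≥0∞) ^ 2 * volume P ∧
      volume P ≤ (((1 - δ)⁻¹ : NNReal) : ℝ≥0∞) ^ 2 * ∫⁻ s, m s := by
  set F : E2 → E2 := fun x => mkp B (f x) (cq B x) with hF
  have hFc : Continuous F := by
    have : Continuous (cq B) := (cq_lip B).continuous
    simp only [hF, mkp]; fun_prop
  have hsub : ∀ x y, F x - F y = (x - y) + (f x - f y - cp B (x - y)) • B 0 := by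
    intro x y
    have h1 : x - y = (cp B x - cp B y) • B 0 + (cq B x - cq B y) • B 1 := by
      conv_lhs => rw [← mkp_cp_cq B x, ← mkp_cp_cq B y]
      simp only [mkp, sub_smul]; abel
    rw [cp_sub, h1]
    simp only [hF, mkp, sub_smul]; abel
  have hB0 : ‖B 0‖ = 1 := B.norm_eq_one 0
  have hup : ∀ x ∈ P, ∀ y ∈ P, dist (F x) (F y) ≤ (1 + δ : NNReal) * dist x y := by
    intro x hx y hy
    rw [dist_eq_norm, dist_eq_norm, hsub]
    refine (norm_add_le _ _).trans ?_
    rw [norm_smul, hB0, mul_one, Real.norm_eq_abs]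
    have := h x hx y hy
    push_cast
    linarith
  have hδ' : (δ : ℝ) < 1 := hδ
  have h1δ : (((1 - δ)⁻¹ : NNReal) : ℝ) = (1 - (δ : ℝ))⁻¹ := by
    rw [NNReal.coe_inv, NNReal.coe_sub hδ.le, NNReal.coe_one]
  have hlo : ∀ x ∈ P, ∀ y ∈ P, dist x y ≤ ((1 - δ)⁻¹ : NNReal) * dist (F x) (F y) := by
    intro x hx y hy
    rw [dist_eq_norm, dist_eq_norm, h1δ]
    have h2 : ‖x - y‖ ≤ ‖F x - F y‖ + ‖(f x - f y - cp B (x - y)) • B 0‖ := by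
      have : x - y = (F x - F y) - (f x - f y - cp B (x - y)) • B 0 := by rw [hsub]; abel
      calc ‖x - y‖ = ‖(F x - F y) - (f x - f y - cp B (x - y)) • B 0‖ := by rw [← this]
        _ ≤ _ := norm_sub_le _ _
    rw [norm_smul, hB0, mul_one, Real.norm_eq_abs] at h2
    have := h x hx y hy
    rw [inv_mul_eq_div, le_div_iff₀ (by linarith)]
    linarith
  have hinj : InjOn F P := by
    intro x hx y hy hxy
    have := hlo x hx y hy
    rw [hxy, dist_self, mul_zero] at this
    exact dist_le_zero.mp this
  have hFP : MeasurableSet (F '' P) := hP.image_of_continuousOn_injOn hFc.continuousOn hinj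
  have hslice : ∀ s, {y : ℝ | mkp B s y ∈ F '' P} = cq B '' (P ∩ f ⁻¹' {s}) := by
    intro s
    ext y
    constructor
    · rintro ⟨x, hx, hxy⟩
      refine ⟨x, ⟨hx, ?_⟩, ?_⟩
      · have := congrArg (cp B) hxy
        simpa [hF, cp_mkp] using this
      · have := congrArg (cq B) hxy
        simpa [hF, cq_mkp] using this
    · rintro ⟨x, ⟨hx, hxs⟩, rfl⟩
      refine ⟨x, hx, ?_⟩
      have hxs' : f x = s := hxs
      simp [hF, hxs']
  refine ⟨fun s => volume {y : ℝ | mkp B s y ∈ F '' P}, measurable_slice B hFP, ?_, ?_, ?_⟩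
  · intro s
    simp only [hslice]
    rw [← hausdorffMeasure_real]
    constructor
    · simpa using (cq_lip B).hausdorffMeasure_image_le (d := 1) (by norm_num) (P ∩ f ⁻¹' {s})
    · have := hausdorff_le_of_expand (cq B) (P ∩ f ⁻¹' {s}) ((1 - δ)⁻¹) ?_ (d := 1) (by norm_num)
      · simpa using this
      · rintro x ⟨hx, hxs⟩ y ⟨hy, hys⟩
        refine (hlo x hx y hy).trans ?_
        gcongr
        have hxs' : f x = s := hxs
        have hys' : f y = s := hys
        have : F x - F y = (cq B x - cq B y) • B 1 := by
          simp [hF, mkp, hxs', hys', sub_smul]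
        rw [dist_eq_norm, this, norm_smul, B.norm_eq_one, mul_one, dist_eq_norm]
  · rw [← volume_fr B hFP]
    exact volume_image_le F P _ (LipschitzOnWith.of_dist_le_mul hup)
  · rw [← volume_fr B hFP]
    exact volume_le_image F P _ hlo

lemma coarea_approx (Γ : Set E2) (hΓ : IsClosed Γ) (hne : Γ.Nonempty) (E : Set E2)
    (hE : MeasurableSet E) (hEΓ : Disjoint E Γ) (δ : NNReal) (hδ0 : 0 < δ) (hδ : δ < 1) :
    ∃ m : ℝ → ℝ≥0∞, Measurable m ∧
      (∀ᵐ s, m s ≤ μH[1] (E ∩ (fun z => infDist z Γ) ⁻¹' {s}) ∧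
        μH[1] (E ∩ (fun z => infDist z Γ) ⁻¹' {s}) ≤ ((1 - δ)⁻¹ : NNReal) * m s) ∧
      ∫⁻ s, m s ≤ ((1 + δ : NNReal) : ℝ≥0∞) ^ 2 * volume E ∧
      volume E ≤ (((1 - δ)⁻¹ : NNReal) : ℝ≥0∞) ^ 2 * ∫⁻ s, m s := by
  set f : E2 → ℝ := fun z => infDist z Γ with hf
  have hfl : LipschitzWith 1 f := lipschitz_infDist_pt Γ
  have hfc : Continuous f := hfl.continuous
  set D : Set E2 := {x | DifferentiableAt ℝ f x} with hD
  have hDm : MeasurableSet D := measurableSet_of_differentiableAt ℝ f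
  have hDnull : volume (E \ D) = 0 := by
    have h1 : ∀ᵐ x : E2, DifferentiableAt ℝ f x := hfl.ae_differentiableAt
    exact measure_mono_null (fun x hx => hx.2) (ae_iff.mp h1)
  set E' := E ∩ D with hE'
  have hE'm : MeasurableSet E' := hE.inter hDm
  obtain ⟨t, A, hdisj, htm, hcov, happ, hAe⟩ :=
    exists_partition_approximatesLinearOn_of_hasFDerivWithinAt f E' (fderiv ℝ f)
      (fun x hx => (DifferentiableAt.hasFDerivAt hx.2).hasFDerivWithinAt) (fun _ => δ)
      (fun _ => hδ0.ne')
  have hpiece : ∀ n, ∃ m : ℝ → ℝ≥0∞, Measurable m ∧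
      (∀ s, m s ≤ μH[1] ((E' ∩ t n) ∩ f ⁻¹' {s}) ∧
        μH[1] ((E' ∩ t n) ∩ f ⁻¹' {s}) ≤ ((1 - δ)⁻¹ : NNReal) * m s) ∧
      ∫⁻ s, m s ≤ ((1 + δ : NNReal) : ℝ≥0∞) ^ 2 * volume (E' ∩ t n) ∧
      volume (E' ∩ t n) ≤ (((1 - δ)⁻¹ : NNReal) : ℝ≥0∞) ^ 2 * ∫⁻ s, m s := by
    intro n
    rcases E'.eq_empty_or_nonempty with hem | hnem
    · refine ⟨fun _ => 0, measurable_const, ?_, ?_, ?_⟩ <;> simp [hem]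
    obtain ⟨y, hy, hAy⟩ := hAe hnem n
    have hA1 : ‖A n‖ = 1 := by
      rw [hAy]
      exact grad_dist_norm Γ hΓ hne y (fun h => hEΓ.le_bot ⟨hy.1, h⟩) _
        (DifferentiableAt.hasFDerivAt hy.2)
    obtain ⟨B, hB⟩ := exists_frame ((InnerProductSpace.toDual ℝ E2).symm (A n)) (by simpa using hA1)
    apply coarea_piece B _ (hE'm.inter (htm n)) f hfc δ hδ
    intro x hx y hy
    have h1 := happ n x hx y hy
    have h2 : cp B (x - y) = A n (x - y) := by
      rw [cp, B.repr_apply_apply, hB, InnerProductSpace.toDual_symm_apply]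
    rw [h2]
    exact h1
  choose m hm hms hmi hmv using hpiece
  have hdisj' : Pairwise (Function.onFun Disjoint (fun n => E' ∩ t n)) := by
    intro i j hij
    exact (hdisj hij).mono inter_subset_right inter_subset_right
  have hEunion : E' = ⋃ n, E' ∩ t n := by
    rw [← inter_iUnion]; exact (inter_eq_left.mpr hcov).symm
  have hvolE : volume E = ∑' n, volume (E' ∩ t n) := by
    rw [← measure_iUnion hdisj' (fun n => hE'm.inter (htm n)), ← hEunion]
    rw [← measure_inter_add_sdiff E hDm, hDnull, add_zero]
  have hlevm : ∀ s, MeasurableSet (f ⁻¹' {s}) := fun s =>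
    (isClosed_singleton.preimage hfc).measurableSet
  refine ⟨fun s => ∑' n, m n s, Measurable.tsum hm, ?_, ?_, ?_⟩
  · have hnull := eilenberg_null (E \ D) ((haus2_null_iff _).mpr hDnull) f 1 hfl
    filter_upwards [hnull] with s hs
    have key : μH[1] (E' ∩ f ⁻¹' {s}) = ∑' n, μH[1] ((E' ∩ t n) ∩ f ⁻¹' {s}) := by
      rw [← measure_iUnion]
      · rw [← iUnion_inter, ← hEunion]
      · intro i j hij
        exact (hdisj' hij).mono inter_subset_left inter_subset_left
      · exact fun n => (hE'm.inter (htm n)).inter (hlevm s)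
    have h2 : μH[1] (E ∩ f ⁻¹' {s}) = μH[1] (E' ∩ f ⁻¹' {s}) := by
      apply le_antisymm
      · calc μH[1] (E ∩ f ⁻¹' {s}) ≤ μH[1] ((E' ∩ f ⁻¹' {s}) ∪ ((E \ D) ∩ f ⁻¹' {s})) := by
              apply measure_mono
              rintro x ⟨hx, hxs⟩
              by_cases hxD : x ∈ D
              · exact Or.inl ⟨⟨hx, hxD⟩, hxs⟩
              · exact Or.inr ⟨⟨hx, hxD⟩, hxs⟩
          _ ≤ _ := measure_union_le _ _
          _ = _ := by rw [hs, add_zero]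
      · exact measure_mono (inter_subset_inter_left _ inter_subset_left)
    rw [h2, key, ← ENNReal.tsum_mul_left]
    exact ⟨ENNReal.tsum_le_tsum (fun n => (hms n s).1), ENNReal.tsum_le_tsum (fun n => (hms n s).2)⟩
  · rw [lintegral_tsum (fun n => (hm n).aemeasurable), hvolE, ← ENNReal.tsum_mul_left]
    exact ENNReal.tsum_le_tsum hmi
  · rw [lintegral_tsum (fun n => (hm n).aemeasurable), hvolE, ← ENNReal.tsum_mul_left]
    exact ENNReal.tsum_le_tsum hmv

lemma coarea_dist (Γ : Set E2) (hΓ : IsClosed Γ) (hne : Γ.Nonempty) (E : Set E2)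
    (hE : MeasurableSet E) (hEΓ : Disjoint E Γ) :
    AEMeasurable (fun s => μH[1] (E ∩ (fun z => infDist z Γ) ⁻¹' {s})) ∧
    ∫⁻ s, μH[1] (E ∩ (fun z => infDist z Γ) ⁻¹' {s}) = volume E := by
  set ell : ℝ → ℝ≥0∞ := fun s => μH[1] (E ∩ (fun z => infDist z Γ) ⁻¹' {s}) with hell
  set δ : ℕ → NNReal := fun n => ((n : NNReal) + 2)⁻¹ with hδ
  have hδ0 : ∀ n, 0 < δ n := fun n => by simp only [hδ]; positivity
  have hδ1 : ∀ n, δ n < 1 := fun n => by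
    simp only [hδ]
    rw [inv_lt_one₀ (by positivity)]
    calc (1 : NNReal) < 2 := by norm_num
      _ ≤ _ := le_add_self
  have hδt : Tendsto δ atTop (𝓝 0) := by
    rw [← NNReal.tendsto_coe]
    have h1 : Tendsto (fun n : ℕ => (n : ℝ) + 2) atTop atTop :=
      tendsto_atTop_add_const_right _ _ tendsto_natCast_atTop_atTop
    refine h1.inv_tendsto_atTop.congr ?_
    intro n; simp [hδ]
  choose m hm hms hmi hmv using fun n =>
    coarea_approx Γ hΓ hne E hE hEΓ (δ n) (hδ0 n) (hδ1 n)
  have hK : Tendsto (fun n => (((1 - δ n)⁻¹ : NNReal) : ℝ≥0∞)) atTop (𝓝 1) := by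
    have h1 : Tendsto (fun n => (1 - δ n)⁻¹) atTop (𝓝 ((1 - 0)⁻¹ : NNReal)) :=
      (tendsto_const_nhds.sub hδt).inv₀ (by simp)
    have h2 := ENNReal.tendsto_coe.mpr h1
    simpa using h2
  have hK' : Tendsto (fun n => ((1 + δ n : NNReal) : ℝ≥0∞)) atTop (𝓝 1) := by
    have h1 : Tendsto (fun n => (1 + δ n)) atTop (𝓝 ((1 + 0) : NNReal)) :=
      tendsto_const_nhds.add hδt
    have h2 := ENNReal.tendsto_coe.mpr h1
    simpa using h2
  have hall := ae_all_iff.mpr hms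
  have heq : ell =ᵐ[volume] fun s => ⨆ n, m n s := by
    filter_upwards [hall] with s hs
    apply le_antisymm
    · have h1 : ∀ n, ell s ≤ ((1 - δ n)⁻¹ : NNReal) * ⨆ k, m k s := fun n =>
        (hs n).2.trans (by gcongr; exact le_iSup (fun k => m k s) n)
      have h2 : Tendsto (fun n => (((1 - δ n)⁻¹ : NNReal) : ℝ≥0∞) * ⨆ k, m k s) atTop
          (𝓝 (1 * ⨆ k, m k s)) :=
        ENNReal.Tendsto.mul_const hK (Or.inl one_ne_zero)
      rw [one_mul] at h2
      exact ge_of_tendsto' h2 h1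
    · exact iSup_le (fun n => (hs n).1)
  have hae : AEMeasurable ell := ⟨_, Measurable.iSup hm, heq⟩
  refine ⟨hae, ?_⟩
  have hle : ∀ n, ∫⁻ s, m n s ≤ ∫⁻ s, ell s := fun n =>
    lintegral_mono_ae ((hms n).mono fun s hs => hs.1)
  have hge : ∀ n, ∫⁻ s, ell s ≤ ((1 - δ n)⁻¹ : NNReal) * ∫⁻ s, m n s := fun n => by
    rw [← lintegral_const_mul _ (hm n)]
    exact lintegral_mono_ae ((hms n).mono fun s hs => hs.2)
  apply le_antisymm
  · have h1 : ∀ n, ∫⁻ s, ell s ≤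
        ((1 - δ n)⁻¹ : NNReal) * (((1 + δ n : NNReal) : ℝ≥0∞) ^ 2) * volume E := fun n => by
      refine (hge n).trans ?_
      rw [mul_assoc]
      gcongr
      exact hmi n
    have h2 : Tendsto (fun n => (((1 - δ n)⁻¹ : NNReal) : ℝ≥0∞) *
        (((1 + δ n : NNReal) : ℝ≥0∞) ^ 2) * volume E) atTop (𝓝 (1 * 1 ^ 2 * volume E)) := by
      apply ENNReal.Tendsto.mul_const _ (Or.inl (by simp))
      exact ENNReal.Tendsto.mul hK (Or.inl one_ne_zero) (ENNReal.Tendsto.pow hK')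
        (Or.inl (by simp))
    simp only [one_pow, one_mul] at h2
    exact ge_of_tendsto' h2 h1
  · have h1 : ∀ n, volume E ≤ (((1 - δ n)⁻¹ : NNReal) : ℝ≥0∞) ^ 2 * ∫⁻ s, ell s := fun n => by
      refine (hmv n).trans ?_
      exact mul_le_mul' le_rfl (hle n)
    have h2 : Tendsto (fun n => (((1 - δ n)⁻¹ : NNReal) : ℝ≥0∞) ^ 2 * ∫⁻ s, ell s) atTop
        (𝓝 (1 ^ 2 * ∫⁻ s, ell s)) :=
      ENNReal.Tendsto.mul_const (ENNReal.Tendsto.pow hK) (Or.inl (by simp))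
    simp only [one_pow, one_mul] at h2
    exact ge_of_tendsto' h2 h1


lemma Lfun_integral (Ω : Set E2) (hO : IsOpen Ω) (hb : IsBounded Ω)
    (hne : (frontier Ω).Nonempty) (r : ℝ) (hr : 0 < r) :
    ∫ t in (0:ℝ)..r, Lfun Ω t = (volume (Ω ∩ thickening r (frontier Ω))).toReal := by
  set Γ := frontier Ω with hΓ
  have hcl : IsClosed Γ := isClosed_frontier
  set E := Ω ∩ thickening r Γ with hE
  have hdis : Disjoint E Γ := by
    have : Disjoint Ω Γ := disjoint_iff_inter_eq_empty.2 hO.inter_frontier_eq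
    exact this.mono_left inter_subset_left
  have hEm : MeasurableSet E := (hO.inter isOpen_thickening).measurableSet
  obtain ⟨h1, h2⟩ := coarea_dist Γ hcl hne E hEm hdis
  have hfin : volume E ≠ ⊤ := ((hb.subset inter_subset_left).measure_lt_top).ne
  have hth : ∀ z, z ∈ thickening r Γ ↔ infDist z Γ < r := fun z => by
    rw [mem_thickening_iff_infDist_lt hne]
  have hpos : ∀ z ∈ Ω, 0 < infDist z Γ := fun z hz => by
    rw [← hcl.notMem_iff_infDist_pos hne]
    exact fun h => (disjoint_iff_inter_eq_empty.2 hO.inter_frontier_eq).le_bot ⟨hz, h⟩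
  set ell := fun s => μH[1] (E ∩ (fun z => infDist z Γ) ⁻¹' {s}) with hell
  have e1 : ∀ t ∈ Ioo 0 r, Lfun Ω t = (ell t).toReal := by
    intro t ht
    simp only [Lfun, hell]
    congr 2
    ext z
    simp only [mem_ofPred_eq, hE, mem_inter_iff, hth, mem_preimage, mem_singleton_iff]
    constructor
    · rintro ⟨a, b⟩; exact ⟨⟨a, by rw [b]; exact ht.2⟩, b⟩
    · rintro ⟨⟨a, -⟩, b⟩; exact ⟨a, b⟩
  have e2 : ∀ t, t ∉ Ioo 0 r → ell t = 0 := by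
    intro t ht
    simp only [hell]
    have : E ∩ (fun z => infDist z Γ) ⁻¹' {t} = ∅ := by
      ext z
      simp only [mem_inter_iff, mem_preimage, mem_singleton_iff, mem_empty_iff_false, iff_false]
      rintro ⟨⟨a, b⟩, c⟩
      exact ht ⟨c ▸ hpos z a, c ▸ (hth z).1 b⟩
    rw [this]; simp
  rw [intervalIntegral.integral_of_le hr.le]
  rw [integral_Ioc_eq_integral_Ioo, setIntegral_congr_fun measurableSet_Ioo e1]
  rw [setIntegral_eq_integral_of_forall_compl_eq_zero (fun t ht => by rw [e2 t ht]; simp)]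
  rw [integral_toReal h1, h2]
  apply ae_lt_top' h1
  rw [h2]; exact hfin

/-! ### lower density, nets, parametrisation of continua -/

lemma ld (G : Set E2) (hG : IsPreconnected G) {x y : E2} (hx : x ∈ G) (hy : y ∈ G) (ρ : ℝ)
    (hρ : ρ ≤ dist x y) : ENNReal.ofReal ρ ≤ μH[1] (G ∩ ball x ρ) := by
  have hf : LipschitzWith 1 (fun z => dist x z) := LipschitzWith.dist_right x
  have h1 : Ico 0 ρ ⊆ (fun z => dist x z) '' (G ∩ ball x ρ) := by
    intro t ht
    have := hG.intermediate_value hx hy (hf.continuous.continuousOn)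
    obtain ⟨z, hz, hzt⟩ := this ⟨by simpa using ht.1, ht.2.le.trans hρ⟩
    refine ⟨z, ⟨hz, ?_⟩, hzt⟩
    rw [mem_ball, dist_comm]
    simp only at hzt
    rw [hzt]; exact ht.2
  have h2 := (hf.lipschitzOnWith (s := G ∩ ball x ρ)).hausdorffMeasure_image_le (d := 1)
    (by norm_num)
  rw [hausdorffMeasure_real] at h2
  have h3 := measure_mono (μ := volume) h1
  rw [Real.volume_Ico, sub_zero] at h3
  simpa using h3.trans h2

lemma sep_count (μ : Measure E2) (A : Set E2) (S : Finset E2) (ρ : ℝ) (c : ℝ≥0∞)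
    (hsep : ∀ x ∈ S, ∀ y ∈ S, x ≠ y → 2 * ρ ≤ dist x y)
    (hc : ∀ x ∈ S, c ≤ μ (A ∩ ball x ρ)) : S.card * c ≤ μ A := by
  have h1 : (μ.restrict A) (⋃ x ∈ S, ball x ρ) = ∑ x ∈ S, (μ.restrict A) (ball x ρ) := by
    apply measure_biUnion_finset
    · intro x hx y hy hxy
      apply ball_disjoint_ball
      linarith [hsep x hx y hy hxy]
    · exact fun x _ => measurableSet_ball
  calc S.card * c = ∑ x ∈ S, c := by simp
    _ ≤ ∑ x ∈ S, (μ.restrict A) (ball x ρ) := by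
      refine Finset.sum_le_sum fun x hx => ?_
      rw [Measure.restrict_apply measurableSet_ball, inter_comm]
      exact hc x hx
    _ = _ := h1.symm
    _ ≤ (μ.restrict A) univ := measure_mono (subset_univ _)
    _ = μ A := by simp

lemma exists_net (A : Set E2) (δ : ℝ) (N : ℕ)
    (hN : ∀ S : Finset E2, ↑S ⊆ A → (∀ x ∈ S, ∀ y ∈ S, x ≠ y → δ ≤ dist x y) → S.card ≤ N) :
    ∃ S : Finset E2, ↑S ⊆ A ∧ (∀ x ∈ S, ∀ y ∈ S, x ≠ y → δ ≤ dist x y) ∧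
      ∀ x ∈ A, ∃ y ∈ S, x = y ∨ dist x y < δ := by
  classical
  by_contra! hcon
  have : ∀ n : ℕ, ∃ S : Finset E2, S.card = n ∧ ↑S ⊆ A ∧
      (∀ x ∈ S, ∀ y ∈ S, x ≠ y → δ ≤ dist x y) := by
    intro n
    induction n with
    | zero => exact ⟨∅, by simp⟩
    | succ n ih =>
      obtain ⟨S, hS, hSA, hs⟩ := ih
      obtain ⟨x, hxA, hx⟩ := hcon S hSA hs
      have hxS : x ∉ S := fun h => (hx x h).1 rfl
      refine ⟨insert x S, by rw [Finset.card_insert_of_notMem hxS, hS], ?_, ?_⟩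
      · simp only [Finset.coe_insert, insert_subset_iff]; exact ⟨hxA, hSA⟩
      · intro a ha b hb hab
        rw [Finset.mem_insert] at ha hb
        rcases ha with rfl | ha <;> rcases hb with rfl | hb
        · exact absurd rfl hab
        · exact (hx b hb).2
        · rw [dist_comm]; exact (hx a ha).2
        · exact hs a ha b hb hab
  obtain ⟨S, hS, hSA, hs⟩ := this (N + 1)
  have := hN S hSA hs
  omega

lemma exists_walk (G : Set E2) (hG : IsPreconnected G) (S : Finset E2) (hS : S.Nonempty)
    (hSG : ↑S ⊆ G) (δ : ℝ) (hδ : 0 < δ) (hcov : ∀ x ∈ G, ∃ y ∈ S, dist x y < δ) :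
    ∃ (m : ℕ) (g : ℕ → E2), m ≤ 2 * S.card ∧ (∀ i, g i ∈ S) ∧
      (∀ i, dist (g i) (g (i + 1)) ≤ 2 * δ) ∧ ∀ x ∈ S, ∃ i < m, g i = x := by
  classical
  have key : ∀ k, 1 ≤ k → k ≤ S.card → ∃ (T : Finset E2) (m : ℕ) (g : ℕ → E2), T ⊆ S ∧ T.card = k ∧
      m ≤ 2 * k ∧ (∀ i, g i ∈ S) ∧
      (∀ i, dist (g i) (g (i + 1)) ≤ 2 * δ) ∧ ∀ x ∈ T, ∃ i < m, g i = x := by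
    intro k hk
    induction k, hk using Nat.le_induction with
    | base =>
      intro _
      obtain ⟨x, hx⟩ := hS
      refine ⟨{x}, 1, fun _ => x, by simpa using hx, by simp, by simp, fun _ => hx, ?_, ?_⟩
      · intro i; simp; positivity
      · intro y hy; exact ⟨0, by simp, by simpa using (Finset.mem_singleton.1 hy).symm⟩
    | succ k hk ih =>
      intro hk1
      obtain ⟨T, m, g, hTS, hTk, hm, hgS, hgd, hgT⟩ := ih (by omega)
      have hne : T.Nonempty := by rw [← Finset.card_pos]; omega
      have hex : ∃ v ∈ T, ∃ w ∈ S, w ∉ T ∧ dist v w < 2 * δ := by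
        by_contra! hcon
        have hU : IsOpen (⋃ x ∈ T, ball x δ) := isOpen_biUnion fun _ _ => isOpen_ball
        have hV : IsOpen (⋃ x ∈ S \ T, ball x δ) := isOpen_biUnion fun _ _ => isOpen_ball
        have hUV : G ⊆ (⋃ x ∈ T, ball x δ) ∪ (⋃ x ∈ S \ T, ball x δ) := by
          intro x hx
          obtain ⟨y, hy, hxy⟩ := hcov x hx
          by_cases hyT : y ∈ T
          · left; simp only [mem_iUnion]; exact ⟨y, hyT, hxy⟩
          · right; simp only [mem_iUnion]; exact ⟨y, by simp [hy, hyT], hxy⟩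
        obtain ⟨v, hv⟩ := hne
        have hlt : (S \ T).Nonempty := by
          rw [← Finset.card_pos, Finset.card_sdiff_of_subset hTS]; omega
        obtain ⟨w, hw⟩ := hlt
        have := hG _ _ hU hV hUV
          ⟨v, hSG (hTS hv), by simp only [mem_iUnion]; exact ⟨v, hv, by simpa using hδ⟩⟩
          ⟨w, hSG (Finset.mem_sdiff.1 hw).1, by
            simp only [mem_iUnion]; exact ⟨w, hw, by simpa using hδ⟩⟩
        obtain ⟨z, -, hz1, hz2⟩ := this
        simp only [mem_iUnion] at hz1 hz2
        obtain ⟨a, ha, hza⟩ := hz1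
        obtain ⟨b, hb, hzb⟩ := hz2
        have h1 := hcon a ha b (Finset.mem_sdiff.1 hb).1 (Finset.mem_sdiff.1 hb).2
        have h2 := dist_triangle_left a b z
        rw [mem_ball] at hza hzb
        linarith
      obtain ⟨v, hv, w, hw, hwT, hvw⟩ := hex
      obtain ⟨i, him, hi⟩ := hgT v hv
      refine ⟨insert w T, m + 2, fun j => if j ≤ i then g j else if j = i + 1 then w else g (j - 2),
        ?_, ?_, by omega, ?_, ?_, ?_⟩
      · intro a ha
        rcases Finset.mem_insert.1 ha with rfl | h
        exacts [hw, hTS h]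
      · rw [Finset.card_insert_of_notMem hwT, hTk]
      · intro j; dsimp only; split_ifs
        exacts [hgS _, hw, hgS _]
      · intro j
        dsimp only
        rcases lt_trichotomy j i with h | h | h
        · rw [if_pos (by omega), if_pos (by omega)]; exact hgd j
        · subst h
          rw [if_pos le_rfl, if_neg (by omega), if_pos rfl, hi]; exact hvw.le
        · by_cases h2 : j = i + 1
          · subst h2
            rw [if_neg (by omega), if_pos rfl, if_neg (by omega), if_neg (by omega)]
            rw [show i + 1 + 1 - 2 = i by omega, hi, dist_comm]; exact hvw.le
          · rw [if_neg (by omega), if_neg h2, if_neg (by omega), if_neg (by omega)]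
            have := hgd (j - 2)
            rwa [show j - 2 + 1 = j + 1 - 2 by omega] at this
      · intro x hx
        rcases Finset.mem_insert.1 hx with rfl | h
        · refine ⟨i + 1, by omega, ?_⟩; simp
        · obtain ⟨k', hk', hgk⟩ := hgT x h
          by_cases hki : k' ≤ i
          · exact ⟨k', by omega, by simp [hki, hgk]⟩
          · refine ⟨k' + 2, by omega, ?_⟩
            dsimp only
            rw [if_neg (by omega), if_neg (by omega)]; simpa using hgk
  obtain ⟨T, m, g, hTS, hTk, hm, h⟩ := key S.card hS.card_pos le_rfl
  obtain rfl := Finset.eq_of_subset_of_card_le hTS hTk.ge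
  exact ⟨m, g, hm, h⟩

lemma nat_floor_dist (a b : ℝ) : |((⌊a⌋₊ : ℝ)) - (⌊b⌋₊ : ℝ)| ≤ |a - b| + 1 := by
  have key : ∀ a b : ℝ, ((⌊a⌋₊ : ℝ)) - (⌊b⌋₊ : ℝ) ≤ |a - b| + 1 := by
    intro a b
    rcases le_or_gt 0 a with ha | ha
    · have h1 := Nat.floor_le ha
      have h2 := (Nat.lt_floor_add_one b).le
      linarith [le_abs_self (a - b)]
    · rw [Nat.floor_of_nonpos ha.le]
      have : (0 : ℝ) ≤ (⌊b⌋₊ : ℝ) := by positivity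
      push_cast
      linarith [abs_nonneg (a - b)]
  rw [abs_le]
  constructor
  · have := key b a; rw [abs_sub_comm] at this; linarith
  · exact key a b

lemma walk_dist (g : ℕ → E2) (c : ℝ) (hg : ∀ i, dist (g i) (g (i + 1)) ≤ c) (i j : ℕ) :
    dist (g i) (g j) ≤ c * |(i : ℝ) - j| := by
  wlog h : i ≤ j generalizing i j
  · rw [dist_comm, abs_sub_comm]; exact this j i (by omega)
  have := dist_le_Ico_sum_of_dist_le h (d := fun _ => c) (fun {k} _ _ => hg k)
  simp only [Finset.sum_const, Nat.card_Ico, nsmul_eq_mul] at this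
  rw [abs_sub_comm, abs_of_nonneg (by simpa using h)]
  rw [Nat.cast_sub h] at this; linarith

/-- A continuum of finite length is a Lipschitz image. -/
lemma exists_param (G : Set E2) (hc : IsCompact G) (hG : IsConnected G) (hH : μH[1] G ≠ ⊤) :
    ∃ (K : NNReal) (γ : ℝ → E2), LipschitzWith K γ ∧ γ '' (Icc 0 1) = G := by
  obtain ⟨x0, hx0⟩ := hG.nonempty
  by_cases hsub : ∀ y ∈ G, y = x0
  · refine ⟨0, fun _ => x0, LipschitzWith.const _, ?_⟩
    have : G = {x0} := by ext z; exact ⟨fun h => hsub z h, fun h => by rw [h]; exact hx0⟩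
    rw [this]; simp
  push Not at hsub
  obtain ⟨y0, hy0, hne⟩ := hsub
  set D := dist y0 x0 / 2 with hD
  have hDpos : 0 < D := by have := dist_pos.2 hne; positivity
  have hfar : ∀ x ∈ G, ∃ y ∈ G, D ≤ dist x y := by
    intro x hx
    by_contra! hcon
    have h1 := hcon x0 hx0
    have h2 := hcon y0 hy0
    have := dist_triangle_left y0 x0 x
    rw [hD] at h1 h2; linarith
  set H := (μH[1] G).toReal with hHdef
  have hstep : ∀ n : ℕ, ∃ (m : ℕ) (g : ℕ → E2), (∀ i, g i ∈ G) ∧ 0 < m ∧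
      (m : ℝ) * (D / (n + 1)) ≤ 4 * H ∧
      (∀ i, dist (g i) (g (i + 1)) ≤ 2 * (D / (n + 1))) ∧
      ∀ x ∈ G, ∃ i < m, dist x (g i) < D / (n + 1) := by
    intro n
    set δ := D / (n + 1) with hδ
    have hδpos : 0 < δ := by positivity
    have hδD : δ ≤ D := by
      rw [hδ]; apply div_le_self hDpos.le; have : (0:ℝ) ≤ n := by positivity
      linarith
    have hcard : ∀ S : Finset E2, ↑S ⊆ G → (∀ x ∈ S, ∀ y ∈ S, x ≠ y → δ ≤ dist x y) →
        (S.card : ℝ) * δ ≤ 2 * H := by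
      intro S hS hs
      have := sep_count μH[1] G S (δ / 2) (ENNReal.ofReal (δ / 2))
        (fun x hx y hy hxy => by linarith [hs x hx y hy hxy]) (fun x hx => by
          obtain ⟨y, hy, hxy⟩ := hfar x (hS hx)
          exact ld G hG.isPreconnected (hS hx) hy _ (by linarith))
      have := ENNReal.toReal_mono hH this
      rw [ENNReal.toReal_mul, ENNReal.toReal_natCast, ENNReal.toReal_ofReal (by positivity)] at this
      linarith
    obtain ⟨S, hSG, hs, hcov⟩ := exists_net G δ ⌈2 * H / δ⌉₊ (fun S h1 h2 => by
      have := hcard S h1 h2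
      have h3 : (S.card : ℝ) ≤ 2 * H / δ := by rw [le_div_iff₀ hδpos]; exact this
      exact_mod_cast h3.trans (Nat.le_ceil _))
    have hcov' : ∀ x ∈ G, ∃ y ∈ S, dist x y < δ := by
      intro x hx
      obtain ⟨y, hy, h⟩ := hcov x hx
      refine ⟨y, hy, ?_⟩
      rcases h with rfl | h
      · simpa using hδpos
      · exact h
    have hSne : S.Nonempty := by obtain ⟨y, hy, -⟩ := hcov' x0 hx0; exact ⟨y, hy⟩
    obtain ⟨m, g, hm, hgS, hgd, hgc⟩ := exists_walk G hG.isPreconnected S hSne hSG δ hδpos hcov'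
    refine ⟨m, g, fun i => hSG (hgS i), ?_, ?_, hgd, ?_⟩
    · obtain ⟨y, hy⟩ := hSne
      obtain ⟨i, hi, -⟩ := hgc y hy; omega
    · have h1 := hcard S hSG hs
      have h2 : (m : ℝ) ≤ 2 * S.card := by exact_mod_cast hm
      nlinarith
    · intro x hx
      obtain ⟨y, hy, h⟩ := hcov' x hx
      obtain ⟨i, hi, rfl⟩ := hgc y hy
      exact ⟨i, hi, h⟩
  choose m g hgG hm0 hmH hgd hgc using hstep
  set f : ℕ → ℝ → E2 := fun n t => g n ⌊t * m n⌋₊ with hf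
  have hfd : ∀ n t s, dist (f n t) (f n s) ≤ 8 * H * |t - s| + 2 * (D / (n + 1)) := by
    intro n t s
    have h1 := walk_dist (g n) _ (hgd n) ⌊t * m n⌋₊ ⌊s * m n⌋₊
    have h2 := nat_floor_dist (t * m n) (s * m n)
    rw [← sub_mul, abs_mul, abs_of_nonneg (by positivity : (0:ℝ) ≤ m n)] at h2
    have hδ : 0 < D / ((n : ℝ) + 1) := by positivity
    calc dist (f n t) (f n s) ≤ _ := h1
      _ ≤ 2 * (D / (n + 1)) * (|t - s| * m n + 1) := by gcongr
      _ = 2 * |t - s| * (m n * (D / (n + 1))) + 2 * (D / (n + 1)) := by ring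
      _ ≤ 2 * |t - s| * (4 * H) + 2 * (D / (n + 1)) := by
        have := mul_le_mul_of_nonneg_left (hmH n) (by positivity : 0 ≤ 2 * |t - s|)
        linarith
      _ = _ := by ring
  let U : Ultrafilter ℕ := hyperfilter ℕ
  have hU : (U : Filter ℕ) ≤ atTop := Nat.hyperfilter_le_atTop
  have hlim : ∀ t, ∃ z ∈ G, Tendsto (fun n => f n t) U (𝓝 z) := by
    intro t
    obtain ⟨z, hz, h⟩ := hc.ultrafilter_le_nhds (U.map (fun n => f n t)) (by
      rw [le_principal_iff]
      exact Ultrafilter.mem_map.2 (Filter.univ_mem' (f := (U : Filter ℕ)) (fun n => hgG n _)))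
    exact ⟨z, hz, h⟩
  choose γ hγG hγ using hlim
  have hδ0 : Tendsto (fun n : ℕ => 2 * (D / ((n : ℝ) + 1))) U (𝓝 0) := by
    have := (tendsto_const_div_atTop_nhds_zero_nat D).comp (tendsto_add_atTop_nat 1)
    have := (this.const_mul 2).mono_left hU
    simpa using this
  have hH0 : 0 ≤ H := ENNReal.toReal_nonneg
  refine ⟨⟨8 * H, by positivity⟩, γ, ?_, ?_⟩
  · apply LipschitzWith.of_dist_le_mul
    intro t s
    have h1 := (hγ t).dist (hγ s)
    have h2 : Tendsto (fun n : ℕ => 8 * H * |t - s| + 2 * (D / ((n : ℝ) + 1))) U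
      (𝓝 (8 * H * |t - s| + 0)) := tendsto_const_nhds.add hδ0
    have := le_of_tendsto_of_tendsto' h1 h2 (fun n => hfd n t s)
    rw [Real.dist_eq]
    rw [add_zero] at this
    exact this
  · apply Subset.antisymm
    · rintro _ ⟨t, -, rfl⟩; exact hγG t
    · intro x hx
      choose i him hi using fun n => hgc n x hx
      have htI : ∀ n, (i n : ℝ) / m n ∈ Icc (0:ℝ) 1 := by
        intro n
        refine ⟨by positivity, ?_⟩
        apply div_le_one_of_le₀ _ (by positivity)
        exact_mod_cast (him n).le
      obtain ⟨t, ht, hlt⟩ := (isCompact_Icc (a := (0:ℝ)) (b := 1)).ultrafilter_le_nhds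
        (U.map (fun n => (i n : ℝ) / m n)) (by
        rw [le_principal_iff]
        exact Ultrafilter.mem_map.2 (Filter.univ_mem' (f := (U : Filter ℕ)) htI))
      have hlt' : Tendsto (fun n => (i n : ℝ) / m n) U (𝓝 t) := hlt
      refine ⟨t, ht, ?_⟩
      have h1 : ∀ n, dist (f n t) x ≤
          8 * H * |t - (i n : ℝ) / m n| + 2 * (D / (n + 1)) + 2 * (D / (n + 1)) := by
        intro n
        have e : f n ((i n : ℝ) / m n) = g n (i n) := by
          simp only [hf]
          rw [div_mul_cancel₀ _ (by exact_mod_cast (hm0 n).ne'), Nat.floor_natCast]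
        have h2 := hfd n t ((i n : ℝ) / m n)
        rw [e] at h2
        have h3 := hi n
        have h4 := dist_triangle_right (f n t) x (g n (i n))
        have hδ : 0 < D / ((n : ℝ) + 1) := by positivity
        linarith
      have h2 : Tendsto (fun n => 8 * H * |t - (i n : ℝ) / m n| + 2 * (D / ((n:ℝ) + 1))
          + 2 * (D / ((n:ℝ) + 1))) U (𝓝 (8 * H * |t - t| + 0 + 0)) :=
        (((tendsto_const_nhds.sub hlt').abs.const_mul _).add hδ0).add hδ0
      have h3 := le_of_tendsto_of_tendsto' ((hγ t).dist (tendsto_const_nhds (x := x))) h2 h1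
      simp only [sub_self, abs_zero, mul_zero, add_zero] at h3
      exact dist_le_zero.1 h3

/-! ### flat pieces -/

def Flat (B : Fr) (ε : ℝ) (F : Set E2) : Prop :=
  ∀ x ∈ F, ∀ y ∈ F, |cq B (x - y)| ≤ ε * |cp B (x - y)|

lemma Flat.mono {B : Fr} {ε : ℝ} {F F' : Set E2} (h : Flat B ε F) (hs : F' ⊆ F) : Flat B ε F' :=
  fun x hx y hy => h x (hs hx) y (hs hy)

lemma continuous_cp (B : Fr) : Continuous (cp B) := (cp_lip B).continuous
lemma continuous_cq (B : Fr) : Continuous (cq B) := (cq_lip B).continuous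

lemma Flat.closure {B : Fr} {ε : ℝ} {F : Set E2} (h : Flat B ε F) : Flat B ε (closure F) := by
  have hcl : IsClosed {z : E2 × E2 | |cq B (z.1 - z.2)| ≤ ε * |cp B (z.1 - z.2)|} := by
    apply isClosed_le
    · exact ((continuous_cq B).comp (continuous_fst.sub continuous_snd)).abs
    · exact ((continuous_cp B).comp (continuous_fst.sub continuous_snd)).abs.const_mul _ 
  have hsub : F ×ˢ F ⊆ {z : E2 × E2 | |cq B (z.1 - z.2)| ≤ ε * |cp B (z.1 - z.2)|} :=
    fun z hz => h z.1 hz.1 z.2 hz.2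
  have := closure_minimal hsub hcl
  rw [closure_prod_eq] at this
  exact fun x hx y hy => this (mk_mem_prod hx hy)

lemma image_zero_deriv_null (γ : ℝ → E2) (Z : Set ℝ) (hZ : volume Z ≠ ⊤)
    (hd : ∀ t ∈ Z, HasDerivAt γ 0 t) : μH[1] (γ '' Z) = 0 := by
  have key : ∀ δ : NNReal, δ ≠ 0 → μH[1] (γ '' Z) ≤ δ * volume Z := by
    intro δ hδ
    rcases Z.eq_empty_or_nonempty with rfl | hne
    · simp
    obtain ⟨t, A, hdis, hm, hcov, happ, hA⟩ :=
      exists_partition_approximatesLinearOn_of_hasFDerivWithinAt γ Z (fun _ => 0)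
        (fun x hx => by
          have := (hd x hx).hasFDerivAt.hasFDerivWithinAt (s := Z)
          simpa using this) (fun _ => δ) (fun _ => hδ)
    have hlip : ∀ n, LipschitzOnWith δ γ (Z ∩ t n) := by
      intro n
      obtain ⟨y, -, hy⟩ := hA hne n
      have := (happ n)
      rw [hy] at this
      rw [lipschitzOnWith_iff_norm_sub_le]
      intro x hx y hy
      simpa using this x hx y hy
    calc μH[1] (γ '' Z) ≤ μH[1] (⋃ n, γ '' (Z ∩ t n)) := by
          apply measure_mono
          rw [← image_iUnion, ← inter_iUnion]
          exact image_mono (fun x hx => ⟨hx, hcov hx⟩)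
      _ ≤ ∑' n, μH[1] (γ '' (Z ∩ t n)) := measure_iUnion_le _
      _ ≤ ∑' n, δ * volume (Z ∩ t n) := by
          refine ENNReal.tsum_le_tsum fun n => ?_
          have := (hlip n).hausdorffMeasure_image_le (d := 1) (by norm_num)
          rw [hausdorffMeasure_real] at this
          simpa using this
      _ = δ * ∑' n, volume (Z ∩ t n) := ENNReal.tsum_mul_left
      _ ≤ δ * volume Z := by
          gcongr
          have := measure_iUnion (μ := volume.restrict Z) hdis hm
          simp only [Measure.restrict_apply (hm _)] at this
          simp only [inter_comm Z]
          rw [← this]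
          calc _ ≤ (volume.restrict Z) univ := measure_mono (subset_univ _)
            _ = volume Z := by simp
  by_contra hne
  have hpos : 0 < μH[1] (γ '' Z) := pos_iff_ne_zero.2 hne
  obtain ⟨δ, hδ0, hδ⟩ := ENNReal.exists_nnreal_pos_mul_lt hZ hpos.ne'
  exact absurd (key δ hδ0.ne') (not_le.2 hδ)

lemma flat_of_approx (γ : ℝ → E2) (T : Set ℝ) (A : ℝ →L[ℝ] E2) (hA : A 1 ≠ 0) (ε : ℝ)
    (hε : 0 < ε) (c : NNReal) (hc : (c : ℝ) = min ε 1 / 2 * ‖A 1‖)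
    (h : ApproximatesLinearOn γ A T c) : ∃ B : Fr, Flat B ε (γ '' T) := by
  have hn : 0 < ‖A 1‖ := norm_pos_iff.2 hA
  obtain ⟨B, hB⟩ := exists_frame (‖A 1‖⁻¹ • A 1) (by rw [norm_smul]; simp [hn.ne'])
  have hA1 : A 1 = ‖A 1‖ • B 0 := by rw [hB, smul_smul, mul_inv_cancel₀ hn.ne', one_smul]
  refine ⟨B, ?_⟩
  rintro _ ⟨x, hx, rfl⟩ _ ⟨y, hy, rfl⟩
  have h1 := h x hx y hy
  have hAx : A (x - y) = ((x - y) * ‖A 1‖) • B 0 := by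
    have : A (x - y) = (x - y) • A 1 := by rw [← map_smul]; simp
    rw [this, hA1]; simp [smul_smul, norm_smul]
  set e := γ x - γ y - A (x - y) with he
  have hg : γ x - γ y = e + ((x - y) * ‖A 1‖) • B 0 := by rw [he, hAx]; abel
  have hp : cp B (γ x - γ y) = cp B e + (x - y) * ‖A 1‖ := by
    rw [hg, cp_add, cp_smul, cp_B0, mul_one]
  have hq : cq B (γ x - γ y) = cq B e := by
    rw [hg, cq_add, cq_smul, cq_B0]; ring
  rw [hp, hq]
  rw [hc, Real.norm_eq_abs] at h1
  have h2 := (abs_cp_le B e).trans h1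
  have h3 := (abs_cq_le B e).trans h1
  set c' := min ε 1 / 2
  have hc1 : c' ≤ 1 / 2 := by have := min_le_right ε 1; simp only [c']; linarith
  have hc2 : 2 * c' ≤ ε := by have := min_le_left ε 1; simp only [c']; linarith
  have hc0 : 0 < c' := by have : 0 < min ε 1 := lt_min hε one_pos
                          simp only [c']; linarith
  have h4 : |(x - y) * ‖A 1‖| - |cp B e| ≤ |cp B e + (x - y) * ‖A 1‖| := by
    have := abs_sub_abs_le_abs_sub ((x - y) * ‖A 1‖) (-cp B e)
    rw [abs_neg, sub_neg_eq_add, add_comm ((x - y) * ‖A 1‖)] at this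
    exact this
  rw [abs_mul, abs_of_pos hn] at h4
  set D := |x - y| * ‖A 1‖ with hD
  have hD0 : 0 ≤ D := by positivity
  have h3' : |cq B e| ≤ c' * D := by rw [hD]; linarith
  have h2' : |cp B e| ≤ c' * D := by rw [hD]; linarith
  have h5 : D / 2 ≤ |cp B e + (x - y) * ‖A 1‖| := by nlinarith
  calc |cq B e| ≤ c' * D := h3'
    _ = (2 * c') * (D / 2) := by ring
    _ ≤ ε * _ := by gcongr

lemma flat_cover (G : Set E2) (hc : IsCompact G) (hG : IsConnected G) (hH : μH[1] G ≠ ⊤)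
    (ε : ℝ) (hε : 0 < ε) :
    ∃ (F : ℕ → Set E2) (B : ℕ → Fr), (∀ n, IsCompact (F n)) ∧ (∀ n, Flat (B n) ε (F n)) ∧
      (∀ n, F n ⊆ G) ∧ μH[1] (G \ ⋃ n, F n) = 0 := by
  obtain ⟨K, γ, hγ, hγG⟩ := exists_param G hc hG hH
  set D := {t ∈ Icc (0:ℝ) 1 | DifferentiableAt ℝ γ t ∧ deriv γ t ≠ 0} with hD
  set Z := {t ∈ Icc (0:ℝ) 1 | HasDerivAt γ 0 t} with hZ
  set N := {t | ¬ DifferentiableAt ℝ γ t} with hN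
  have hN0 : μH[1] (γ '' N) = 0 := by
    have h1 : volume N = 0 := by
      have := hγ.ae_differentiableAt_real
      rwa [ae_iff] at this
    have := (hγ.lipschitzOnWith (s := N)).hausdorffMeasure_image_le (d := 1) (by norm_num)
    rw [hausdorffMeasure_real, h1] at this
    simpa using this
  have hZ0 : μH[1] (γ '' Z) = 0 := by
    apply image_zero_deriv_null
    · have : volume Z ≤ volume (Icc (0:ℝ) 1) := measure_mono (fun t ht => ht.1)
      exact ne_top_of_le_ne_top (by simp) this
    · exact fun t ht => ht.2
  classical
  obtain ⟨t, A, htc, hcov, happ, hA⟩ :=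
    exists_closed_cover_approximatesLinearOn_of_hasFDerivWithinAt γ D (fun t => fderiv ℝ γ t)
      (fun x hx => hx.2.1.hasFDerivAt.hasFDerivWithinAt)
      (fun A => if h : A 1 = 0 then 1 else Real.toNNReal (min ε 1 / 2 * ‖A 1‖)) (by
        intro A
        split_ifs with h
        · exact one_ne_zero
        · have h1 : 0 < ‖A 1‖ := norm_pos_iff.2 h
          have h2 : 0 < min ε 1 := lt_min hε one_pos
          have : 0 < min ε 1 / 2 * ‖A 1‖ := by positivity
          exact (Real.toNNReal_pos.2 this).ne')
  have hfl : ∀ n, ∃ B : Fr, Flat B ε (γ '' (D ∩ t n)) := by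
    intro n
    rcases D.eq_empty_or_nonempty with hDe | hDn
    · refine ⟨EuclideanSpace.basisFun (Fin 2) ℝ, ?_⟩
      rw [hDe]; intro x hx; simp at hx
    obtain ⟨y, hy, hAy⟩ := hA hDn n
    have hne : (A n) 1 ≠ 0 := by
      rw [hAy]; exact hy.2.2
    have h1 := happ n
    simp only [hne, dite_false] at h1
    refine flat_of_approx γ _ (A n) hne ε hε _ ?_ h1
    have h2 : 0 < min ε 1 := lt_min hε one_pos
    rw [Real.coe_toNNReal _ (by positivity)]
  choose B hB using hfl
  have hsub : ∀ n, closure (γ '' (D ∩ t n)) ⊆ G := by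
    intro n
    apply closure_minimal _ hc.isClosed
    rw [← hγG]
    exact image_mono (fun x hx => hx.1.1)
  refine ⟨fun n => closure (γ '' (D ∩ t n)), B, fun n => ?_, fun n => (hB n).closure, hsub, ?_⟩
  · exact hc.of_isClosed_subset isClosed_closure (hsub n)
  · apply measure_mono_null _ (measure_union_null hN0 hZ0)
    rintro x ⟨hx, hxn⟩
    rw [← hγG] at hx
    obtain ⟨s, hs, rfl⟩ := hx
    by_cases h1 : DifferentiableAt ℝ γ s
    · by_cases h2 : deriv γ s = 0
      · right; exact ⟨s, ⟨hs, h2 ▸ h1.hasDerivAt⟩, rfl⟩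
      · exfalso
        apply hxn
        have hsD : s ∈ D := ⟨hs, h1, h2⟩
        obtain ⟨n, hn⟩ := mem_iUnion.1 (hcov hsD)
        exact mem_iUnion.2 ⟨n, subset_closure ⟨s, ⟨hsD, hn⟩, rfl⟩⟩
    · left; exact ⟨s, h1, rfl⟩

/-! components -/

lemma comp_compact (Γ : Set E2) (hΓ : IsCompact Γ) (x : E2) :
    IsCompact (connectedComponentIn Γ x) := by
  by_cases hx : x ∈ Γ
  · have hcl : IsClosed (connectedComponentIn Γ x) := by
      apply isClosed_of_closure_subset
      apply IsPreconnected.subset_connectedComponentIn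
      · exact isPreconnected_connectedComponentIn.closure
      · exact subset_closure (mem_connectedComponentIn hx)
      · exact closure_minimal (connectedComponentIn_subset _ _) hΓ.isClosed
    exact hΓ.of_isClosed_subset hcl (connectedComponentIn_subset _ _)
  · rw [connectedComponentIn_eq_empty hx]; exact isCompact_empty

lemma exists_comps (Γ : Set E2) (hΓ : IsCompact Γ)
    (hc : {C | ∃ x ∈ Γ, C = connectedComponentIn Γ x}.Finite) :
    ∃ 𝒞 : Finset (Set E2), (∀ C ∈ 𝒞, IsCompact C ∧ IsConnected C) ∧
      (∀ C ∈ 𝒞, ∀ C' ∈ 𝒞, C ≠ C' → Disjoint C C') ∧ Γ = ⋃ C ∈ 𝒞, C := by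
  refine ⟨hc.toFinset, ?_, ?_, ?_⟩
  · intro C hC
    simp only [Finite.mem_toFinset] at hC
    obtain ⟨x, hx, rfl⟩ := hC
    exact ⟨comp_compact Γ hΓ x, isConnected_connectedComponentIn_iff.2 hx⟩
  · intro C hC C' hC' hne
    simp only [Finite.mem_toFinset] at hC hC'
    obtain ⟨x, hx, rfl⟩ := hC
    obtain ⟨y, hy, rfl⟩ := hC'
    rw [Set.disjoint_left]
    intro z hz hz'
    exact hne ((connectedComponentIn_eq hz).trans (connectedComponentIn_eq hz').symm)
  · ext z
    simp only [mem_iUnion, Finite.mem_toFinset]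
    constructor
    · intro hz; exact ⟨_, ⟨z, hz, rfl⟩, mem_connectedComponentIn hz⟩
    · rintro ⟨C, ⟨x, hx, rfl⟩, hzC⟩; exact connectedComponentIn_subset _ _ hzC

lemma flat_cover_all (Γ : Set E2) (hΓ : IsCompact Γ) (hH : μH[1] Γ ≠ ⊤)
    (hc : {C | ∃ x ∈ Γ, C = connectedComponentIn Γ x}.Finite) (ε : ℝ) (hε : 0 < ε) :
    ∃ (F : ℕ → Set E2) (B : ℕ → Fr), (∀ n, IsCompact (F n)) ∧ (∀ n, Flat (B n) ε (F n)) ∧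
      (∀ n, F n ⊆ Γ) ∧ μH[1] (Γ \ ⋃ n, F n) = 0 := by
  obtain ⟨𝒞, h1, h2, h3⟩ := exists_comps Γ hΓ hc
  have hsub : ∀ C ∈ 𝒞, C ⊆ Γ := fun C hC => by
    rw [h3]; exact subset_biUnion_of_mem (u := fun C => C) hC
  have key : ∀ C : 𝒞, ∃ (F : ℕ → Set E2) (B : ℕ → Fr), (∀ n, IsCompact (F n)) ∧
      (∀ n, Flat (B n) ε (F n)) ∧
      (∀ n, F n ⊆ C.1) ∧ μH[1] (C.1 \ ⋃ n, F n) = 0 := fun C =>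
    flat_cover C.1 (h1 C.1 C.2).1 (h1 C.1 C.2).2
      (ne_top_of_le_ne_top hH (measure_mono (hsub _ C.2))) ε hε
  choose F B hF1 hF2 hF3 hF4 using key
  rcases 𝒞.eq_empty_or_nonempty with he | ⟨C0, hC0⟩
  · refine ⟨fun _ => ∅, fun _ => EuclideanSpace.basisFun (Fin 2) ℝ, fun _ => isCompact_empty,
      fun _ x hx => by simp at hx, fun _ => empty_subset _, ?_⟩
    have : Γ = ∅ := by rw [h3, he]; simp
    rw [this]; simp
  have : Nonempty (𝒞 × ℕ) := ⟨⟨C0, hC0⟩, 0⟩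
  obtain ⟨e, he⟩ := exists_surjective_nat (𝒞 × ℕ)
  refine ⟨fun n => F (e n).1 (e n).2, fun n => B (e n).1 (e n).2, fun n => hF1 _ _,
    fun n => hF2 _ _, fun n => (hF3 _ _).trans (hsub _ (e n).1.2), ?_⟩
  have hle : Γ \ ⋃ n, F (e n).1 (e n).2 ⊆ ⋃ C : 𝒞, (C.1 \ ⋃ n, F C n) := by
    rintro x ⟨hx, hxn⟩
    rw [h3] at hx
    simp only [mem_iUnion] at hx
    obtain ⟨C, hC, hxC⟩ := hx
    refine mem_iUnion.2 ⟨⟨C, hC⟩, hxC, ?_⟩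
    intro hx'
    obtain ⟨n, hn⟩ := mem_iUnion.1 hx'
    obtain ⟨k, hk⟩ := he (⟨C, hC⟩, n)
    apply hxn
    refine mem_iUnion.2 ⟨k, ?_⟩
    rw [hk]; exact hn
  exact measure_mono_null hle (measure_iUnion_null hF4)

/-! ### upper bound for the volume of the thickening -/

lemma disj_compact (Γ : Set E2) (hΓ : MeasurableSet Γ) (hH : μH[1] Γ ≠ ⊤) (F : ℕ → Set E2)
    (hF : ∀ n, MeasurableSet (F n)) (hFΓ : ∀ n, F n ⊆ Γ)
    (hcov : μH[1] (Γ \ ⋃ n, F n) = 0) (η : ℝ≥0∞) (hη : η ≠ 0) :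
    ∃ (N : ℕ) (K : ℕ → Set E2), (∀ n, IsCompact (K n)) ∧ (∀ n, K n ⊆ F n) ∧
      Pairwise (Function.onFun Disjoint K) ∧ μH[1] (Γ \ ⋃ n ∈ Finset.range N, K n) < η := by
  set ν := (μH[1] : Measure E2).restrict Γ with hν
  have : IsFiniteMeasure ν := ⟨by rw [hν]; simpa using hH.lt_top⟩
  obtain ⟨δ, hδ0, hδ⟩ := ENNReal.exists_pos_sum_of_countable' hη ℕ
  have hA : ∀ n, MeasurableSet (disjointed F n) := fun n => MeasurableSet.disjointed hF n
  choose K hKA hKc hK using fun n =>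
    (hA n).exists_isCompact_sdiff_lt (μ := ν) (measure_ne_top _ _) (hδ0 n).ne'
  have hall : ν (Γ \ ⋃ n, K n) < η := by
    have h1 : Γ \ ⋃ n, K n ⊆ (Γ \ ⋃ n, F n) ∪ ⋃ n, (disjointed F n \ K n) := by
      rintro x ⟨hx, hxn⟩
      by_cases h : x ∈ ⋃ n, F n
      · right
        rw [← iUnion_disjointed] at h
        obtain ⟨n, hn⟩ := mem_iUnion.1 h
        exact mem_iUnion.2 ⟨n, hn, fun h' => hxn (mem_iUnion.2 ⟨n, h'⟩)⟩
      · left; exact ⟨hx, h⟩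
    calc ν (Γ \ ⋃ n, K n) ≤ ν (Γ \ ⋃ n, F n) + ν (⋃ n, (disjointed F n \ K n)) :=
          (measure_mono h1).trans (measure_union_le _ _)
      _ ≤ 0 + ∑' n, δ n := by
          gcongr
          · rw [← hcov]; exact Measure.restrict_apply_le _ _
          · exact (measure_iUnion_le _).trans (ENNReal.tsum_le_tsum fun n => (hK n).le)
      _ < η := by rw [zero_add]; exact hδ
  have htend : Tendsto (ν ∘ fun N => Γ \ ⋃ n ∈ Finset.range N, K n) atTop
      (𝓝 (ν (⋂ N, Γ \ ⋃ n ∈ Finset.range N, K n))) := by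
    apply tendsto_measure_iInter_atTop
    · intro N
      exact (MeasurableSet.diff hΓ (Finset.measurableSet_biUnion _
        fun n _ => (hKc n).measurableSet)).nullMeasurableSet
    · intro N M h
      apply sdiff_subset_sdiff_right
      exact biUnion_subset_biUnion_left (by simpa using Finset.range_mono h)
    · exact ⟨0, measure_ne_top _ _⟩
  have he : (⋂ N, Γ \ ⋃ n ∈ Finset.range N, K n) ⊆ Γ \ ⋃ n, K n := by
    intro x hx
    rw [mem_iInter] at hx
    refine ⟨(hx 0).1, fun h => ?_⟩
    obtain ⟨n, hn⟩ := mem_iUnion.1 h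
    apply (hx (n + 1)).2
    simp only [mem_iUnion]
    exact ⟨n, by simp, hn⟩
  have hlt := lt_of_le_of_lt (measure_mono he) hall
  obtain ⟨N, hN⟩ := (htend.eventually_lt_const hlt).exists
  refine ⟨N, K, hKc, fun n => (hKA n).trans (disjointed_subset F n), ?_, ?_⟩
  · intro i j hij
    exact (disjoint_disjointed F hij).mono (hKA i) (hKA j)
  · simp only [Function.comp] at hN
    rwa [hν, Measure.restrict_eq_self _ sdiff_subset] at hN

lemma volume_cp_le (B : Fr) (F : Set E2) : volume (cp B '' F) ≤ μH[1] F := by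
  have := ((cp_lip B).lipschitzOnWith (s := F)).hausdorffMeasure_image_le (d := 1) (by norm_num)
  rw [hausdorffMeasure_real] at this
  simpa using this

lemma Flat.haus_le {B : Fr} {ε : ℝ} {F : Set E2} (h : Flat B ε F) (hε : 0 ≤ ε) :
    μH[1] F ≤ ENNReal.ofReal (1 + ε) * volume (cp B '' F) := by
  have := hausdorff_le_of_expand (cp B) F (Real.toNNReal (1 + ε)) (by
    intro x hx y hy
    rw [Real.coe_toNNReal _ (by positivity), dist_eq_norm, Real.dist_eq, ← cp_sub]
    have h1 := norm_le_fr B (x - y)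
    have h2 := h x hx y hy
    linarith) (d := 1) (by norm_num)
  rw [hausdorffMeasure_real, ENNReal.rpow_one] at this
  exact this

lemma volume_thickening_flat {B : Fr} {ε : ℝ} {K : Set E2} (h : Flat B ε K) (hε : 0 ≤ ε)
    (r : ℝ) : volume (thickening r K) ≤
      ENNReal.ofReal (2 * r * (1 + ε)) * volume (thickening r (cp B '' K)) := by
  rw [volume_fr B isOpen_thickening.measurableSet]
  have hm : MeasurableSet (thickening r (cp B '' K)) := isOpen_thickening.measurableSet
  calc ∫⁻ s, volume {y : ℝ | mkp B s y ∈ thickening r K}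
      ≤ ∫⁻ s, (thickening r (cp B '' K)).indicator (fun _ => ENNReal.ofReal (2 * r * (1 + ε))) s := by
        apply lintegral_mono
        intro s
        dsimp only
        have key : ∀ y, mkp B s y ∈ thickening r K → ∃ x ∈ K, |s - cp B x| < r ∧
            |y - cq B x| < r := by
          intro y hy
          obtain ⟨x, hx, hd⟩ := mem_thickening_iff.1 hy
          rw [dist_eq_norm] at hd
          refine ⟨x, hx, ?_, ?_⟩
          · have := (abs_cp_le B (mkp B s y - x)).trans_lt hd
            rwa [cp_sub, cp_mkp] at this
          · have := (abs_cq_le B (mkp B s y - x)).trans_lt hd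
            rwa [cq_sub, cq_mkp] at this
        by_cases hs : s ∈ thickening r (cp B '' K)
        · rw [indicator_of_mem hs]
          refine (Real.volume_le_diam _).trans ?_
          apply ediam_le
          intro y hy y' hy'
          obtain ⟨x, hx, h1, h2⟩ := key y hy
          obtain ⟨x', hx', h1', h2'⟩ := key y' hy'
          have h3 := h x hx x' hx'
          rw [cp_sub, cq_sub] at h3
          rw [edist_dist, Real.dist_eq]
          apply ENNReal.ofReal_le_ofReal
          have h4 : |cp B x - cp B x'| ≤ 2 * r := by
            rw [abs_lt] at h1 h1'; rw [abs_le]; constructor <;> linarith [h1.1, h1.2, h1'.1, h1'.2]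
          have h5 : ε * |cp B x - cp B x'| ≤ ε * (2 * r) := by gcongr
          have h6 := h3.trans h5
          rw [abs_le] at h6; rw [abs_lt] at h2 h2'
          rw [abs_le]; constructor <;> nlinarith [h6.1, h6.2, h2.1, h2.2, h2'.1, h2'.2]
        · rw [indicator_of_notMem hs]
          have : {y : ℝ | mkp B s y ∈ thickening r K} = ∅ := by
            ext y
            simp only [mem_ofPred_eq, mem_empty_iff_false, iff_false]
            intro hy
            obtain ⟨x, hx, h1, -⟩ := key y hy
            exact hs (mem_thickening_iff.2 ⟨cp B x, ⟨x, hx, rfl⟩, by rwa [Real.dist_eq]⟩)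
          rw [this]; simp
    _ = _ := by rw [lintegral_indicator hm, setLIntegral_const]

lemma vol_thick_real (C : Set ℝ) (hC : IsCompact C) (δ : ℝ≥0∞) (hδ : δ ≠ 0) :
    ∀ᶠ r in 𝓝[>] (0:ℝ), volume (thickening r C) ≤ volume C + δ := by
  have h := tendsto_measure_thickening_of_isClosed (μ := volume) (s := C)
    ⟨1, one_pos, (hC.isBounded.thickening.measure_lt_top).ne⟩ hC.isClosed
  have hfin : volume C ≠ ⊤ := hC.measure_lt_top.ne
  exact (h.eventually_lt_const (ENNReal.lt_add_right hfin hδ)).mono fun r hr => hr.le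

lemma flat_thick_le {B : Fr} {ε : ℝ} {K : Set E2} (h : Flat B ε K) (hε : 0 ≤ ε)
    (hK : IsCompact K) (hfin : μH[1] K ≠ ⊤) (δ : ℝ) (hδ : 0 < δ) :
    ∀ᶠ r in 𝓝[>] (0:ℝ), volume (thickening r K) ≤
      ENNReal.ofReal (2 * r * (1 + ε) * ((μH[1] K).toReal + δ)) := by
  filter_upwards [vol_thick_real _ (hK.image (continuous_cp B)) (ENNReal.ofReal δ)
    (by simpa using hδ), self_mem_nhdsWithin] with r hr hr0
  have hr0' : 0 < r := hr0
  refine (volume_thickening_flat h hε r).trans ?_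
  rw [ENNReal.ofReal_mul (p := 2 * r * (1 + ε)) (by positivity)]
  refine mul_le_mul' le_rfl (hr.trans ?_)
  rw [ENNReal.ofReal_add (by positivity) hδ.le, ENNReal.ofReal_toReal hfin]
  gcongr
  exact volume_cp_le B K

lemma sum_haus_le (Γ : Set E2) (K : ℕ → Set E2) (N : ℕ) (hK : ∀ n, IsCompact (K n))
    (hd : Pairwise (Function.onFun Disjoint K)) (hs : ∀ n, K n ⊆ Γ) (hH : μH[1] Γ ≠ ⊤) :
    ∑ n ∈ Finset.range N, (μH[1] (K n)).toReal ≤ (μH[1] Γ).toReal := by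
  rw [← ENNReal.toReal_sum (fun n _ => ne_top_of_le_ne_top hH (measure_mono (hs n)))]
  apply ENNReal.toReal_mono hH
  rw [← measure_biUnion_finset (fun i _ j _ hij => hd hij) (fun n _ => (hK n).measurableSet)]
  apply measure_mono
  exact iUnion₂_subset fun n _ => hs n

lemma thick_scale {f : ℝ → Prop} (h : ∀ᶠ r in 𝓝[>] (0:ℝ), f r) (c : ℝ) (hc : 0 < c) :
    ∀ᶠ r in 𝓝[>] (0:ℝ), f (c * r) := by
  have : Tendsto (fun r : ℝ => c * r) (𝓝[>] 0) (𝓝[>] 0) := by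
    apply tendsto_nhdsWithin_of_tendsto_nhds_of_eventually_within
    · have : Tendsto (fun r : ℝ => c * r) (𝓝 0) (𝓝 (c * 0)) := tendsto_id.const_mul c
      rw [mul_zero] at this
      exact this.mono_left nhdsWithin_le_nhds
    · filter_upwards [self_mem_nhdsWithin] with r hr
      exact mul_pos hc hr
  exact this.eventually h

lemma continuum_thick_aux (G : Set E2) (hc : IsCompact G) (hG : IsConnected G)
    (hH : μH[1] G ≠ ⊤) (ε : ℝ) (hε : 0 < ε) (hε1 : ε ≤ 1) :
    ∀ᶠ r in 𝓝[>] (0:ℝ), volume (thickening r G) ≤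
      ENNReal.ofReal ((2 * (1 + ε) ^ 2 * ((μH[1] G).toReal + ε) + 36 * ε) * r) := by
  obtain ⟨x0, hx0⟩ := hG.nonempty
  have hball : ∀ (x : E2) (r : ℝ), 0 ≤ r → volume (ball x r) ≤ ENNReal.ofReal (4 * r ^ 2) := by
    intro x r hr
    rw [EuclideanSpace.volume_ball_fin_two, ← ENNReal.ofReal_pow hr, ← ENNReal.ofReal_mul (by positivity)]
    apply ENNReal.ofReal_le_ofReal
    nlinarith [Real.pi_le_four, sq_nonneg r]
  by_cases hsub : ∀ y ∈ G, y = x0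
  · have hGe : G = {x0} := by ext z; exact ⟨fun h => hsub z h, fun h => by rw [h]; exact hx0⟩
    filter_upwards [Ioo_mem_nhdsGT hε] with r hr
    rw [hGe, thickening_singleton]
    refine (hball _ _ hr.1.le).trans (ENNReal.ofReal_le_ofReal ?_)
    have : 0 ≤ 2 * (1 + ε) ^ 2 * ((μH[1] ({x0} : Set E2)).toReal + ε) := by positivity
    nlinarith [hr.1, hr.2, mul_pos hε hr.1, mul_nonneg this hr.1.le]
  push Not at hsub
  obtain ⟨y0, hy0, hne⟩ := hsub
  set D := dist y0 x0 / 2 with hD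
  have hDpos : 0 < D := by have := dist_pos.2 hne; positivity
  have hfar : ∀ x ∈ G, ∃ y ∈ G, D ≤ dist x y := by
    intro x hx
    by_contra! hcon
    have h1 := hcon x0 hx0
    have h2 := hcon y0 hy0
    have := dist_triangle_left y0 x0 x
    rw [hD] at h1 h2; linarith
  obtain ⟨F, B, hFc, hFf, hFG, hF0⟩ := flat_cover G hc hG hH ε hε
  obtain ⟨N, K, hKc, hKF, hKd, hKη⟩ := disj_compact G hc.measurableSet hH F
    (fun n => (hFc n).measurableSet) hFG hF0 (ENNReal.ofReal (ε ^ 2)) (by simpa using by positivity)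
  have hKG : ∀ n, K n ⊆ G := fun n => (hKF n).trans (hFG n)
  have hev : ∀ᶠ r in 𝓝[>] (0:ℝ), ∀ n ∈ Finset.range N, volume (thickening ((1 + ε) * r) (K n)) ≤
      ENNReal.ofReal (2 * ((1 + ε) * r) * (1 + ε) * ((μH[1] (K n)).toReal + ε / (N + 1))) := by
    rw [Filter.eventually_all_finset]
    intro n _
    exact thick_scale (flat_thick_le ((hFf n).mono (hKF n)) hε.le (hKc n)
      (ne_top_of_le_ne_top hH (measure_mono (hKG n))) (ε / (N + 1)) (by positivity)) (1 + ε)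
      (by positivity)
  set KK := ⋃ n ∈ Finset.range N, K n with hKK
  filter_upwards [hev, Ioo_mem_nhdsGT (show 0 < D / ε by positivity)] with r hr hr1
  have hr0 : 0 < r := hr1.1
  set ρ := ε * r with hρ
  have hρ0 : 0 < ρ := by positivity
  have hρD : ρ ≤ D := by
    have := hr1.2.le
    rw [le_div_iff₀ hε] at this; rw [hρ]; linarith
  set R := G \ thickening ρ KK with hR
  have hcard : ∀ S : Finset E2, ↑S ⊆ R → (∀ x ∈ S, ∀ y ∈ S, x ≠ y → 2 * ρ ≤ dist x y) →
      (S.card : ℝ) * r ≤ ε := by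
    intro S hS hs
    have h1 := sep_count μH[1] (G \ KK) S ρ (ENNReal.ofReal ρ) hs (fun x hx => by
      obtain ⟨y, hy, hxy⟩ := hfar x (hS hx).1
      refine (ld G hG.isPreconnected (hS hx).1 hy ρ (hρD.trans hxy)).trans (measure_mono ?_)
      rintro z ⟨hz, hzx⟩
      refine ⟨⟨hz, fun hzK => ?_⟩, hzx⟩
      apply (hS hx).2
      exact mem_thickening_iff.2 ⟨z, hzK, by rw [dist_comm]; exact hzx⟩)
    have h2 := h1.trans hKη.le
    have h3 := ENNReal.toReal_mono (by simp) h2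
    rw [ENNReal.toReal_mul, ENNReal.toReal_natCast, ENNReal.toReal_ofReal (by positivity),
      ENNReal.toReal_ofReal (by positivity)] at h3
    rw [hρ] at h3
    have h4 : ε * ((S.card : ℝ) * r) ≤ ε * ε := by linarith
    exact le_of_mul_le_mul_left h4 hε
  obtain ⟨S, hSR, hs, hcov⟩ := exists_net R (2 * ρ) ⌈ε / r⌉₊ (fun S h1 h2 => by
    have := hcard S h1 h2
    have h3 : (S.card : ℝ) ≤ ε / r := by rw [le_div_iff₀ hr0]; exact this
    exact_mod_cast h3.trans (Nat.le_ceil _))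
  have hsubset : thickening r G ⊆ (⋃ n ∈ Finset.range N, thickening ((1 + ε) * r) (K n)) ∪
      ⋃ x ∈ S, ball x (3 * r) := by
    intro z hz
    obtain ⟨g, hg, hzg⟩ := mem_thickening_iff.1 hz
    by_cases hgK : g ∈ thickening ρ KK
    · left
      obtain ⟨k, hk, hgk⟩ := mem_thickening_iff.1 hgK
      simp only [hKK, mem_iUnion] at hk
      obtain ⟨n, hn, hkn⟩ := hk
      simp only [mem_iUnion]
      refine ⟨n, hn, mem_thickening_iff.2 ⟨k, hkn, ?_⟩⟩
      have := dist_triangle z g k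
      rw [hρ] at hgk; linarith
    · right
      obtain ⟨y, hy, h⟩ := hcov g ⟨hg, hgK⟩
      simp only [mem_iUnion]
      refine ⟨y, hy, ?_⟩
      rw [mem_ball]
      have h1 := dist_triangle z g y
      have h2 : ρ ≤ r := by rw [hρ]; nlinarith
      rcases h with h | h
      · rw [h] at hzg; linarith
      · linarith
  have hsum := sum_haus_le G K N hKc hKd hKG hH
  calc volume (thickening r G) ≤ volume (⋃ n ∈ Finset.range N, thickening ((1 + ε) * r) (K n)) +
        volume (⋃ x ∈ S, ball x (3 * r)) := (measure_mono hsubset).trans (measure_union_le _ _)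
    _ ≤ ∑ n ∈ Finset.range N, volume (thickening ((1 + ε) * r) (K n)) +
        ∑ x ∈ S, volume (ball x (3 * r)) := by
        gcongr <;> exact measure_biUnion_finset_le _ _
    _ ≤ ∑ n ∈ Finset.range N, ENNReal.ofReal (2 * ((1 + ε) * r) * (1 + ε) *
          ((μH[1] (K n)).toReal + ε / (N + 1))) +
        ∑ x ∈ S, ENNReal.ofReal (4 * (3 * r) ^ 2) := by
        apply add_le_add
        · exact Finset.sum_le_sum fun n hn => hr n hn
        · exact Finset.sum_le_sum fun x _ => hball x _ (by positivity)
    _ = ENNReal.ofReal (∑ n ∈ Finset.range N, (2 * ((1 + ε) * r) * (1 + ε) *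
          ((μH[1] (K n)).toReal + ε / (N + 1))) + ∑ x ∈ S, 4 * (3 * r) ^ 2) := by
        rw [ENNReal.ofReal_add (Finset.sum_nonneg fun _ _ => by positivity)
          (Finset.sum_nonneg fun _ _ => by positivity),
          ENNReal.ofReal_sum_of_nonneg (fun _ _ => by positivity),
          ENNReal.ofReal_sum_of_nonneg (fun _ _ => by positivity)]
    _ ≤ _ := by
        apply ENNReal.ofReal_le_ofReal
        rw [← Finset.mul_sum, Finset.sum_add_distrib]
        simp only [Finset.sum_const, Finset.card_range, nsmul_eq_mul]
        have h1 : (N : ℝ) * (ε / (N + 1)) ≤ ε := by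
          rw [← mul_div_assoc, div_le_iff₀ (by positivity)]; nlinarith
        have h2 := hcard S hSR hs
        have h3 : 2 * ((1 + ε) * r) * (1 + ε) *
            (∑ n ∈ Finset.range N, (μH[1] (K n)).toReal + (N : ℝ) * (ε / (N + 1))) ≤
            2 * ((1 + ε) * r) * (1 + ε) * ((μH[1] G).toReal + ε) := by
          gcongr
        nlinarith

lemma continuum_thick (G : Set E2) (hc : IsCompact G) (hG : IsConnected G)
    (hH : μH[1] G ≠ ⊤) (δ : ℝ) (hδ : 0 < δ) :
    ∀ᶠ r in 𝓝[>] (0:ℝ), volume (thickening r G) ≤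
      ENNReal.ofReal ((2 * (μH[1] G).toReal + δ) * r) := by
  set m := (μH[1] G).toReal
  have hcont : Tendsto (fun ε : ℝ => 2 * (1 + ε) ^ 2 * (m + ε) + 36 * ε) (𝓝[>] 0) (𝓝 (2 * m)) := by
    have : Continuous (fun ε : ℝ => 2 * (1 + ε) ^ 2 * (m + ε) + 36 * ε) := by fun_prop
    have h := this.tendsto 0
    simp only [add_zero, one_pow, mul_one, mul_zero] at h
    exact h.mono_left nhdsWithin_le_nhds
  have h1 := hcont.eventually_lt_const (show 2 * m < 2 * m + δ by linarith)
  obtain ⟨ε, he, he1⟩ := (h1.and (Ioo_mem_nhdsGT (one_pos))).exists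
  filter_upwards [continuum_thick_aux G hc hG hH ε he1.1 he1.2.le, self_mem_nhdsWithin] with r hr hr0
  refine hr.trans (ENNReal.ofReal_le_ofReal ?_)
  have : 0 < r := hr0
  gcongr

lemma all_thick (Γ : Set E2) (hΓ : IsCompact Γ) (hH : μH[1] Γ ≠ ⊤)
    (hc : {C | ∃ x ∈ Γ, C = connectedComponentIn Γ x}.Finite) (δ : ℝ) (hδ : 0 < δ) :
    ∀ᶠ r in 𝓝[>] (0:ℝ), volume (thickening r Γ) ≤
      ENNReal.ofReal ((2 * (μH[1] Γ).toReal + δ) * r) := by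
  obtain ⟨𝒞, h1, h2, h3⟩ := exists_comps Γ hΓ hc
  have hsub : ∀ C ∈ 𝒞, C ⊆ Γ := fun C hC => by
    rw [h3]; exact subset_biUnion_of_mem (u := fun C => C) hC
  have hfin : ∀ C ∈ 𝒞, μH[1] C ≠ ⊤ := fun C hC => ne_top_of_le_ne_top hH (measure_mono (hsub C hC))
  have hev : ∀ᶠ r in 𝓝[>] (0:ℝ), ∀ C ∈ 𝒞, volume (thickening r C) ≤
      ENNReal.ofReal ((2 * (μH[1] C).toReal + δ / (𝒞.card + 1)) * r) := by
    rw [Filter.eventually_all_finset]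
    intro C hC
    exact continuum_thick C (h1 C hC).1 (h1 C hC).2 (hfin C hC) _ (by positivity)
  have hsum : ∑ C ∈ 𝒞, (μH[1] C).toReal = (μH[1] Γ).toReal := by
    rw [← ENNReal.toReal_sum hfin]
    conv_rhs => rw [h3]
    rw [measure_biUnion_finset (fun C hC C' hC' hne => h2 C hC C' hC' hne)
      (fun C hC => (h1 C hC).1.measurableSet)]
  filter_upwards [hev, self_mem_nhdsWithin] with r hr hr0
  have hr0' : 0 < r := hr0
  calc volume (thickening r Γ) = volume (⋃ C ∈ 𝒞, thickening r C) := by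
        conv_lhs => rw [h3]
        simp only [thickening_iUnion]
    _ ≤ ∑ C ∈ 𝒞, volume (thickening r C) := measure_biUnion_finset_le _ _
    _ ≤ ∑ C ∈ 𝒞, ENNReal.ofReal ((2 * (μH[1] C).toReal + δ / (𝒞.card + 1)) * r) :=
        Finset.sum_le_sum hr
    _ = ENNReal.ofReal (∑ C ∈ 𝒞, (2 * (μH[1] C).toReal + δ / (𝒞.card + 1)) * r) := by
        rw [ENNReal.ofReal_sum_of_nonneg (fun _ _ => by positivity)]
    _ ≤ _ := by
        apply ENNReal.ofReal_le_ofReal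
        rw [← Finset.sum_mul, Finset.sum_add_distrib, ← Finset.mul_sum, hsum]
        simp only [Finset.sum_const, nsmul_eq_mul]
        have h4 : (𝒞.card : ℝ) * (δ / (𝒞.card + 1)) ≤ δ := by
          rw [← mul_div_assoc, div_le_iff₀ (by positivity)]; nlinarith
        gcongr

/-! ### typed pieces -/

def Side (Ω : Set E2) (B : Fr) (σ h : ℝ) (b : Bool) : Set E2 :=
  {x | ∀ t ∈ Ioo 0 h, (b = true → x + (σ * t) • B 1 ∈ closure Ω) ∧
    (b = false → x + (σ * t) • B 1 ∉ Ω)}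

lemma isClosed_Side (Ω : Set E2) (hO : IsOpen Ω) (B : Fr) (σ h : ℝ) (b : Bool) :
    IsClosed (Side Ω B σ h b) := by
  have : Side Ω B σ h b = ⋂ t ∈ Ioo 0 h, {x | (b = true → x + (σ * t) • B 1 ∈ closure Ω) ∧
    (b = false → x + (σ * t) • B 1 ∉ Ω)} := by
    ext x; simp [Side]
  rw [this]
  refine isClosed_biInter fun t _ => ?_
  have hc : Continuous (fun x : E2 => x + (σ * t) • B 1) := by fun_prop
  cases b
  · simp only [Bool.false_eq_true, false_implies, true_and, forall_const]
    exact (hO.preimage hc).isClosed_compl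
  · simp only [forall_const, Bool.true_eq_false, false_implies, and_true]
    exact isClosed_closure.preimage hc

lemma Side_anti {Ω : Set E2} {B : Fr} {σ h h' : ℝ} {b : Bool} (hh : h' ≤ h) :
    Side Ω B σ h b ⊆ Side Ω B σ h' b :=
  fun _ hx t ht => hx t ⟨ht.1, ht.2.trans_le hh⟩

lemma ae_finite_slice (Γ : Set E2) (hH : μH[1] Γ ≠ ⊤) (B : Fr) :
    ∀ᵐ s : ℝ, {y : ℝ | mkp B s y ∈ Γ}.Finite := by
  obtain ⟨G, hG, hGF, hGi⟩ := eilenberg_count Γ hH (cp B) 1 ((cp_lip B).lipschitzOnWith)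
  have hfin : ∫⁻ s, G s ≠ ⊤ := ne_top_of_le_ne_top (by simpa using hH) hGi
  filter_upwards [ae_lt_top hG hfin] with s hs
  by_contra hinf
  obtain ⟨n, hn⟩ := ENNReal.exists_nat_gt hs.ne
  obtain ⟨t, ht, htn⟩ := Set.Infinite.exists_subset_card_eq hinf n
  classical
  have hinj : Function.Injective (mkp B s) := fun y y' h => by
    have := congrArg (cq B) h
    rwa [cq_mkp, cq_mkp] at this
  have := hGF s (t.image (mkp B s)) (by
    intro z hz
    simp only [Finset.coe_image, mem_image] at hz
    obtain ⟨y, hy, rfl⟩ := hz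
    exact ⟨ht hy, cp_mkp B s y⟩)
  rw [Finset.card_image_of_injective _ hinj, htn] at this
  exact absurd this (not_le.2 hn)

lemma frontier_dichotomy (Ω : Set E2) (hO : IsOpen Ω) (S : Set E2) (hS : IsPreconnected S)
    (hd : ∀ x ∈ S, x ∉ frontier Ω) : S ⊆ Ω ∨ ∀ x ∈ S, x ∉ Ω := by
  by_contra! hcon
  obtain ⟨h1, x, hx, hxO⟩ := hcon
  obtain ⟨y, hy, hyO⟩ := not_subset.1 h1
  obtain ⟨z, hz, hz1, hz2⟩ := hS Ω (closure Ω)ᶜ hO isClosed_closure.isOpen_compl (by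
    intro z hz
    by_cases hzO : z ∈ Ω
    · left; exact hzO
    · right; intro hzc
      exact hd z hz ⟨hzc, by rwa [hO.interior_eq]⟩) ⟨x, hx, hxO⟩ ⟨y, hy, by
        intro hyc; exact hd y hy ⟨hyc, by rwa [hO.interior_eq]⟩⟩
  exact hz2 (subset_closure hz1)

lemma exists_side (Ω : Set E2) (hO : IsOpen Ω) (B : Fr) (σ : ℝ) (hσ : σ ≠ 0) (x : E2)
    (hf : {y : ℝ | mkp B (cp B x) y ∈ frontier Ω}.Finite) :
    ∃ h0 > 0, ∃ b, x ∈ Side Ω B σ h0 b := by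
  have hinj : Function.Injective (fun t : ℝ => cq B x + σ * t) := fun t t' h => by
    simpa [hσ] using h
  have hf' : {t : ℝ | x + (σ * t) • B 1 ∈ frontier Ω}.Finite := by
    have := hf.preimage (hinj.injOn)
    refine this.subset ?_
    intro t ht
    simp only [mem_preimage, mem_ofPred_eq]
    rw [mkp_add_smul]; exact ht
  have hf2 := (hf'.subset (sdiff_subset (t := {0}))).isClosed
  have h0 : (0:ℝ) ∈ ({t : ℝ | x + (σ * t) • B 1 ∈ frontier Ω} \ {0})ᶜ := by simp
  obtain ⟨h, hpos, hball⟩ := Metric.isOpen_iff.1 hf2.isOpen_compl 0 h0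
  have hno : ∀ t ∈ Ioo 0 h, x + (σ * t) • B 1 ∉ frontier Ω := by
    intro t ht hmem
    have : t ∈ ball (0:ℝ) h := by rw [mem_ball, Real.dist_eq, sub_zero, abs_of_pos ht.1]; exact ht.2
    apply hball this
    exact ⟨hmem, by simpa using ht.1.ne'⟩
  have hpre : IsPreconnected ((fun t : ℝ => x + (σ * t) • B 1) '' Ioo 0 h) :=
    isPreconnected_Ioo.image _ (by fun_prop)
  refine ⟨h, hpos, ?_⟩
  rcases frontier_dichotomy Ω hO _ hpre (by rintro _ ⟨t, ht, rfl⟩; exact hno t ht) with h1 | h1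
  · refine ⟨true, fun t ht => ⟨fun _ => subset_closure (h1 ⟨t, ht, rfl⟩), by simp⟩⟩
  · refine ⟨false, fun t ht => ⟨by simp, fun _ => h1 _ ⟨t, ht, rfl⟩⟩⟩

lemma Flat.null {B : Fr} {ε : ℝ} {F : Set E2} (h : Flat B ε F) (hε : 0 ≤ ε) (N : Set ℝ)
    (hN : volume N = 0) : μH[1] (F ∩ cp B ⁻¹' N) = 0 := by
  have h1 := (h.mono (inter_subset_left (t := cp B ⁻¹' N))).haus_le hε
  have h2 : volume (cp B '' (F ∩ cp B ⁻¹' N)) = 0 := by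
    apply measure_mono_null _ hN
    rintro _ ⟨x, hx, rfl⟩; exact hx.2
  rw [h2, mul_zero] at h1
  exact le_antisymm h1 (zero_le)

lemma vol_closure_sdiff (Ω : Set E2) (hO : IsOpen Ω) (hH : μH[1] (frontier Ω) ≠ ⊤) :
    volume (closure Ω \ Ω) = 0 := by
  rw [← hO.frontier_eq]; exact volume_null_of_haus1 _ hH

/-- all points over `C` near `x` on an in-in piece are in the closure -/
lemma in_of_sides {Ω : Set E2} {B : Fr} {ε h : ℝ} {F : Set E2} (hF : Flat B ε F) (hε : ε ≤ 1 / 2)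
    (hFΓ : F ⊆ frontier Ω) (h1 : F ⊆ Side Ω B 1 h true) (h2 : F ⊆ Side Ω B (-1) h true)
    {x z : E2} (hx : x ∈ F) {r : ℝ} (hr : 2 * r < h) (hz : z ∈ ball x r)
    (hzC : cp B z ∈ cp B '' F) : z ∈ closure Ω := by
  obtain ⟨p, hp, hpz⟩ := hzC
  rw [mem_ball, dist_eq_norm] at hz
  have e1 := (abs_cp_le B (z - x)).trans_lt hz
  have e2 := (abs_cq_le B (z - x)).trans_lt hz
  have e3 := hF p hp x hx
  rw [cp_sub, cq_sub] at *
  rw [hpz] at e3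
  have e4 : |cq B p - cq B x| ≤ r := by nlinarith [abs_nonneg (cp B z - cp B x)]
  have e5 : |cq B z - cq B p| < h := by
    rw [abs_lt] at *; rw [abs_le] at e4; constructor <;> linarith [e2.1, e2.2, e4.1, e4.2]
  have hzp : z = p + (cq B z - cq B p) • B 1 := by
    rw [← mkp_add_smul, hpz, add_sub_cancel, mkp_cp_cq]
  rcases lt_trichotomy (cq B z - cq B p) 0 with hlt | heq | hgt
  · have := (h2 hp (-(cq B z - cq B p)) ⟨by linarith, by rw [abs_of_neg hlt] at e5; exact e5⟩).1 rfl
    rw [neg_one_mul, neg_neg, ← hzp] at this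
    exact this
  · rw [hzp, heq, zero_smul, add_zero]; exact frontier_subset_closure (hFΓ hp)
  · have := (h1 hp (cq B z - cq B p) ⟨hgt, by rw [abs_of_pos hgt] at e5; exact e5⟩).1 rfl
    rw [one_mul, ← hzp] at this
    exact this

/-! ### density of typed pieces -/

lemma slice_lower (B : Fr) {C : Set ℝ} (hC : MeasurableSet C) {S : Set E2} (hS : MeasurableSet S)
    (c : ℝ≥0∞) (h : ∀ s ∈ C, c ≤ volume {y : ℝ | mkp B s y ∈ S}) : c * volume C ≤ volume S := by
  rw [volume_fr B hS]
  calc c * volume C = ∫⁻ s in C, c := by rw [setLIntegral_const]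
    _ ≤ ∫⁻ s in C, volume {y : ℝ | mkp B s y ∈ S} := setLIntegral_mono' hC h
    _ ≤ _ := setLIntegral_le_lintegral _ _

lemma slab_le (B : Fr) {A : Set ℝ} (hA : MeasurableSet A) {S : Set E2} (c r : ℝ)
    (h : ∀ z ∈ S, cp B z ∈ A ∧ |cq B z - c| < r) : volume S ≤ ENNReal.ofReal (2 * r) * volume A := by
  set S' := {z : E2 | cp B z ∈ A ∧ |cq B z - c| < r} with hS'
  have hm : MeasurableSet S' := by
    apply ((continuous_cp B).measurable hA).inter
    exact (isOpen_lt ((continuous_cq B).sub continuous_const).abs continuous_const).measurableSet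
  have hsub : S ⊆ S' := fun z hz => h z hz
  refine (measure_mono hsub).trans ?_
  rw [volume_fr B hm, ← setLIntegral_const, ← lintegral_indicator hA]
  apply lintegral_mono
  intro s
  dsimp only
  by_cases hs : s ∈ A
  · rw [indicator_of_mem hs]
    have : {y : ℝ | mkp B s y ∈ S'} ⊆ Ioo (c - r) (c + r) := by
      intro y hy
      have := hy.2
      rw [cq_mkp, abs_lt] at this
      constructor <;> linarith [this.1, this.2]
    refine (measure_mono this).trans ?_
    rw [Real.volume_Ioo]
    apply ENNReal.ofReal_le_ofReal; linarith
  · have : {y : ℝ | mkp B s y ∈ S'} = ∅ := by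
      ext y
      simp only [mem_ofPred_eq, mem_empty_iff_false, iff_false]
      intro hy
      have := hy.1
      rw [cp_mkp] at this
      exact hs this
    rw [this]; simp

lemma side_slice (B : Fr) (σ : ℝ) (hσ : σ = 1 ∨ σ = -1) (p : E2) (a : ℝ) (S : Set E2)
    (h : ∀ t ∈ Ioo 0 a, p + (σ * t) • B 1 ∈ S) :
    ENNReal.ofReal a ≤ volume ({y : ℝ | mkp B (cp B p) y ∈ S} ∩ {y | 0 < σ * (y - cq B p)}) := by
  rcases hσ with rfl | rfl
  · have : Ioo (cq B p) (cq B p + a) ⊆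
        {y : ℝ | mkp B (cp B p) y ∈ S} ∩ {y | 0 < 1 * (y - cq B p)} := by
      intro y hy
      refine ⟨?_, ?_⟩
      · have := h (y - cq B p) ⟨by linarith [hy.1], by linarith [hy.2]⟩
        rw [one_mul, ← mkp_add_smul, add_sub_cancel] at this
        exact this
      · simpa using hy.1
    refine le_trans ?_ (measure_mono this)
    rw [Real.volume_Ioo]; simp
  · have : Ioo (cq B p - a) (cq B p) ⊆
        {y : ℝ | mkp B (cp B p) y ∈ S} ∩ {y | 0 < -1 * (y - cq B p)} := by
      intro y hy
      refine ⟨?_, ?_⟩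
      · have := h (cq B p - y) ⟨by linarith [hy.2], by linarith [hy.1]⟩
        rw [neg_one_mul, neg_sub, ← mkp_add_smul, add_sub_cancel] at this
        exact this
      · simpa using hy.2
    refine le_trans ?_ (measure_mono this)
    rw [Real.volume_Ioo]; simp

def IsDens (C : Set ℝ) (s : ℝ) : Prop :=
  Tendsto (fun r => volume (C ∩ closedBall s r) / volume (closedBall s r)) (𝓝[>] 0) (𝓝 1)

lemma dens_bounds {C : Set ℝ} (hC : MeasurableSet C) {s : ℝ} (h : IsDens C s) (δ : ℝ)
    (hδ : 0 < δ) :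
    ∀ᶠ r in 𝓝[>] (0:ℝ), volume (closedBall s r \ C) ≤ ENNReal.ofReal (δ * r) ∧
      ENNReal.ofReal r ≤ volume (C ∩ closedBall s r) := by
  have h1 := (ENNReal.tendsto_toReal one_ne_top).comp h
  rw [ENNReal.toReal_one] at h1
  filter_upwards [h1.eventually_const_lt (show 1 - min (δ / 2) (1 / 2) < 1 by
    have : 0 < min (δ / 2) (1 / 2) := lt_min (by positivity) (by norm_num)
    linarith), self_mem_nhdsWithin] with r hr hr0
  have hr0' : 0 < r := hr0
  simp only [Function.comp, Real.volume_closedBall, ENNReal.toReal_div] at hr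
  rw [ENNReal.toReal_ofReal (by positivity), lt_div_iff₀ (by positivity)] at hr
  have hsum : volume (closedBall s r ∩ C) + volume (closedBall s r \ C) = ENNReal.ofReal (2 * r) := by
    rw [measure_inter_add_sdiff _ hC, Real.volume_closedBall]
  have hf1 : volume (C ∩ closedBall s r) ≠ ⊤ :=
    ne_top_of_le_ne_top (by rw [Real.volume_closedBall]; exact ENNReal.ofReal_ne_top) (measure_mono (inter_subset_right (s := C) (t := closedBall s r)))
  have hf2 : volume (closedBall s r \ C) ≠ ⊤ :=
    ne_top_of_le_ne_top (by rw [Real.volume_closedBall]; exact ENNReal.ofReal_ne_top) (measure_mono (sdiff_subset (s := closedBall s r) (t := C)))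
  rw [inter_comm] at hsum
  have hsum' := congrArg ENNReal.toReal hsum
  rw [ENNReal.toReal_add hf1 hf2, ENNReal.toReal_ofReal (by positivity)] at hsum'
  have m1 := min_le_left (δ / 2) (1 / 2)
  have m2 := min_le_right (δ / 2) (1 / 2)
  constructor
  · rw [ENNReal.le_ofReal_iff_toReal_le hf2 (by positivity)]
    nlinarith
  · rw [ENNReal.ofReal_le_iff_le_toReal hf1]
    nlinarith

lemma ball_sdiff_add (Ω : Set E2) (hO : IsOpen Ω) (x : E2) (r : ℝ) (hr : 0 < r) :
    volume (Ω ∩ ball x r) / volume (ball x r) + volume (ball x r \ Ω) / volume (ball x r) = 1 := by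
  rw [← ENNReal.add_div, inter_comm, measure_inter_add_sdiff _ hO.measurableSet]
  apply ENNReal.div_self
  · exact (measure_ball_pos volume x hr).ne'
  · exact measure_ball_lt_top.ne

lemma density_in {Ω : Set E2} (hO : IsOpen Ω) (hH : μH[1] (frontier Ω) ≠ ⊤)
    {B : Fr} {ε h : ℝ} {F : Set E2} (hF : Flat B ε F) (hε : ε ≤ 1 / 2) (hh : 0 < h)
    (hFc : IsCompact F)
    (hFΓ : F ⊆ frontier Ω) (h1 : F ⊆ Side Ω B 1 h true) (h2 : F ⊆ Side Ω B (-1) h true)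
    {x : E2} (hx : x ∈ F) (hd : IsDens (cp B '' F) (cp B x)) : x ∈ densityPts Ω 1 := by
  have hCm : MeasurableSet (cp B '' F) := (hFc.image (continuous_cp B)).measurableSet
  have hz : Tendsto (fun r => volume (ball x r \ Ω) / volume (ball x r)) (𝓝[>] (0:ℝ)) (𝓝 0) := by
    rw [ENNReal.tendsto_nhds_zero]
    intro e he
    obtain ⟨δ, hδ0, hδ⟩ : ∃ δ : ℝ, 0 < δ ∧ ENNReal.ofReal δ ≤ e := by
      rcases eq_or_ne e ⊤ with rfl | htop
      · exact ⟨1, one_pos, le_top⟩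
      · exact ⟨e.toReal, ENNReal.toReal_pos he.ne' htop, by rw [ENNReal.ofReal_toReal htop]⟩
    filter_upwards [dens_bounds hCm hd δ hδ0, Ioo_mem_nhdsGT (show 0 < h / 2 by positivity)]
      with r hr hr1
    have hr0 : 0 < r := hr1.1
    have hsub : ball x r \ Ω ⊆ (closure Ω \ Ω) ∪ {z ∈ ball x r | cp B z ∉ cp B '' F} := by
      rintro z ⟨hz, hzO⟩
      by_cases hzC : cp B z ∈ cp B '' F
      · left; exact ⟨in_of_sides hF hε hFΓ h1 h2 hx (by linarith [hr1.2]) hz hzC, hzO⟩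
      · right; exact ⟨hz, hzC⟩
    have hle : volume (ball x r \ Ω) ≤ ENNReal.ofReal (2 * r) * ENNReal.ofReal (δ * r) := by
      refine (measure_mono hsub).trans ((measure_union_le _ _).trans ?_)
      rw [vol_closure_sdiff Ω hO hH, zero_add]
      refine (slab_le B (A := closedBall (cp B x) r \ cp B '' F)
        (measurableSet_closedBall.diff hCm) (cq B x) r ?_).trans (mul_le_mul' le_rfl hr.1)
      rintro z ⟨hz, hzC⟩
      rw [mem_ball, dist_eq_norm] at hz
      refine ⟨⟨?_, hzC⟩, ?_⟩
      · rw [mem_closedBall, Real.dist_eq, ← cp_sub]; exact (abs_cp_le B _).trans hz.le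
      · rw [← cq_sub]; exact (abs_cq_le B _).trans_lt hz
    rw [ENNReal.div_le_iff (measure_ball_pos volume x hr0).ne' measure_ball_lt_top.ne]
    refine hle.trans ?_
    rw [EuclideanSpace.volume_ball_fin_two, ← ENNReal.ofReal_pow hr0.le,
      ← ENNReal.ofReal_mul (by positivity), ← ENNReal.ofReal_mul (by positivity)]
    refine le_trans ?_ (mul_le_mul' hδ le_rfl)
    rw [← ENNReal.ofReal_mul hδ0.le]
    apply ENNReal.ofReal_le_ofReal
    have := Real.two_le_pi
    have h3 : 0 ≤ δ * r ^ 2 := by positivity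
    nlinarith
  have h3 : Tendsto (fun r => 1 - volume (ball x r \ Ω) / volume (ball x r)) (𝓝[>] (0:ℝ)) (𝓝 (1 - 0)) :=
    ENNReal.Tendsto.sub tendsto_const_nhds hz (Or.inl one_ne_top)
  rw [tsub_zero] at h3
  refine h3.congr' ?_
  filter_upwards [self_mem_nhdsWithin] with r hr
  have h4 := ball_sdiff_add Ω hO x r hr
  rw [← h4]
  apply ENNReal.add_sub_cancel_right
  apply ne_top_of_le_ne_top one_ne_top
  rw [← h4]; exact le_add_self

lemma density_out {Ω : Set E2} (hO : IsOpen Ω)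
    {B : Fr} {ε h σ : ℝ} {F : Set E2} (hF : Flat B ε F) (hε : ε ≤ 1 / 2) (hh : 0 < h)
    (hFc : IsCompact F) (hσ : σ = 1 ∨ σ = -1) (h1 : F ⊆ Side Ω B σ h false)
    {x : E2} (hx : x ∈ F) (hd : IsDens (cp B '' F) (cp B x)) : x ∉ densityPts Ω 1 := by
  intro hden
  have hCm : MeasurableSet (cp B '' F) := (hFc.image (continuous_cp B)).measurableSet
  have hlow : ∀ᶠ r in 𝓝[>] (0:ℝ),
      ENNReal.ofReal (1 / 48) ≤ volume (ball x r \ Ω) / volume (ball x r) := by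
    filter_upwards [thick_scale (dens_bounds hCm hd 1 one_pos) (1 / 3) (by norm_num),
      Ioo_mem_nhdsGT hh] with r hr hr1
    have hr0 : 0 < r := hr1.1
    have hle : ENNReal.ofReal (r / 4) * volume (cp B '' F ∩ closedBall (cp B x) (1 / 3 * r)) ≤
        volume (ball x r \ Ω) := by
      apply slice_lower B (hCm.inter measurableSet_closedBall)
        (measurableSet_ball.diff hO.measurableSet)
      rintro _ ⟨⟨p, hp, rfl⟩, hpb⟩
      rw [mem_closedBall, Real.dist_eq] at hpb
      refine (side_slice B σ hσ p (r / 4) (ball x r \ Ω) ?_).trans (measure_mono inter_subset_left)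
      intro t ht
      refine ⟨?_, (h1 hp t ⟨ht.1, by linarith [ht.2, hr1.2]⟩).2 rfl⟩
      rw [mem_ball, dist_eq_norm, add_sub_right_comm]
      have e1 : ‖(σ * t) • B 1‖ = t := by
        rw [norm_smul, B.norm_eq_one, mul_one, Real.norm_eq_abs, abs_mul, abs_of_pos ht.1]
        rcases hσ with rfl | rfl <;> simp
      have e2 := norm_le_fr B (p - x)
      have e3 := hF p hp x hx
      rw [cp_sub, cq_sub] at *
      have e4 : |cq B p - cq B x| ≤ r / 6 := by nlinarith [abs_nonneg (cp B p - cp B x)]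
      have e5 := norm_add_le (p - x) ((σ * t) • B 1)
      linarith [ht.2]
    rw [ENNReal.le_div_iff_mul_le (Or.inl (measure_ball_pos volume x hr0).ne')
      (Or.inl measure_ball_lt_top.ne)]
    refine le_trans ?_ ((mul_le_mul' le_rfl hr.2).trans hle)
    rw [EuclideanSpace.volume_ball_fin_two, ← ENNReal.ofReal_pow hr0.le,
      ← ENNReal.ofReal_mul (by positivity), ← ENNReal.ofReal_mul (by positivity),
      ← ENNReal.ofReal_mul (by positivity)]
    apply ENNReal.ofReal_le_ofReal
    nlinarith [Real.pi_le_four, sq_nonneg r]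
  have hev : ∀ᶠ r in 𝓝[>] (0:ℝ),
      volume (Ω ∩ ball x r) / volume (ball x r) + ENNReal.ofReal (1 / 48) ≤ 1 := by
    filter_upwards [hlow, self_mem_nhdsWithin] with r hr hr0
    rw [← ball_sdiff_add Ω hO x r hr0]
    gcongr
  have hlim : Tendsto (fun r => volume (Ω ∩ ball x r) / volume (ball x r) + ENNReal.ofReal (1 / 48))
      (𝓝[>] (0:ℝ)) (𝓝 (1 + ENNReal.ofReal (1 / 48))) := Tendsto.add hden tendsto_const_nhds
  have := le_of_tendsto hlim hev
  have h2 : (1 : ℝ≥0∞) < 1 + ENNReal.ofReal (1 / 48) :=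
    ENNReal.lt_add_right one_ne_top (by simp)
  exact absurd this (not_le.2 h2)

lemma ae_dens {C : Set ℝ} (hC : MeasurableSet C) : ∀ᵐ s : ℝ, s ∈ C → IsDens C s := by
  filter_upwards [Besicovitch.ae_tendsto_measure_inter_div_of_measurableSet volume hC] with s hs hsC
  unfold IsDens
  rw [indicator_of_mem hsC] at hs
  exact hs

structure Piece (Ω : Set E2) (ε : ℝ) (K : Set E2) (B : Fr) (b₁ b₂ : Bool) (h : ℝ) : Prop where
  compact : IsCompact K
  sub : K ⊆ frontier Ω
  flat : Flat B ε K
  hpos : 0 < h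
  up : K ⊆ Side Ω B 1 h b₁
  down : K ⊆ Side Ω B (-1) h b₂
  inn : b₁ = true → b₂ = true → K ⊆ densityPts Ω 1
  out : ¬ (b₁ = true ∧ b₂ = true) → Disjoint K (densityPts Ω 1)

lemma Piece.exists_h {Ω : Set E2} {ε : ℝ} (hO : IsOpen Ω) (hH : μH[1] (frontier Ω) ≠ ⊤)
    (hε0 : 0 ≤ ε) (hε : ε ≤ 1 / 2) {F : Set E2} {B : Fr} (hFc : IsCompact F)
    (hFΓ : F ⊆ frontier Ω) (hF : Flat B ε F) (b₁ b₂ : Bool) (h : ℝ) (hh : 0 < h) :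
    ∃ M : Set E2, MeasurableSet M ∧ M ⊆ F ∧
      μH[1] ((F ∩ Side Ω B 1 h b₁ ∩ Side Ω B (-1) h b₂) \ M) = 0 ∧
      ∀ K ⊆ M, IsCompact K → Piece Ω ε K B b₁ b₂ h := by
  set F' := F ∩ Side Ω B 1 h b₁ ∩ Side Ω B (-1) h b₂ with hF'
  have hF'c : IsCompact F' :=
    (hFc.inter_right (isClosed_Side Ω hO B 1 h b₁)).inter_right (isClosed_Side Ω hO B (-1) h b₂)
  have hF'F : F' ⊆ F := fun x hx => hx.1.1
  have hflat := hF.mono hF'F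
  have hCm : MeasurableSet (cp B '' F') := (hF'c.image (continuous_cp B)).measurableSet
  have hae := ae_dens hCm
  rw [ae_iff] at hae
  set N := toMeasurable volume {s | ¬ (s ∈ cp B '' F' → IsDens (cp B '' F') s)} with hN
  have hN0 : volume N = 0 := by rw [hN, measure_toMeasurable]; exact hae
  have hup : F' ⊆ Side Ω B 1 h b₁ := fun x hx => hx.1.2
  have hdown : F' ⊆ Side Ω B (-1) h b₂ := fun x hx => hx.2
  have hdens : ∀ x ∈ F' \ cp B ⁻¹' N, IsDens (cp B '' F') (cp B x) := by
    rintro x ⟨hx, hxN⟩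
    by_contra hcon
    apply hxN
    apply subset_toMeasurable
    simp only [mem_ofPred_eq, Classical.not_imp]
    exact ⟨⟨x, hx, rfl⟩, hcon⟩
  refine ⟨F' \ cp B ⁻¹' N, ?_, sdiff_subset.trans hF'F, ?_, ?_⟩
  · exact hF'c.measurableSet.diff ((continuous_cp B).measurable (measurableSet_toMeasurable _ _))
  · rw [sdiff_sdiff_right_self]
    exact hflat.null hε0 N hN0
  · intro K hK hKc
    have hKF : K ⊆ F' := hK.trans sdiff_subset
    refine ⟨hKc, (hKF.trans hF'F).trans hFΓ, hflat.mono hKF, hh, hKF.trans hup, hKF.trans hdown,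
      ?_, ?_⟩
    · rintro rfl rfl x hx
      exact density_in hO hH hflat hε hh hF'c (hF'F.trans hFΓ) hup hdown (hKF hx) (hdens x (hK hx))
    · intro hb
      rw [Set.disjoint_left]
      intro x hx
      by_cases h1 : b₁ = true
      · have h2 : b₂ = false := by simpa [h1] using hb
        subst h2
        exact density_out hO hflat hε hh hF'c (Or.inr rfl) hdown (hKF hx) (hdens x (hK hx))
      · have h2 : b₁ = false := by simpa using h1
        subst h2
        exact density_out hO hflat hε hh hF'c (Or.inl rfl) hup (hKF hx) (hdens x (hK hx))

lemma decomp (Ω : Set E2) (hO : IsOpen Ω) (hb : IsBounded Ω) (hH : μH[1] (frontier Ω) ≠ ⊤)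
    (hc : {C | ∃ x ∈ frontier Ω, C = connectedComponentIn (frontier Ω) x}.Finite)
    (ε : ℝ) (hε0 : 0 < ε) (hε : ε ≤ 1 / 2) (η : ℝ≥0∞) (hη : η ≠ 0) :
    ∃ (N : ℕ) (K : ℕ → Set E2) (B : ℕ → Fr) (b₁ b₂ : ℕ → Bool) (h : ℕ → ℝ),
      (∀ n, Piece Ω ε (K n) (B n) (b₁ n) (b₂ n) (h n)) ∧ Pairwise (Function.onFun Disjoint K) ∧
      μH[1] (frontier Ω \ ⋃ n ∈ Finset.range N, K n) < η := by
  have hΓ : IsCompact (frontier Ω) :=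
    isCompact_of_isClosed_isBounded isClosed_frontier (hb.closure.subset frontier_subset_closure)
  obtain ⟨F, B, hFc, hFf, hFΓ, hF0⟩ := flat_cover_all _ hΓ hH hc ε hε0
  let ι := ℕ × Bool × Bool × ℕ
  choose M hMm hMF hM0 hMP using fun i : ι => Piece.exists_h hO hH hε0.le hε (hFc i.1) (hFΓ i.1)
    (hFf i.1) i.2.1 i.2.2.1 (1 / ((i.2.2.2 : ℝ) + 1)) (by positivity)
  obtain ⟨e, he⟩ := exists_surjective_nat ι
  have hcov : μH[1] (frontier Ω \ ⋃ n, M (e n)) = 0 := by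
    set T : ι → Set E2 := fun i => F i.1 ∩ Side Ω (B i.1) 1 (1 / ((i.2.2.2 : ℝ) + 1)) i.2.1 ∩
      Side Ω (B i.1) (-1) (1 / ((i.2.2.2 : ℝ) + 1)) i.2.2.1 with hT
    have hsl : ∀ n, μH[1] (F n ∩ cp (B n) ⁻¹'
        {s | ¬ {y : ℝ | mkp (B n) s y ∈ frontier Ω}.Finite}) = 0 := fun n =>
      (hFf n).null hε0.le _ (ae_iff.1 (ae_finite_slice _ hH (B n)))
    refine measure_mono_null ?_ (measure_union_null hF0 (measure_union_null
      (measure_iUnion_null hsl) (measure_iUnion_null hM0)))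
    rintro x ⟨hx, hxM⟩
    by_cases hxF : x ∈ ⋃ n, F n
    · right
      obtain ⟨n, hn⟩ := mem_iUnion.1 hxF
      by_cases hfin : {y : ℝ | mkp (B n) (cp (B n) x) y ∈ frontier Ω}.Finite
      · right
        obtain ⟨h1, hh1, c1, hs1⟩ := exists_side Ω hO (B n) 1 one_ne_zero x hfin
        obtain ⟨h2, hh2, c2, hs2⟩ := exists_side Ω hO (B n) (-1) (by norm_num) x hfin
        obtain ⟨k, hk⟩ := exists_nat_one_div_lt (lt_min hh1 hh2)
        refine mem_iUnion.2 ⟨(n, c1, c2, k), ⟨⟨hn, ?_⟩, ?_⟩, ?_⟩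
        · exact Side_anti (hk.le.trans (min_le_left _ _)) hs1
        · exact Side_anti (hk.le.trans (min_le_right _ _)) hs2
        · intro hxM'
          obtain ⟨m, hm⟩ := he (n, c1, c2, k)
          exact hxM (mem_iUnion.2 ⟨m, by rw [hm]; exact hxM'⟩)
      · left; exact mem_iUnion.2 ⟨n, hn, hfin⟩
    · left; exact ⟨hx, hxF⟩
  obtain ⟨N, K, hKc, hKM, hKd, hKη⟩ := disj_compact _ hΓ.measurableSet hH (fun n => M (e n))
    (fun n => hMm _) (fun n => (hMF _).trans (hFΓ _)) hcov η hη
  exact ⟨N, K, fun n => B (e n).1, fun n => (e n).2.1, fun n => (e n).2.2.1,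
    fun n => 1 / (((e n).2.2.2 : ℝ) + 1), fun n => hMP (e n) (K n) (hKM n) (hKc n), hKd, hKη⟩


/-! ### volume lower bounds -/

noncomputable def nt (b : Bool) : ℝ := if b = true then 1 else 0

lemma nt_nonneg (b : Bool) : 0 ≤ nt b := by unfold nt; split_ifs <;> norm_num

lemma nt_not (b : Bool) : nt (!b) = 1 - nt b := by cases b <;> simp [nt]

lemma sep_thick (K : ℕ → Set E2) (hK : ∀ n, IsCompact (K n))
    (hd : Pairwise (Function.onFun Disjoint K)) (N : ℕ) :
    ∃ δ > 0, ∀ i ∈ Finset.range N, ∀ j ∈ Finset.range N, i ≠ j →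
      Disjoint (thickening δ (K i)) (thickening δ (K j)) := by
  have : ∀ᶠ δ in 𝓝[>] (0:ℝ), ∀ i ∈ Finset.range N, ∀ j ∈ Finset.range N, i ≠ j →
      Disjoint (thickening δ (K i)) (thickening δ (K j)) := by
    rw [Filter.eventually_all_finset]
    intro i _
    rw [Filter.eventually_all_finset]
    intro j _
    by_cases hij : i = j
    · exact Eventually.of_forall fun _ h => absurd hij h
    · obtain ⟨δ, hδ, hdis⟩ := (hd hij).exists_thickenings (hK i) (hK j).isClosed
      filter_upwards [Ioo_mem_nhdsGT hδ] with r hr _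
      exact hdis.mono (thickening_mono hr.2.le _) (thickening_mono hr.2.le _)
  obtain ⟨δ, h1, h2⟩ := (this.and self_mem_nhdsWithin).exists
  exact ⟨δ, h2, h1⟩

lemma piece_vol {K : Set E2} (hK : IsCompact K) (B : Fr) {h r : ℝ} (hr0 : 0 < r) (hr : r ≤ h)
    {X : Set E2} (hX : MeasurableSet X) (c₁ c₂ : Bool)
    (h1 : c₁ = true → ∀ p ∈ K, ∀ t ∈ Ioo 0 h, p + ((1:ℝ) * t) • B 1 ∈ X)
    (h2 : c₂ = true → ∀ p ∈ K, ∀ t ∈ Ioo 0 h, p + ((-1:ℝ) * t) • B 1 ∈ X) :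
    ENNReal.ofReal (r * (nt c₁ + nt c₂)) * volume (cp B '' K) ≤ volume (X ∩ thickening r K) := by
  apply slice_lower B (hK.image (continuous_cp B)).measurableSet
    (MeasurableSet.inter hX isOpen_thickening.measurableSet)
  rintro _ ⟨p, hp, rfl⟩
  have key : ∀ (σ : ℝ) (c : Bool), (σ = 1 ∨ σ = -1) →
      (c = true → ∀ p ∈ K, ∀ t ∈ Ioo 0 h, p + (σ * t) • B 1 ∈ X) →
      ENNReal.ofReal (r * nt c) ≤
        volume ({y : ℝ | mkp B (cp B p) y ∈ X ∩ thickening r K} ∩ {y | 0 < σ * (y - cq B p)}) := by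
    intro σ c hσ hh
    cases c
    · simp [nt]
    · simp only [nt, if_true, mul_one]
      apply side_slice B σ hσ
      intro t ht
      refine ⟨hh rfl p hp t ⟨ht.1, ht.2.trans_le hr⟩, ?_⟩
      rw [mem_thickening_iff]
      refine ⟨p, hp, ?_⟩
      have e1 : ‖(σ * t) • B 1‖ = t := by
        rw [norm_smul, B.norm_eq_one, mul_one, Real.norm_eq_abs, abs_mul, abs_of_pos ht.1]
        rcases hσ with rfl | rfl <;> simp
      rw [dist_eq_norm, add_sub_cancel_left, e1]; exact ht.2
  rw [mul_add, ENNReal.ofReal_add (mul_nonneg hr0.le (nt_nonneg _))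
    (mul_nonneg hr0.le (nt_nonneg _))]
  refine (add_le_add (key 1 c₁ (Or.inl rfl) h1) (key (-1) c₂ (Or.inr rfl) h2)).trans ?_
  rw [← measure_union]
  · exact measure_mono (union_subset inter_subset_left inter_subset_left)
  · rw [Set.disjoint_left]
    rintro y ⟨_, hy⟩ ⟨_, hy'⟩
    simp only [mem_ofPred_eq] at hy hy'
    linarith
  · apply MeasurableSet.inter
    · exact (continuous_mkp_left B _).measurable
        (MeasurableSet.inter hX isOpen_thickening.measurableSet)
    · exact (isOpen_lt continuous_const (by fun_prop)).measurableSet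

lemma vol_lower {Ω : Set E2} (hO : IsOpen Ω) (hb : IsBounded Ω) (hH : μH[1] (frontier Ω) ≠ ⊤) {ε : ℝ}
    {N : ℕ} {K : ℕ → Set E2} {B : ℕ → Fr} {b₁ b₂ : ℕ → Bool} {h : ℕ → ℝ}
    (hP : ∀ n, Piece Ω ε (K n) (B n) (b₁ n) (b₂ n) (h n))
    (hd : Pairwise (Function.onFun Disjoint K)) :
    ∀ᶠ r in 𝓝[>] (0:ℝ),
      r * ∑ i ∈ Finset.range N, (nt (b₁ i) + nt (b₂ i)) * (volume (cp (B i) '' K i)).toReal ≤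
        (volume (Ω ∩ thickening r (frontier Ω))).toReal ∧
      r * ∑ i ∈ Finset.range N, (2 - (nt (b₁ i) + nt (b₂ i))) * (volume (cp (B i) '' K i)).toReal ≤
        (volume (thickening r (frontier Ω) \ Ω)).toReal := by
  obtain ⟨δ, hδ, hsep⟩ := sep_thick K (fun n => (hP n).compact) hd N
  have hh : ∀ᶠ r in 𝓝[>] (0:ℝ), ∀ i ∈ Finset.range N, r ≤ h i := by
    rw [Filter.eventually_all_finset]
    intro i _
    filter_upwards [Ioo_mem_nhdsGT (hP i).hpos] with r hr using hr.2.le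
  filter_upwards [hh, Ioo_mem_nhdsGT hδ] with r hrh hrδ
  have hr0 : 0 < r := hrδ.1
  have hΓb : IsBounded (frontier Ω) := hb.closure.subset frontier_subset_closure
  have hfin : volume (thickening r (frontier Ω)) ≠ ⊤ := (hΓb.thickening).measure_lt_top.ne
  have key : ∀ (X : Set E2) (c₁ c₂ : ℕ → Bool), MeasurableSet X →
      (∀ n, c₁ n = true → ∀ p ∈ K n, ∀ t ∈ Ioo 0 (h n), p + ((1:ℝ) * t) • B n 1 ∈ X) →
      (∀ n, c₂ n = true → ∀ p ∈ K n, ∀ t ∈ Ioo 0 (h n), p + ((-1:ℝ) * t) • B n 1 ∈ X) →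
      r * ∑ i ∈ Finset.range N, (nt (c₁ i) + nt (c₂ i)) * (volume (cp (B i) '' K i)).toReal ≤
        (volume (X ∩ thickening r (frontier Ω))).toReal := by
    intro X c₁ c₂ hX h1 h2
    have hfX : volume (X ∩ thickening r (frontier Ω)) ≠ ⊤ :=
      ne_top_of_le_ne_top hfin (measure_mono inter_subset_right)
    have hcf : ∀ i, volume (cp (B i) '' K i) ≠ ⊤ := fun i =>
      ((hP i).compact.image (continuous_cp (B i))).measure_lt_top.ne
    have e1 : ∑ i ∈ Finset.range N, volume (X ∩ thickening r (K i)) ≤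
        volume (X ∩ thickening r (frontier Ω)) := by
      rw [← measure_biUnion_finset]
      · apply measure_mono
        apply iUnion₂_subset
        intro i _
        exact inter_subset_inter_right _ (thickening_subset_of_subset _ (hP i).sub)
      · intro i hi j hj hij
        exact (hsep i hi j hj hij).mono
          (inter_subset_right.trans (thickening_mono hrδ.2.le _))
          (inter_subset_right.trans (thickening_mono hrδ.2.le _))
      · intro i _
        exact MeasurableSet.inter hX isOpen_thickening.measurableSet
    have e2 := (Finset.sum_le_sum fun i hi => piece_vol (hP i).compact (B i) hr0 (hrh i hi) hX
      (c₁ i) (c₂ i) (h1 i) (h2 i)).trans e1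
    have e3 := ENNReal.toReal_mono hfX e2
    rw [ENNReal.toReal_sum (fun i _ => ENNReal.mul_ne_top ENNReal.ofReal_ne_top (hcf i))] at e3
    refine le_trans (le_of_eq ?_) e3
    rw [Finset.mul_sum]
    apply Finset.sum_congr rfl
    intro i _
    rw [ENNReal.toReal_mul, ENNReal.toReal_ofReal
      (mul_nonneg hr0.le (add_nonneg (nt_nonneg _) (nt_nonneg _)))]
    ring
  constructor
  · have := key (closure Ω) b₁ b₂ isClosed_closure.measurableSet
      (fun n hn p hp t ht => ((hP n).up hp t ht).1 hn)
      (fun n hn p hp t ht => ((hP n).down hp t ht).1 hn)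
    refine this.trans (ENNReal.toReal_mono
      (ne_top_of_le_ne_top hfin (measure_mono inter_subset_right)) ?_)
    have hs : closure Ω ∩ thickening r (frontier Ω) ⊆
        (Ω ∩ thickening r (frontier Ω)) ∪ (closure Ω \ Ω) := by
      rintro z ⟨hz, hz'⟩
      by_cases hzO : z ∈ Ω
      · left; exact ⟨hzO, hz'⟩
      · right; exact ⟨hz, hzO⟩
    refine (measure_mono hs).trans ((measure_union_le _ _).trans ?_)
    rw [vol_closure_sdiff Ω hO hH, add_zero]
  · have := key Ωᶜ (fun n => !b₁ n) (fun n => !b₂ n) hO.measurableSet.compl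
      (fun n hn p hp t ht => ((hP n).up hp t ht).2 (by simpa using hn))
      (fun n hn p hp t ht => ((hP n).down hp t ht).2 (by simpa using hn))
    rw [sdiff_eq, inter_comm]
    refine le_trans (le_of_eq ?_) this
    congr 1
    apply Finset.sum_congr rfl
    intro i _
    rw [nt_not, nt_not]; ring


/-! ### one dimensional integration by parts -/

lemma oned (T : Finset ℝ) : ∀ (χ p m : ℝ → ℝ),
    (∀ x y, x ≤ y → (∀ t ∈ T, t ∉ Icc x y) → χ x = χ y) →
    (∀ t ∈ T, ∀ᶠ y in 𝓝[>] t, χ y = p t) → (∀ t ∈ T, ∀ᶠ y in 𝓝[<] t, χ y = m t) →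
    ∀ G : ℝ → ℝ, ContDiff ℝ 1 G → HasCompactSupport G →
      Integrable (fun y => χ y * deriv G y) ∧
      ∫ y, χ y * deriv G y = ∑ t ∈ T, (m t - p t) * G t := by
  classical
  induction T using Finset.induction_on_max with
  | empty =>
    intro χ p m hχ _ _ G hG hGc
    have hc : ∀ y, χ y = χ 0 := by
      intro y
      rcases le_total y 0 with h | h
      · exact hχ y 0 h (by simp)
      · exact (hχ 0 y h (by simp)).symm
    have hi : Integrable (deriv G) :=
      (hG.continuous_deriv le_rfl).integrable_of_hasCompactSupport hGc.deriv
    simp only [hc, Finset.sum_empty]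
    refine ⟨hi.const_mul _, ?_⟩
    rw [integral_const_mul]
    have : ∫ y, deriv G y = 0 := by
      rw [← integral_add_compl (s := Iic 0) measurableSet_Iic hi, compl_Iic,
        hGc.integral_Ioi_deriv_eq hG, hGc.integral_Iic_deriv_eq hG]
      ring
    rw [this, mul_zero]
  | insert a T hlt ih =>
    intro χ p m hχ hp hm G hG hGc
    have hi : Integrable (deriv G) :=
      (hG.continuous_deriv le_rfl).integrable_of_hasCompactSupport hGc.deriv
    have haT : a ∉ T := fun h => lt_irrefl _ (hlt a h)
    have hr : ∀ y, a < y → χ y = p a := by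
      intro y hy
      obtain ⟨z, hz, hz1⟩ := ((hp a (Finset.mem_insert_self _ _)).and (Ioo_mem_nhdsGT hy)).exists
      rw [← hz]
      refine (hχ z y hz1.2.le ?_).symm
      intro t ht hti
      rcases Finset.mem_insert.1 ht with rfl | ht
      · linarith [hti.1, hz1.1]
      · linarith [hti.1, hz1.1, hlt t ht]
    have hl : ∀ y, y < a → (∀ t ∈ T, t < y) → χ y = m a := by
      intro y hy hyT
      obtain ⟨z, hz, hz1⟩ := ((hm a (Finset.mem_insert_self _ _)).and (Ioo_mem_nhdsLT hy)).exists
      rw [← hz]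
      refine hχ y z hz1.1.le ?_
      intro t ht hti
      rcases Finset.mem_insert.1 ht with rfl | ht
      · linarith [hti.2, hz1.2]
      · linarith [hti.1, hyT t ht]
    set χ' : ℝ → ℝ := fun y => if y < a then χ y else m a with hχ'
    have h1 := ih χ' p m ?_ ?_ ?_ G hG hGc
    · have hae : (fun y => χ y * deriv G y) =ᵐ[volume]
          fun y => χ' y * deriv G y + (p a - m a) * (Ioi a).indicator (deriv G) y := by
        have : ∀ᵐ y : ℝ, y ≠ a := by simp [ae_iff]
        filter_upwards [this] with y hy
        rcases lt_or_gt_of_ne hy with h | h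
        · have : y ∉ Ioi a := fun h' => lt_asymm h h'
          simp [hχ', h, indicator_of_notMem this]
        · have h' : y ∈ Ioi a := h
          rw [indicator_of_mem h', hr y h]
          simp only [hχ', not_lt.2 h.le, if_false]
          ring
      have hi2 : Integrable (fun y => (p a - m a) * (Ioi a).indicator (deriv G) y) :=
        (hi.indicator measurableSet_Ioi).const_mul _
      refine ⟨(h1.1.add hi2).congr hae.symm, ?_⟩
      rw [integral_congr_ae hae, integral_add h1.1 hi2, h1.2, integral_const_mul,
        integral_indicator measurableSet_Ioi, hGc.integral_Ioi_deriv_eq hG,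
        Finset.sum_insert haT]
      ring
    · intro x y hxy hT
      simp only [hχ']
      by_cases hy : y < a
      · rw [if_pos hy, if_pos (hxy.trans_lt hy)]
        apply hχ x y hxy
        intro t ht hti
        rcases Finset.mem_insert.1 ht with rfl | ht
        · linarith [hti.2]
        · exact hT t ht hti
      · rw [if_neg hy]
        by_cases hx : x < a
        · rw [if_pos hx]
          apply hl x hx
          intro t ht
          by_contra hcon
          exact hT t ht ⟨not_lt.1 hcon, (hlt t ht).le.trans (not_lt.1 hy)⟩
        · rw [if_neg hx]
    · intro t ht
      filter_upwards [hp t (Finset.mem_insert_of_mem ht), Ioo_mem_nhdsGT (hlt t ht)] with y hy hy'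
      simp only [hχ']
      rw [if_pos hy'.2]; exact hy
    · intro t ht
      filter_upwards [hm t (Finset.mem_insert_of_mem ht), self_mem_nhdsWithin] with y hy hy'
      simp only [hχ']
      rw [if_pos (lt_trans hy' (hlt t ht))]; exact hy

/-- the one-sided traces of `Ω` along a line -/
def IsTr (Ω : Set E2) (B : Fr) (σ : ℝ) (x : E2) (v : ℝ) : Prop :=
  ∀ᶠ t in 𝓝[>] (0:ℝ), Ω.indicator (fun _ => (1:ℝ)) (x + (σ * t) • B 1) = v

lemma IsTr.unique {Ω : Set E2} {B : Fr} {σ : ℝ} {x : E2} {v w : ℝ} (h : IsTr Ω B σ x v)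
    (h' : IsTr Ω B σ x w) : v = w := by
  obtain ⟨t, h1, h2⟩ := (Eventually.and h h').exists
  exact h1.symm.trans h2

lemma isTr_of_side {Ω : Set E2} (hO : IsOpen Ω) {B : Fr} {σ : ℝ} (hσ : σ ≠ 0) {x : E2}
    (hf : {y : ℝ | mkp B (cp B x) y ∈ frontier Ω}.Finite) {h : ℝ} (hh : 0 < h) {b : Bool}
    (hs : x ∈ Side Ω B σ h b) : IsTr Ω B σ x (nt b) := by
  have hinj : Function.Injective (fun t : ℝ => cq B x + σ * t) := fun t t' h => by
    simpa [hσ] using h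
  have hf' : {t : ℝ | x + (σ * t) • B 1 ∈ frontier Ω}.Finite := by
    have := hf.preimage (hinj.injOn)
    refine this.subset ?_
    intro t ht
    simp only [mem_preimage, mem_ofPred_eq]
    rw [mkp_add_smul]; exact ht
  have hev : ∀ᶠ t in 𝓝[>] (0:ℝ), x + (σ * t) • B 1 ∉ frontier Ω := by
    have h1 : ∀ᶠ t in 𝓝[≠] (0:ℝ), t ∉ {t : ℝ | x + (σ * t) • B 1 ∈ frontier Ω} \ {0} := by
      have : IsClosed ({t : ℝ | x + (σ * t) • B 1 ∈ frontier Ω} \ {0}) :=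
        (hf'.subset sdiff_subset).isClosed
      exact nhdsWithin_le_nhds (this.isOpen_compl.mem_nhds (by simp))
    have h2 : 𝓝[>] (0:ℝ) ≤ 𝓝[≠] 0 := nhdsWithin_mono _ (fun t ht => ne_of_gt ht)
    filter_upwards [h2 h1, self_mem_nhdsWithin] with t ht ht0 htf
    exact ht ⟨htf, ne_of_gt ht0⟩
  unfold IsTr
  filter_upwards [hev, Ioo_mem_nhdsGT hh] with t ht hth
  have := hs t hth
  cases b
  · rw [indicator_of_notMem (this.2 rfl)]; simp [nt]
  · have hO' : x + (σ * t) • B 1 ∈ Ω := by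
      by_contra hcon
      apply ht
      rw [hO.frontier_eq]
      exact ⟨this.1 rfl, hcon⟩
    rw [indicator_of_mem hO']; simp [nt]

lemma slice_formula (Ω : Set E2) (hO : IsOpen Ω) (B : Fr) (s : ℝ)
    (hf : {y : ℝ | mkp B s y ∈ frontier Ω}.Finite) :
    ∃ p m : ℝ → ℝ, (∀ y, p y = 0 ∨ p y = 1) ∧ (∀ y, m y = 0 ∨ m y = 1) ∧
      (∀ y, IsTr Ω B 1 (mkp B s y) (p y)) ∧ (∀ y, IsTr Ω B (-1) (mkp B s y) (m y)) ∧
      ∀ g : E2 → ℝ, ContDiff ℝ 1 g → HasCompactSupport g →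
        ∫ y, Ω.indicator (fun x => fderiv ℝ g x (B 1)) (mkp B s y) =
          ∑ y ∈ hf.toFinset, (m y - p y) * g (mkp B s y) := by
  have hex : ∀ σ : ℝ, σ ≠ 0 → ∀ y, ∃ v, (v = 0 ∨ v = 1) ∧ IsTr Ω B σ (mkp B s y) v := by
    intro σ hσ y
    have hf' : {y' : ℝ | mkp B (cp B (mkp B s y)) y' ∈ frontier Ω}.Finite := by
      rw [cp_mkp]; exact hf
    obtain ⟨h, hh, b, hb⟩ := exists_side Ω hO B σ hσ (mkp B s y) hf'
    refine ⟨nt b, ?_, isTr_of_side hO hσ hf' hh hb⟩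
    cases b <;> simp [nt]
  choose p hp1 hp using hex 1 one_ne_zero
  choose m hm1 hm using hex (-1) (by norm_num)
  refine ⟨p, m, hp1, hm1, hp, hm, ?_⟩
  intro g hg hgc
  have hmk : ∀ y t : ℝ, mkp B s y + t • B 1 = mkp B s (y + t) := by
    intro y t
    rw [← mkp_add_smul, cp_mkp, cq_mkp]
  have hmd : ∀ y, HasDerivAt (fun y => mkp B s y) (B 1) y := by
    intro y
    unfold mkp
    simpa using ((hasDerivAt_id y).smul_const (B 1)).const_add (s • B 0)
  have hmC : ContDiff ℝ 1 (fun y => mkp B s y) := by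
    unfold mkp; fun_prop
  have hder : ∀ y, deriv (fun y => g (mkp B s y)) y = fderiv ℝ g (mkp B s y) (B 1) := by
    intro y
    have h1 : HasFDerivAt g (fderiv ℝ g (mkp B s y)) (mkp B s y) :=
      (hg.differentiable one_ne_zero _).hasFDerivAt
    exact (h1.comp_hasDerivAt y (hmd y)).deriv
  have hcs : HasCompactSupport (fun y => g (mkp B s y)) := by
    apply hgc.comp_isClosedEmbedding
    have hanti : Isometry (fun y : ℝ => mkp B s y) := by
      apply Isometry.of_dist_eq
      intro y y'
      rw [dist_eq_norm]
      have : mkp B s y - mkp B s y' = (y - y') • B 1 := by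
        unfold mkp; rw [sub_smul]; abel
      rw [this, norm_smul, B.norm_eq_one, mul_one, Real.dist_eq, Real.norm_eq_abs]
    exact hanti.isClosedEmbedding
  have := (oned hf.toFinset (fun y => Ω.indicator (fun _ => (1:ℝ)) (mkp B s y)) p m ?_ ?_ ?_
    (fun y => g (mkp B s y)) (hg.comp hmC) hcs).2
  · rw [← this]
    congr 1
    ext y
    rw [hder]
    by_cases hy : mkp B s y ∈ Ω
    · rw [indicator_of_mem hy, indicator_of_mem hy, one_mul]
    · rw [indicator_of_notMem hy, indicator_of_notMem hy, zero_mul]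
  · intro x y hxy hT
    have hpre : IsPreconnected ((fun y => mkp B s y) '' Icc x y) :=
      isPreconnected_Icc.image _ (continuous_mkp_left B s).continuousOn
    have := frontier_dichotomy Ω hO _ hpre (by
      rintro _ ⟨z, hz, rfl⟩ hzf
      exact hT z (by simpa using hzf) hz)
    have hx : mkp B s x ∈ (fun y => mkp B s y) '' Icc x y := ⟨x, left_mem_Icc.2 hxy, rfl⟩
    have hy : mkp B s y ∈ (fun y => mkp B s y) '' Icc x y := ⟨y, right_mem_Icc.2 hxy, rfl⟩
    rcases this with h | h
    · rw [indicator_of_mem (h hx), indicator_of_mem (h hy)]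
    · rw [indicator_of_notMem (h _ hx), indicator_of_notMem (h _ hy)]
  · intro y _
    have h1 := hp y
    unfold IsTr at h1
    have h2 : Tendsto (fun z : ℝ => z - y) (𝓝[>] y) (𝓝[>] 0) := by
      apply tendsto_nhdsWithin_of_tendsto_nhds_of_eventually_within
      · have : Tendsto (fun z : ℝ => z - y) (𝓝 y) (𝓝 (y - y)) := tendsto_id.sub_const y
        rw [sub_self] at this
        exact this.mono_left nhdsWithin_le_nhds
      · filter_upwards [self_mem_nhdsWithin] with z hz
        exact sub_pos.2 (mem_Ioi.1 hz)
    filter_upwards [h2.eventually h1] with z hz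
    rw [hmk, one_mul, add_sub_cancel] at hz
    exact hz
  · intro y _
    have h1 := hm y
    unfold IsTr at h1
    have h2 : Tendsto (fun z : ℝ => y - z) (𝓝[<] y) (𝓝[>] 0) := by
      apply tendsto_nhdsWithin_of_tendsto_nhds_of_eventually_within
      · have : Tendsto (fun z : ℝ => y - z) (𝓝 y) (𝓝 (y - y)) := tendsto_id.const_sub y
        rw [sub_self] at this
        exact this.mono_left nhdsWithin_le_nhds
      · filter_upwards [self_mem_nhdsWithin] with z hz
        exact sub_pos.2 (mem_Iio.1 hz)
    filter_upwards [h2.eventually h1] with z hz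
    rw [hmk, neg_one_mul, neg_sub, add_sub_cancel] at hz
    exact hz


/-! ### slicing bounds for directional derivatives -/

lemma integrable_dir (Ω : Set E2) (hO : IsOpen Ω) {g : E2 → ℝ} (hg : ContDiff ℝ 1 g)
    (hgc : HasCompactSupport g) (v : E2) :
    Integrable (Ω.indicator (fun x => fderiv ℝ g x v)) := by
  apply Integrable.indicator _ hO.measurableSet
  apply Continuous.integrable_of_hasCompactSupport
  · exact (hg.continuous_fderiv one_ne_zero).clm_apply continuous_const
  · have := hgc.fderiv (𝕜 := ℝ)
    exact this.comp_left (g := fun L : E2 →L[ℝ] ℝ => L v) (by simp)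

lemma int_bound (Ω : Set E2) (hO : IsOpen Ω) (B : Fr) {g : E2 → ℝ} (hg : ContDiff ℝ 1 g)
    (hgc : HasCompactSupport g) (c : ℝ → ℝ) (hc : Integrable c) (G : ℝ → ℝ≥0∞) (M : ℝ)
    (hM0 : 0 ≤ M) (hM : ∫⁻ s, G s ≤ ENNReal.ofReal M)
    (h : ∀ᵐ s : ℝ, ENNReal.ofReal
      |(∫ y, Ω.indicator (fun x => fderiv ℝ g x (B 1)) (mkp B s y)) - c s| ≤ G s) :
    |(∫ x in Ω, fderiv ℝ g x (B 1)) - ∫ s, c s| ≤ M := by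
  set f := Ω.indicator (fun x => fderiv ℝ g x (B 1)) with hf
  have hfi : Integrable f := integrable_dir Ω hO hg hgc (B 1)
  have hmp := (frEquiv_mp B).symm
  have e1 : ∫ x in Ω, fderiv ℝ g x (B 1) = ∫ z : ℝ × ℝ, f (mkp B z.1 z.2) := by
    rw [← integral_indicator hO.measurableSet, ← hf, ← hmp.integral_comp' f]
    congr 1
    ext z
    rw [frEquiv_symm_apply]
  have hi2 : Integrable (fun z : ℝ × ℝ => f (mkp B z.1 z.2)) := by
    have := (mkp_mp B).integrable_comp_of_integrable hfi
    exact this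
  rw [Measure.volume_eq_prod] at e1 hi2
  rw [integral_prod _ hi2] at e1
  have hJ := hi2.integral_prod_left
  rw [e1, ← integral_sub hJ hc]
  have := enorm_integral_le_lintegral_enorm
    (μ := volume) (fun s => (∫ y, f (mkp B s y)) - c s)
  have h2 : ∫⁻ s, ‖(∫ y, f (mkp B s y)) - c s‖ₑ ≤ ENNReal.ofReal M := by
    refine le_trans (lintegral_mono_ae ?_) hM
    filter_upwards [h] with s hs
    rw [Real.enorm_eq_ofReal_abs]; exact hs
  have h3 := this.trans h2
  rw [Real.enorm_eq_ofReal_abs] at h3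
  exact (ENNReal.ofReal_le_ofReal_iff hM0).1 h3

lemma count_le {B : Fr} {A : Set E2} {s : ℝ} {c : ℝ≥0∞}
    (hG : ∀ F : Finset E2, ↑F ⊆ A ∩ cp B ⁻¹' {s} → (F.card : ℝ≥0∞) ≤ c)
    (F : Finset ℝ) (hF : ∀ y ∈ F, mkp B s y ∈ A) : (F.card : ℝ≥0∞) ≤ c := by
  classical
  have hinj : Function.Injective (fun y => mkp B s y) := by
    intro y y' h
    have := congrArg (cq B) h
    simpa [cq_mkp] using this
  rw [← Finset.card_image_of_injective F hinj]
  apply hG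
  intro x hx
  simp only [Finset.coe_image, mem_image, Finset.mem_coe] at hx
  obtain ⟨y, hy, rfl⟩ := hx
  exact ⟨hF y hy, cp_mkp B s y⟩

lemma dir_upper (Ω : Set E2) (hO : IsOpen Ω) (hH : μH[1] (frontier Ω) ≠ ⊤) (B : Fr) {g : E2 → ℝ}
    (hg : ContDiff ℝ 1 g) (hgc : HasCompactSupport g) (hg1 : ∀ x, |g x| ≤ 1)
    (A₁ A₂ : Set E2) (hA₁ : μH[1] A₁ ≠ ⊤) (hA₂ : μH[1] A₂ ≠ ⊤) (k : NNReal)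
    (hk : LipschitzOnWith k (cp B) A₁)
    (hz : ∀ x ∈ frontier Ω, x ∉ A₁ → x ∉ A₂ → g x = 0 ∨
      ∃ h > 0, ∃ b, x ∈ Side Ω B 1 h b ∧ x ∈ Side Ω B (-1) h b) :
    |∫ x in Ω, fderiv ℝ g x (B 1)| ≤ k * (μH[1] A₁).toReal + (μH[1] A₂).toReal := by
  classical
  obtain ⟨G₁, hG₁, hc₁, hi₁⟩ := eilenberg_count A₁ hA₁ (cp B) k hk
  obtain ⟨G₂, hG₂, hc₂, hi₂⟩ := eilenberg_count A₂ hA₂ (cp B) 1 ((cp_lip B).lipschitzOnWith)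
  have := int_bound Ω hO B hg hgc (fun _ => 0) (integrable_zero _ _ _) (fun s => G₁ s + G₂ s)
    (k * (μH[1] A₁).toReal + (μH[1] A₂).toReal) (by positivity) ?_ ?_
  · simpa using this
  · rw [lintegral_add_left hG₁]
    refine (add_le_add hi₁ hi₂).trans (le_of_eq ?_)
    rw [ENNReal.ofReal_add (by positivity) (by positivity), ENNReal.ofReal_mul (by positivity),
      ENNReal.ofReal_toReal hA₁, ENNReal.ofReal_toReal hA₂]
    simp
  · filter_upwards [ae_finite_slice _ hH B] with s hf
    obtain ⟨p, m, hp01, hm01, hp, hm, hform⟩ := slice_formula Ω hO B s hf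
    rw [hform g hg hgc, sub_zero]
    set T := hf.toFinset with hT
    have hterm : ∀ y ∈ T, |(m y - p y) * g (mkp B s y)| ≤
        (if mkp B s y ∈ A₁ then 1 else 0) + (if mkp B s y ∈ A₂ then 1 else 0) := by
      intro y hy
      have hyΓ : mkp B s y ∈ frontier Ω := by simpa [hT] using hy
      have hb : |(m y - p y) * g (mkp B s y)| ≤ 1 := by
        rw [abs_mul]
        have : |m y - p y| ≤ 1 := by
          rcases hp01 y with h | h <;> rcases hm01 y with h' | h' <;> rw [h, h'] <;> norm_num
        exact mul_le_one₀ this (abs_nonneg _) (hg1 _)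
      by_cases h1 : mkp B s y ∈ A₁
      · rw [if_pos h1]; refine hb.trans ?_; split_ifs <;> norm_num
      · by_cases h2 : mkp B s y ∈ A₂
        · rw [if_pos h2, if_neg h1]; simpa using hb
        · rw [if_neg h1, if_neg h2]
          rcases hz _ hyΓ h1 h2 with h | ⟨h, hh, b, hu, hd⟩
          · rw [h]; simp
          · have hf' : {y' : ℝ | mkp B (cp B (mkp B s y)) y' ∈ frontier Ω}.Finite := by
              rw [cp_mkp]; exact hf
            have e1 := (hp y).unique (isTr_of_side hO one_ne_zero hf' hh hu)
            have e2 := (hm y).unique (isTr_of_side hO (by norm_num) hf' hh hd)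
            rw [e1, e2]; simp
    have hsum : |∑ y ∈ T, (m y - p y) * g (mkp B s y)| ≤
        ((T.filter fun y => mkp B s y ∈ A₁).card : ℝ) + ((T.filter fun y => mkp B s y ∈ A₂).card : ℝ) := by
      refine (Finset.abs_sum_le_sum_abs _ _).trans ((Finset.sum_le_sum hterm).trans (le_of_eq ?_))
      rw [Finset.sum_add_distrib, Finset.sum_boole, Finset.sum_boole]
    refine (ENNReal.ofReal_le_ofReal hsum).trans ?_
    rw [ENNReal.ofReal_add (by positivity) (by positivity), ENNReal.ofReal_natCast,
      ENNReal.ofReal_natCast]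
    exact add_le_add (count_le (hc₁ s) _ (by simp)) (count_le (hc₂ s) _ (by simp))

lemma dir_lower (Ω : Set E2) (hO : IsOpen Ω) (hH : μH[1] (frontier Ω) ≠ ⊤) {g : E2 → ℝ}
    (hg : ContDiff ℝ 1 g) (hgc : HasCompactSupport g) (hg1 : ∀ x, |g x| ≤ 1)
    {ε h : ℝ} {K : Set E2} {B : Fr} {b₁ b₂ : Bool} (hP : Piece Ω ε K B b₁ b₂ h)
    (hgK : ∀ x ∈ K, g x = 1)
    (A : Set E2) (hA : μH[1] A ≠ ⊤) 
    (hz : ∀ x ∈ frontier Ω, x ∉ K → x ∉ A → g x = 0) :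
    |(∫ x in Ω, fderiv ℝ g x (B 1)) - (nt b₂ - nt b₁) * (volume (cp B '' K)).toReal|
      ≤ (μH[1] A).toReal := by
  classical
  obtain ⟨G, hG, hc, hi⟩ := eilenberg_count A hA (cp B) 1 ((cp_lip B).lipschitzOnWith)
  have hCc : IsCompact (cp B '' K) := hP.compact.image (continuous_cp B)
  have hci : Integrable (fun s => (nt b₂ - nt b₁) * (cp B '' K).indicator (fun _ => (1:ℝ)) s) := by
    apply Integrable.const_mul
    rw [integrable_indicator_iff hCc.measurableSet]
    exact integrableOn_const hCc.measure_lt_top.ne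
  have := int_bound Ω hO B hg hgc _ hci G (μH[1] A).toReal (by positivity) ?_ ?_
  · rw [integral_const_mul, integral_indicator hCc.measurableSet] at this
    simpa [Measure.real] using this
  · rw [ENNReal.ofReal_toReal hA]; simpa using hi
  · filter_upwards [ae_finite_slice _ hH B] with s hf
    obtain ⟨p, m, hp01, hm01, hp, hm, hform⟩ := slice_formula Ω hO B s hf
    rw [hform g hg hgc]
    set T := hf.toFinset with hT
    have hKsum : ∑ y ∈ T.filter (fun y => mkp B s y ∈ K), (m y - p y) * g (mkp B s y) =
        (nt b₂ - nt b₁) * (cp B '' K).indicator (fun _ => (1:ℝ)) s := by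
      by_cases hs : s ∈ cp B '' K
      · rw [indicator_of_mem hs]
        obtain ⟨x, hx, hxs⟩ := hs
        have hfil : T.filter (fun y => mkp B s y ∈ K) = {cq B x} := by
          ext y
          simp only [hT, Finset.mem_filter, Finite.mem_toFinset, mem_ofPred_eq,
            Finset.mem_singleton]
          constructor
          · rintro ⟨_, hy⟩
            have := hP.flat _ hy x hx
            rw [cp_sub, cq_sub, cp_mkp, cq_mkp, hxs, sub_self, abs_zero, mul_zero] at this
            have := abs_nonpos_iff.1 this
            linarith
          · rintro rfl
            rw [← hxs, mkp_cp_cq]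
            exact ⟨hP.sub hx, hx⟩
        have hmx : mkp B s (cq B x) = x := by rw [← hxs, mkp_cp_cq]
        have hf' : {y' : ℝ | mkp B (cp B x) y' ∈ frontier Ω}.Finite := by
          rw [hxs]; exact hf
        have h1 := hp (cq B x)
        have h2 := hm (cq B x)
        rw [hmx] at h1 h2
        rw [hfil, Finset.sum_singleton, hmx, hgK x hx,
          h1.unique (isTr_of_side hO one_ne_zero hf' hP.hpos (hP.up hx)),
          h2.unique (isTr_of_side hO (by norm_num) hf' hP.hpos (hP.down hx))]
      · rw [indicator_of_notMem hs, mul_zero]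
        apply Finset.sum_eq_zero
        intro y hy
        exact absurd ⟨_, (Finset.mem_filter.1 hy).2, cp_mkp B s y⟩ hs
    rw [← Finset.sum_filter_add_sum_filter_not T (fun y => mkp B s y ∈ K), hKsum,
      add_sub_cancel_left]
    have hterm : ∀ y ∈ T.filter (fun y => mkp B s y ∉ K), |(m y - p y) * g (mkp B s y)| ≤
        (if mkp B s y ∈ A then 1 else 0) := by
      intro y hy
      obtain ⟨hy, hyK⟩ := Finset.mem_filter.1 hy
      have hyΓ : mkp B s y ∈ frontier Ω := by simpa [hT] using hy
      have hb : |(m y - p y) * g (mkp B s y)| ≤ 1 := by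
        rw [abs_mul]
        have : |m y - p y| ≤ 1 := by
          rcases hp01 y with h | h <;> rcases hm01 y with h' | h' <;> rw [h, h'] <;> norm_num
        exact mul_le_one₀ this (abs_nonneg _) (hg1 _)
      by_cases h2 : mkp B s y ∈ A
      · rw [if_pos h2]; simpa using hb
      · rw [if_neg h2, hz _ hyΓ hyK h2]; simp
    have hsum : |∑ y ∈ T.filter (fun y => mkp B s y ∉ K), (m y - p y) * g (mkp B s y)| ≤
        (((T.filter (fun y => mkp B s y ∉ K)).filter fun y => mkp B s y ∈ A).card : ℝ) := by
      refine (Finset.abs_sum_le_sum_abs _ _).trans ((Finset.sum_le_sum hterm).trans (le_of_eq ?_))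
      rw [Finset.sum_boole]
    refine (ENNReal.ofReal_le_ofReal hsum).trans ?_
    rw [ENNReal.ofReal_natCast]
    exact count_le (hc s) _ (fun y hy => (Finset.mem_filter.1 hy).2)


/-! ### perimeter estimates -/

noncomputable def cpL (B : Fr) : E2 →L[ℝ] ℝ :=
  LinearMap.toContinuousLinearMap
    { toFun := cp B, map_add' := cp_add B, map_smul' := fun c x => cp_smul B c x }

noncomputable def cqL (B : Fr) : E2 →L[ℝ] ℝ :=
  LinearMap.toContinuousLinearMap
    { toFun := cq B, map_add' := cq_add B, map_smul' := fun c x => cq_smul B c x }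

lemma cpL_apply (B : Fr) (x : E2) : cpL B x = cp B x := rfl
lemma cqL_apply (B : Fr) (x : E2) : cqL B x = cq B x := rfl

lemma divg_fr (B : Fr) (φ : E2 → E2) (x : E2) :
    divg φ x = cp B (fderiv ℝ φ x (B 0)) + cq B (fderiv ℝ φ x (B 1)) := by
  have h1 := LinearMap.trace_eq_sum_inner (fderiv ℝ φ x : E2 →ₗ[ℝ] E2) B
  have h2 := LinearMap.trace_eq_sum_inner (fderiv ℝ φ x : E2 →ₗ[ℝ] E2)
    (EuclideanSpace.basisFun (Fin 2) ℝ)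
  rw [h1] at h2
  have h3 : divg φ x = ∑ i, inner ℝ ((EuclideanSpace.basisFun (Fin 2) ℝ) i)
      ((fderiv ℝ φ x : E2 →ₗ[ℝ] E2) ((EuclideanSpace.basisFun (Fin 2) ℝ) i)) := by
    unfold divg
    apply Finset.sum_congr rfl
    intro i _
    rw [EuclideanSpace.basisFun_apply, EuclideanSpace.inner_single_left]
    simp
  rw [h3, ← h2, Fin.sum_univ_two]
  simp [cp, cq, OrthonormalBasis.repr_apply_apply]

lemma contDiff_cp_comp (B : Fr) {ψ : E2 → E2} (hψ : ContDiff ℝ 1 ψ) :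
    ContDiff ℝ 1 (fun x => cp B (ψ x)) := (cpL B).contDiff.comp hψ

lemma contDiff_cq_comp (B : Fr) {ψ : E2 → E2} (hψ : ContDiff ℝ 1 ψ) :
    ContDiff ℝ 1 (fun x => cq B (ψ x)) := (cqL B).contDiff.comp hψ

lemma cs_cp_comp (B : Fr) {ψ : E2 → E2} (hψ : HasCompactSupport ψ) :
    HasCompactSupport (fun x => cp B (ψ x)) := hψ.comp_left (g := cp B) (cpL B).map_zero

lemma cs_cq_comp (B : Fr) {ψ : E2 → E2} (hψ : HasCompactSupport ψ) :
    HasCompactSupport (fun x => cq B (ψ x)) := hψ.comp_left (g := cq B) (cqL B).map_zero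

lemma fderiv_cp_comp (B : Fr) {ψ : E2 → E2} (hψ : ContDiff ℝ 1 ψ) (x v : E2) :
    fderiv ℝ (fun x => cp B (ψ x)) x v = cp B (fderiv ℝ ψ x v) := by
  have h := (cpL B).hasFDerivAt.comp x (hψ.differentiable one_ne_zero x).hasFDerivAt
  have h' : fderiv ℝ (fun x => cp B (ψ x)) x = (cpL B).comp (fderiv ℝ ψ x) := h.fderiv
  rw [h']; rfl

lemma fderiv_cq_comp (B : Fr) {ψ : E2 → E2} (hψ : ContDiff ℝ 1 ψ) (x v : E2) :
    fderiv ℝ (fun x => cq B (ψ x)) x v = cq B (fderiv ℝ ψ x v) := by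
  have h := (cqL B).hasFDerivAt.comp x (hψ.differentiable one_ne_zero x).hasFDerivAt
  have h' : fderiv ℝ (fun x => cq B (ψ x)) x = (cqL B).comp (fderiv ℝ ψ x) := h.fderiv
  rw [h']; rfl

lemma div_split (Ω : Set E2) (hO : IsOpen Ω) (B : Fr) {ψ : E2 → E2} (hψ : ContDiff ℝ 1 ψ)
    (hc : HasCompactSupport ψ) :
    IntegrableOn (divg ψ) Ω ∧ ∫ x in Ω, divg ψ x =
      (∫ x in Ω, fderiv ℝ (fun x => cp B (ψ x)) x (swapFr B 1)) +
      ∫ x in Ω, fderiv ℝ (fun x => cq B (ψ x)) x (B 1) := by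
  have i1 : IntegrableOn (fun x => fderiv ℝ (fun x => cp B (ψ x)) x (swapFr B 1)) Ω :=
    (integrable_indicator_iff hO.measurableSet).1
      (integrable_dir Ω hO (contDiff_cp_comp B hψ) (cs_cp_comp B hc) _)
  have i2 : IntegrableOn (fun x => fderiv ℝ (fun x => cq B (ψ x)) x (B 1)) Ω :=
    (integrable_indicator_iff hO.measurableSet).1
      (integrable_dir Ω hO (contDiff_cq_comp B hψ) (cs_cq_comp B hc) _)
  have e : divg ψ = fun x => fderiv ℝ (fun x => cp B (ψ x)) x (swapFr B 1) +
      fderiv ℝ (fun x => cq B (ψ x)) x (B 1) := by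
    ext x
    rw [divg_fr B, fderiv_cp_comp B hψ, fderiv_cq_comp B hψ, swapFr_1]
  rw [e]
  exact ⟨i1.add i2, integral_add i1 i2⟩

/-- admissible fields -/
def Adm (ψ : E2 → E2) : Prop := ContDiff ℝ 1 ψ ∧ HasCompactSupport ψ

lemma exists_fr : Nonempty Fr := ⟨EuclideanSpace.basisFun (Fin 2) ℝ⟩

lemma divg_add (Ω : Set E2) (hO : IsOpen Ω) {ψ χ : E2 → E2} (hψ : Adm ψ) (hχ : Adm χ) :
    Adm (fun x => ψ x + χ x) ∧ ∫ x in Ω, divg (fun x => ψ x + χ x) x =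
      (∫ x in Ω, divg ψ x) + ∫ x in Ω, divg χ x := by
  obtain ⟨B⟩ := exists_fr
  refine ⟨⟨hψ.1.add hχ.1, hψ.2.add hχ.2⟩, ?_⟩
  rw [← integral_add (div_split Ω hO B hψ.1 hψ.2).1 (div_split Ω hO B hχ.1 hχ.2).1]
  congr 1
  ext x
  have : fderiv ℝ (fun x => ψ x + χ x) x = fderiv ℝ ψ x + fderiv ℝ χ x :=
    fderiv_add (hψ.1.differentiable one_ne_zero x) (hχ.1.differentiable one_ne_zero x)
  unfold divg
  rw [this, ← Finset.sum_add_distrib]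
  rfl

lemma divg_smul (Ω : Set E2) {ψ : E2 → E2} (hψ : Adm ψ) (c : ℝ) :
    Adm (fun x => c • ψ x) ∧ ∫ x in Ω, divg (fun x => c • ψ x) x = c * ∫ x in Ω, divg ψ x := by
  refine ⟨⟨hψ.1.const_smul c, hψ.2.comp_left (g := fun v => c • v) (by simp)⟩, ?_⟩
  rw [← integral_const_mul]
  congr 1
  ext x
  have : fderiv ℝ (fun x => c • ψ x) x = c • fderiv ℝ ψ x :=
    fderiv_const_smul (hψ.1.differentiable one_ne_zero x) c
  unfold divg
  rw [this, Finset.mul_sum]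
  rfl

lemma divg_sum (Ω : Set E2) (hO : IsOpen Ω) (ψ : ℕ → E2 → E2) (hψ : ∀ i, Adm (ψ i)) (s : Finset ℕ) :
    Adm (fun x => ∑ i ∈ s, ψ i x) ∧ ∫ x in Ω, divg (fun x => ∑ i ∈ s, ψ i x) x =
      ∑ i ∈ s, ∫ x in Ω, divg (ψ i) x := by
  classical
  induction s using Finset.induction_on with
  | empty =>
    simp only [Finset.sum_empty]
    refine ⟨⟨contDiff_const, HasCompactSupport.zero⟩, ?_⟩
    simp [divg]
  | insert a s ha ih =>
    have := divg_add Ω hO (hψ a) ih.1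
    simp only [Finset.sum_insert ha]
    rw [← ih.2]
    exact this

lemma exists_cutoff (K : Set E2) (hK : IsCompact K) (δ : ℝ) (hδ : 0 < δ) :
    ∃ η : E2 → ℝ, ContDiff ℝ 1 η ∧ HasCompactSupport η ∧ (∀ x, 0 ≤ η x ∧ η x ≤ 1) ∧
      (∀ x ∈ K, η x = 1) ∧ ∀ x, x ∉ thickening δ K → η x = 0 := by
  obtain ⟨f, h0, h1, h01⟩ := exists_contMDiffMap_zero_one_of_isClosed (n := 1)
    (modelWithCornersSelf ℝ E2) (s := (thickening δ K)ᶜ) (t := K)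
    isOpen_thickening.isClosed_compl hK.isClosed
    (disjoint_compl_left_iff_subset.2 (self_subset_thickening hδ K))
  have hz : ∀ x, x ∉ thickening δ K → f x = 0 := fun x hx => h0 hx
  refine ⟨f, f.contMDiff.contDiff, ?_, fun x => h01 x, fun x hx => h1 hx, hz⟩
  apply HasCompactSupport.of_support_subset_isCompact (hK.isBounded.thickening (δ := δ)).isCompact_closure
  intro x hx
  apply subset_closure
  by_contra hcon
  exact hx (hz x hcon)


/-! ### perimeter of a set with decomposed boundary -/

lemma abs_smul_field_cp (B : Fr) (c : ℝ) (v : E2) (hc : |c| ≤ 1) (hv : ‖v‖ ≤ 1) :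
    |cp B (c • v)| ≤ 1 ∧ |cq B (c • v)| ≤ 1 := by
  have : ‖c • v‖ ≤ 1 := by
    rw [norm_smul, Real.norm_eq_abs]
    exact mul_le_one₀ hc (norm_nonneg _) hv
  exact ⟨(abs_cp_le B _).trans this, (abs_cq_le B _).trans this⟩

lemma adm_smul {η : E2 → ℝ} {φ : E2 → E2} (h1 : ContDiff ℝ 1 η) (hφ : Adm φ) :
    Adm (fun x => η x • φ x) := by
  refine ⟨ContDiff.fun_smul h1 hφ.1, ?_⟩
  have : HasCompactSupport (η • φ) := hφ.2.smul_left
  exact this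

lemma cp_zero (B : Fr) : cp B 0 = 0 := (cpL B).map_zero
lemma cq_zero (B : Fr) : cq B 0 = 0 := (cqL B).map_zero

lemma piece_div (Ω : Set E2) (hO : IsOpen Ω) (hH : μH[1] (frontier Ω) ≠ ⊤)
    {ε h : ℝ} (hε : 0 ≤ ε) {K : Set E2} {B : Fr} {b₁ b₂ : Bool} (hP : Piece Ω ε K B b₁ b₂ h)
    {η : E2 → ℝ} (hη : ContDiff ℝ 1 η) (hη1 : ∀ x, |η x| ≤ 1) (R : Set E2) (hR : R ⊆ frontier Ω)
    (hηR : ∀ x ∈ frontier Ω, x ∉ K → x ∉ R → η x = 0)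
    {φ : E2 → E2} (hφ : Adm φ) (hφ1 : ∀ x, ‖φ x‖ ≤ 1) :
    ∫ x in Ω, divg (fun x => η x • φ x) x ≤
      |nt b₂ - nt b₁| * (μH[1] K).toReal + ε * (μH[1] K).toReal + 2 * (μH[1] R).toReal := by
  have hψ := adm_smul hη hφ
  rw [(div_split Ω hO B hψ.1 hψ.2).2]
  have hKf : μH[1] K ≠ ⊤ := ne_top_of_le_ne_top hH (measure_mono hP.sub)
  have hRf : μH[1] R ≠ ⊤ := ne_top_of_le_ne_top hH (measure_mono hR)
  have h1 : |∫ x in Ω, fderiv ℝ (fun x => cp B (η x • φ x)) x (swapFr B 1)| ≤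
      ε * (μH[1] K).toReal + (μH[1] R).toReal := by
    refine dir_upper Ω hO hH (swapFr B) (contDiff_cp_comp B hψ.1) (cs_cp_comp B hψ.2)
      (fun x => (abs_smul_field_cp B _ _ (hη1 x) (hφ1 x)).1) K R hKf hRf ⟨ε, hε⟩ ?_ ?_
    · apply LipschitzOnWith.of_dist_le_mul
      intro x hx y hy
      rw [cp_swapFr, cp_swapFr, Real.dist_eq, ← cq_sub, dist_eq_norm]
      exact (hP.flat x hx y hy).trans (mul_le_mul_of_nonneg_left (abs_cp_le B _) hε)
    · intro x hx hxK hxR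
      left
      rw [hηR x hx hxK hxR, zero_smul, cp_zero]
  have h2 : |∫ x in Ω, fderiv ℝ (fun x => cq B (η x • φ x)) x (B 1)| ≤
      |nt b₂ - nt b₁| * (μH[1] K).toReal + (μH[1] R).toReal := by
    by_cases hb : b₁ = b₂
    · subst hb
      have := dir_upper Ω hO hH B (contDiff_cq_comp B hψ.1) (cs_cq_comp B hψ.2)
        (fun x => (abs_smul_field_cp B _ _ (hη1 x) (hφ1 x)).2) ∅ R (by simp) hRf 1
        ((cp_lip B).lipschitzOnWith) ?_
      · simpa using this
      · intro x hx _ hxR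
        by_cases hxK : x ∈ K
        · right; exact ⟨h, hP.hpos, b₁, hP.up hxK, hP.down hxK⟩
        · left; rw [hηR x hx hxK hxR, zero_smul, cq_zero]
    · have := dir_upper Ω hO hH B (contDiff_cq_comp B hψ.1) (cs_cq_comp B hψ.2)
        (fun x => (abs_smul_field_cp B _ _ (hη1 x) (hφ1 x)).2) K R hKf hRf 1
        ((cp_lip B).lipschitzOnWith) ?_
      · have e : |nt b₂ - nt b₁| = 1 := by
          cases b₁ <;> cases b₂ <;> simp [nt] at hb ⊢
        rw [e]; simpa using this
      · intro x hx hxK hxR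
        left; rw [hηR x hx hxK hxR, zero_smul, cq_zero]
  have := le_abs_self (∫ x in Ω, fderiv ℝ (fun x => cp B (η x • φ x)) x (swapFr B 1))
  have := le_abs_self (∫ x in Ω, fderiv ℝ (fun x => cq B (η x • φ x)) x (B 1))
  linarith

lemma rest_div (Ω : Set E2) (hO : IsOpen Ω) (hH : μH[1] (frontier Ω) ≠ ⊤)
    {η : E2 → ℝ} (hη : ContDiff ℝ 1 η) (hη1 : ∀ x, |η x| ≤ 1) (R : Set E2) (hR : R ⊆ frontier Ω)
    (hηR : ∀ x ∈ frontier Ω, x ∉ R → η x = 0)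
    {φ : E2 → E2} (hφ : Adm φ) (hφ1 : ∀ x, ‖φ x‖ ≤ 1) :
    ∫ x in Ω, divg (fun x => η x • φ x) x ≤ 2 * (μH[1] R).toReal := by
  obtain ⟨B⟩ := exists_fr
  have hψ := adm_smul hη hφ
  rw [(div_split Ω hO B hψ.1 hψ.2).2]
  have hRf : μH[1] R ≠ ⊤ := ne_top_of_le_ne_top hH (measure_mono hR)
  have h1 := dir_upper Ω hO hH (swapFr B) (contDiff_cp_comp B hψ.1) (cs_cp_comp B hψ.2)
      (fun x => (abs_smul_field_cp B _ _ (hη1 x) (hφ1 x)).1) ∅ R (by simp) hRf 1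
      ((cp_lip _).lipschitzOnWith) (by
        intro x hx _ hxR; left; rw [hηR x hx hxR, zero_smul, cp_zero])
  have h2 := dir_upper Ω hO hH B (contDiff_cq_comp B hψ.1) (cs_cq_comp B hψ.2)
      (fun x => (abs_smul_field_cp B _ _ (hη1 x) (hφ1 x)).2) ∅ R (by simp) hRf 1
      ((cp_lip _).lipschitzOnWith) (by
        intro x hx _ hxR; left; rw [hηR x hx hxR, zero_smul, cq_zero])
  simp only [measure_empty, ENNReal.toReal_zero, mul_zero, zero_add] at h1 h2
  have := le_abs_self (∫ x in Ω, fderiv ℝ (fun x => cp B (η x • φ x)) x (swapFr B 1))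
  have := le_abs_self (∫ x in Ω, fderiv ℝ (fun x => cq B (η x • φ x)) x (B 1))
  linarith

lemma perim_bounds {Ω : Set E2} (hO : IsOpen Ω) (hH : μH[1] (frontier Ω) ≠ ⊤) {ε : ℝ} (hε : 0 ≤ ε)
    {N : ℕ} {K : ℕ → Set E2} {B : ℕ → Fr} {b₁ b₂ : ℕ → Bool} {h : ℕ → ℝ}
    (hP : ∀ n, Piece Ω ε (K n) (B n) (b₁ n) (b₂ n) (h n))
    (hd : Pairwise (Function.onFun Disjoint K)) (ρ : ℝ)
    (hρ : (μH[1] (frontier Ω \ ⋃ n ∈ Finset.range N, K n)).toReal ≤ ρ) :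
    perimeter Ω ≤ (∑ i ∈ Finset.range N, |nt (b₂ i) - nt (b₁ i)| * (μH[1] (K i)).toReal) +
        ε * (μH[1] (frontier Ω)).toReal + 4 * ρ ∧
    (∑ i ∈ Finset.range N, |nt (b₂ i) - nt (b₁ i)| * (volume (cp (B i) '' K i)).toReal) - ρ ≤
      perimeter Ω := by
  classical
  set R := frontier Ω \ ⋃ n ∈ Finset.range N, K n with hR
  have hRf : μH[1] R ≠ ⊤ := ne_top_of_le_ne_top hH (measure_mono sdiff_subset)
  obtain ⟨δ, hδ, hsep⟩ := sep_thick K (fun n => (hP n).compact) hd N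
  choose η hη hηc hη01 hηK hη0 using fun n => exists_cutoff (K n) (hP n).compact δ hδ
  set Ri : ℕ → Set E2 := fun i => R ∩ thickening δ (K i) with hRi
  have hRsub : ∀ i, Ri i ⊆ frontier Ω := fun i => inter_subset_left.trans sdiff_subset
  have hRif : ∀ i, μH[1] (Ri i) ≠ ⊤ := fun i => ne_top_of_le_ne_top hH (measure_mono (hRsub i))
  have hone : ∀ x, ∀ i ∈ Finset.range N, η i x ≠ 0 → ∀ j ∈ Finset.range N, j ≠ i → η j x = 0 := by
    intro x i hi hix j hj hji
    apply hη0
    intro hxj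
    have hxi : x ∈ thickening δ (K i) := by
      by_contra hcon; exact hix (hη0 i x hcon)
    exact Set.disjoint_left.1 (hsep j hj i hi hji) hxj hxi
  have hηR : ∀ i ∈ Finset.range N, ∀ x ∈ frontier Ω, x ∉ K i → x ∉ Ri i → η i x = 0 := by
    intro i hi x hx hxK hxR
    by_contra hcon
    have hxi : x ∈ thickening δ (K i) := by
      by_contra hcon'; exact hcon (hη0 i x hcon')
    apply hxR
    refine ⟨⟨hx, ?_⟩, hxi⟩
    intro hxU
    simp only [mem_iUnion] at hxU
    obtain ⟨j, hj, hxj⟩ := hxU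
    by_cases hji : j = i
    · exact hxK (hji ▸ hxj)
    · exact Set.disjoint_left.1 (hsep j hj i hi hji) (self_subset_thickening hδ _ hxj) hxi
  have hηabs : ∀ i x, |η i x| ≤ 1 := fun i x => by
    rw [abs_of_nonneg (hη01 i x).1]; exact (hη01 i x).2
  have hRm : MeasurableSet R := by
    apply MeasurableSet.diff isClosed_frontier.measurableSet
    exact Finset.measurableSet_biUnion _ (fun n _ => (hP n).compact.measurableSet)
  have hsumR : ∑ i ∈ Finset.range N, (μH[1] (Ri i)).toReal ≤ ρ := by
    refine le_trans ?_ hρ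
    rw [← ENNReal.toReal_sum (fun i _ => hRif i)]
    apply ENNReal.toReal_mono hRf
    rw [← measure_biUnion_finset]
    · exact measure_mono (iUnion₂_subset fun i _ => inter_subset_left)
    · intro i hi j hj hij
      exact (hsep i hi j hj hij).mono inter_subset_right inter_subset_right
    · intro i _
      exact MeasurableSet.inter hRm isOpen_thickening.measurableSet
  have hsumK := sum_haus_le _ K N (fun n => (hP n).compact) hd (fun n => (hP n).sub) hH
  have hub : ∀ r ∈ perimSet Ω,
      r ≤ (∑ i ∈ Finset.range N, |nt (b₂ i) - nt (b₁ i)| * (μH[1] (K i)).toReal) +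
        ε * (μH[1] (frontier Ω)).toReal + 4 * ρ := by
    rintro r ⟨φ, hφ, hφc, hφ1, rfl⟩
    have hA : Adm φ := ⟨hφ, hφc⟩
    have hAi : ∀ i, Adm (fun x => η i x • φ x) := fun i => adm_smul (hη i) hA
    have hsum := divg_sum Ω hO (fun i x => η i x • φ x) hAi (Finset.range N)
    set θ : E2 → ℝ := fun x => 1 - ∑ i ∈ Finset.range N, η i x with hθ
    have hθC : ContDiff ℝ 1 θ := contDiff_const.sub (ContDiff.sum fun i _ => hη i)
    have hsum01 : ∀ x, 0 ≤ ∑ i ∈ Finset.range N, η i x ∧ ∑ i ∈ Finset.range N, η i x ≤ 1 := by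
      intro x
      refine ⟨Finset.sum_nonneg fun i _ => (hη01 i x).1, ?_⟩
      by_cases hex : ∃ i ∈ Finset.range N, η i x ≠ 0
      · obtain ⟨i, hi, hix⟩ := hex
        rw [Finset.sum_eq_single_of_mem i hi (fun j hj hji => hone x i hi hix j hj hji)]
        exact (hη01 i x).2
      · push Not at hex
        rw [Finset.sum_eq_zero hex]; norm_num
    have hθ1 : ∀ x, |θ x| ≤ 1 := by
      intro x
      rw [abs_le]
      simp only [hθ]
      constructor <;> linarith [(hsum01 x).1, (hsum01 x).2]
    have hθR : ∀ x ∈ frontier Ω, x ∉ R → θ x = 0 := by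
      intro x hx hxR
      have hxU : x ∈ ⋃ n ∈ Finset.range N, K n := by
        by_contra hcon; exact hxR ⟨hx, hcon⟩
      simp only [mem_iUnion] at hxU
      obtain ⟨i, hi, hxi⟩ := hxU
      simp only [hθ]
      rw [Finset.sum_eq_single_of_mem i hi (fun j hj hji =>
        hone x i hi (by rw [hηK i x hxi]; norm_num) j hj hji), hηK i x hxi, sub_self]
    have hdec : φ = fun x => (∑ i ∈ Finset.range N, η i x • φ x) + θ x • φ x := by
      ext1 x
      rw [← Finset.sum_smul, ← add_smul]
      simp [hθ]
    have hadd := divg_add Ω hO hsum.1 (adm_smul hθC hA)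
    have hIntEq : ∫ x in Ω, divg φ x =
        (∑ i ∈ Finset.range N, ∫ x in Ω, divg (fun x => η i x • φ x) x) +
          ∫ x in Ω, divg (fun x => θ x • φ x) x := by
      conv_lhs => rw [hdec]
      rw [hadd.2, hsum.2]
    rw [hIntEq]
    have e1 := rest_div Ω hO hH hθC hθ1 R sdiff_subset hθR hA hφ1
    have e2 := Finset.sum_le_sum fun i hi => piece_div Ω hO hH hε (hP i) (hη i) (hηabs i) (Ri i)
      (hRsub i) (hηR i hi) hA hφ1
    rw [Finset.sum_add_distrib, Finset.sum_add_distrib, ← Finset.mul_sum, ← Finset.mul_sum] at e2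
    have e3 := mul_le_mul_of_nonneg_left hsumK hε
    linarith
  have hlow : ∃ r ∈ perimSet Ω,
      (∑ i ∈ Finset.range N, |nt (b₂ i) - nt (b₁ i)| * (volume (cp (B i) '' K i)).toReal) - ρ ≤ r := by
    have hA0 : ∀ i, Adm (fun x => η i x • B i 1) := by
      intro i
      refine ⟨ContDiff.fun_smul (hη i) contDiff_const, ?_⟩
      have : HasCompactSupport (η i • fun _ : E2 => B i 1) := (hηc i).smul_right
      exact this
    have hA1 := fun i => divg_smul Ω (hA0 i) (nt (b₂ i) - nt (b₁ i))
    have hs := divg_sum Ω hO (fun i x => (nt (b₂ i) - nt (b₁ i)) • η i x • B i 1)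
      (fun i => (hA1 i).1) (Finset.range N)
    have hτ : ∀ i, |nt (b₂ i) - nt (b₁ i)| ≤ 1 := by
      intro i
      cases b₁ i <;> cases b₂ i <;> simp [nt]
    refine ⟨_, ⟨_, hs.1.1, hs.1.2, ?_, rfl⟩, ?_⟩
    · intro x
      by_cases hex : ∃ i ∈ Finset.range N, η i x ≠ 0
      · obtain ⟨i, hi, hix⟩ := hex
        rw [Finset.sum_eq_single_of_mem i hi (fun j hj hji => by
          rw [hone x i hi hix j hj hji]; simp)]
        rw [norm_smul, norm_smul, (B i).norm_eq_one, mul_one, Real.norm_eq_abs, Real.norm_eq_abs]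
        exact mul_le_one₀ (hτ i) (abs_nonneg _) (hηabs i x)
      · push Not at hex
        rw [Finset.sum_eq_zero (fun i hi => by rw [hex i hi]; simp)]; simp
    · rw [hs.2]
      have hterm : ∀ i ∈ Finset.range N,
          |nt (b₂ i) - nt (b₁ i)| * (volume (cp (B i) '' K i)).toReal - (μH[1] (Ri i)).toReal ≤
          ∫ x in Ω, divg (fun x => (nt (b₂ i) - nt (b₁ i)) • η i x • B i 1) x := by
        intro i hi
        have e1 := dir_lower Ω hO hH (hη i) (hηc i) (hηabs i) (hP i) (hηK i) (Ri i) (hRif i)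
          (hηR i hi)
        have e2 : ∫ x in Ω, divg (fun x => η i x • B i 1) x =
            ∫ x in Ω, fderiv ℝ (η i) x (B i 1) := by
          rw [(div_split Ω hO (B i) (hA0 i).1 (hA0 i).2).2]
          have c1 : (fun x => cp (B i) (η i x • B i 1)) = fun _ => (0:ℝ) := by
            ext x; rw [cp_smul, cp_B1, mul_zero]
          have c2 : (fun x => cq (B i) (η i x • B i 1)) = η i := by
            ext x; rw [cq_smul, cq_B1, mul_one]
          rw [c1, c2]
          simp
        rw [(hA1 i).2, e2]
        have hnn : 0 ≤ (μH[1] (Ri i)).toReal := ENNReal.toReal_nonneg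
        rw [abs_le] at e1
        rcases e1 with ⟨e3, e4⟩
        cases h1 : b₁ i <;> cases h2 : b₂ i <;> simp [nt, h1, h2] at e3 e4 ⊢ <;> linarith
      have := Finset.sum_le_sum hterm
      rw [Finset.sum_sub_distrib] at this
      linarith
  obtain ⟨r, hr, hrl⟩ := hlow
  exact ⟨csSup_le ⟨r, hr⟩ hub, hrl.trans (le_csSup ⟨_, hub⟩ hr)⟩


/-! ### assembly -/

lemma Lfun_integral' (Ω : Set E2) (hO : IsOpen Ω) (hb : IsBounded Ω) (r : ℝ) (hr : 0 < r) :
    ∫ t in (0:ℝ)..r, Lfun Ω t = (volume (Ω ∩ thickening r (frontier Ω))).toReal := by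
  by_cases hne : (frontier Ω).Nonempty
  · exact Lfun_integral Ω hO hb hne r hr
  · have he : frontier Ω = ∅ := not_nonempty_iff_eq_empty.1 hne
    have hclo := isClopen_iff_frontier_eq_empty.2 he
    have hΩ : Ω = ∅ := by
      rcases isClopen_iff.1 hclo with h | h
      · exact h
      · exfalso
        rw [h] at hb
        exact NormedSpace.unbounded_univ ℝ E2 hb
    subst hΩ
    have : Lfun ∅ = fun _ => 0 := by
      ext t; simp [Lfun]
    rw [this]; simp

lemma dens_meas {Ω : Set E2} (hH : μH[1] (frontier Ω) ≠ ⊤) {ε : ℝ}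
    {N : ℕ} {K : ℕ → Set E2} {B : ℕ → Fr} {b₁ b₂ : ℕ → Bool} {h : ℕ → ℝ}
    (hP : ∀ n, Piece Ω ε (K n) (B n) (b₁ n) (b₂ n) (h n))
    (hd : Pairwise (Function.onFun Disjoint K)) (ρ : ℝ)
    (hρ : (μH[1] (frontier Ω \ ⋃ n ∈ Finset.range N, K n)).toReal ≤ ρ) :
    ∑ i ∈ Finset.range N, nt (b₁ i) * nt (b₂ i) * (μH[1] (K i)).toReal ≤
      (μH[1] (frontier Ω ∩ densityPts Ω 1)).toReal ∧
    (μH[1] (frontier Ω ∩ densityPts Ω 1)).toReal ≤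
      (∑ i ∈ Finset.range N, nt (b₁ i) * nt (b₂ i) * (μH[1] (K i)).toReal) + ρ := by
  classical
  set I := (Finset.range N).filter (fun i => b₁ i = true ∧ b₂ i = true) with hI
  have hKf : ∀ i, μH[1] (K i) ≠ ⊤ := fun i => ne_top_of_le_ne_top hH (measure_mono (hP i).sub)
  have hRf : μH[1] (frontier Ω \ ⋃ n ∈ Finset.range N, K n) ≠ ⊤ :=
    ne_top_of_le_ne_top hH (measure_mono sdiff_subset)
  have hsum : ∑ i ∈ Finset.range N, nt (b₁ i) * nt (b₂ i) * (μH[1] (K i)).toReal =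
      (∑ i ∈ I, μH[1] (K i)).toReal := by
    rw [ENNReal.toReal_sum (fun i _ => hKf i), hI, Finset.sum_filter]
    apply Finset.sum_congr rfl
    intro i _
    cases b₁ i <;> cases b₂ i <;> simp [nt]
  have hSf : ∑ i ∈ I, μH[1] (K i) ≠ ⊤ := ENNReal.sum_ne_top.2 (fun i _ => hKf i)
  rw [hsum]
  constructor
  · apply ENNReal.toReal_mono (ne_top_of_le_ne_top hH (measure_mono inter_subset_left))
    rw [← measure_biUnion_finset (fun i _ j _ hij => hd hij)
      (fun n _ => (hP n).compact.measurableSet)]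
    apply measure_mono
    apply iUnion₂_subset
    intro i hi x hx
    obtain ⟨_, h1, h2⟩ := Finset.mem_filter.1 hi
    exact ⟨(hP i).sub hx, (hP i).inn h1 h2 hx⟩
  · have hsub : frontier Ω ∩ densityPts Ω 1 ⊆
        (⋃ i ∈ I, K i) ∪ (frontier Ω \ ⋃ n ∈ Finset.range N, K n) := by
      rintro x ⟨hx, hxd⟩
      by_cases hxU : x ∈ ⋃ n ∈ Finset.range N, K n
      · left
        simp only [mem_iUnion] at hxU
        obtain ⟨i, hi, hxi⟩ := hxU
        have hbb : b₁ i = true ∧ b₂ i = true := by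
          by_contra hcon
          exact Set.disjoint_left.1 ((hP i).out hcon) hxi hxd
        exact mem_biUnion (Finset.mem_filter.2 ⟨hi, hbb⟩) hxi
      · right; exact ⟨hx, hxU⟩
    have h1 := (measure_mono (μ := μH[1]) hsub).trans (measure_union_le _ _)
    have h2 := h1.trans (add_le_add (measure_biUnion_finset_le I K) le_rfl)
    have h3 := ENNReal.toReal_mono (ENNReal.add_ne_top.2 ⟨hSf, hRf⟩) h2
    rw [ENNReal.toReal_add hSf hRf] at h3
    linarith

lemma main_est (Ω : Set E2) (hO : IsOpen Ω) (hb : IsBounded Ω) (hH : μH[1] (frontier Ω) ≠ ⊤)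
    (hc : {C | ∃ x ∈ frontier Ω, C = connectedComponentIn (frontier Ω) x}.Finite)
    (ε : ℝ) (hε0 : 0 < ε) (hε : ε ≤ 1 / 2) :
    ∀ᶠ r in 𝓝[>] (0:ℝ), |1 / r * (volume (Ω ∩ thickening r (frontier Ω))).toReal -
      (perimeter Ω + 2 * (μH[1] (frontier Ω ∩ densityPts Ω 1)).toReal)| ≤
        ε * (3 * (μH[1] (frontier Ω)).toReal + 6) := by
  obtain ⟨N, K, B, b₁, b₂, h, hP, hd, hη⟩ := decomp Ω hO hb hH hc ε hε0 hε (ENNReal.ofReal ε)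
    (by simpa using hε0)
  have hΓ : IsCompact (frontier Ω) :=
    isCompact_of_isClosed_isBounded isClosed_frontier (hb.closure.subset frontier_subset_closure)
  have hρ : (μH[1] (frontier Ω \ ⋃ n ∈ Finset.range N, K n)).toReal ≤ ε :=
    ENNReal.toReal_le_of_le_ofReal hε0.le hη.le
  have hKf : ∀ i, μH[1] (K i) ≠ ⊤ := fun i => ne_top_of_le_ne_top hH (measure_mono (hP i).sub)
  obtain ⟨hp1, hp2⟩ := perim_bounds hO hH hε0.le hP hd ε hρ
  obtain ⟨hd1, hd2⟩ := dens_meas hH hP hd ε hρ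
  have hsumK := sum_haus_le _ K N (fun n => (hP n).compact) hd (fun n => (hP n).sub) hH
  set H := (μH[1] (frontier Ω)).toReal with hHdef
  set k : ℕ → ℝ := fun i => (μH[1] (K i)).toReal with hk
  set c : ℕ → ℝ := fun i => (volume (cp (B i) '' K i)).toReal with hcdef
  have hk0 : ∀ i, 0 ≤ k i := fun i => ENNReal.toReal_nonneg
  have hck : ∀ i, k i - ε * k i ≤ c i := by
    intro i
    have hcf : volume (cp (B i) '' K i) ≠ ⊤ :=
      ((hP i).compact.image (continuous_cp (B i))).measure_lt_top.ne
    have := ENNReal.toReal_mono (ENNReal.mul_ne_top ENNReal.ofReal_ne_top hcf)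
      ((hP i).flat.haus_le hε0.le)
    rw [ENNReal.toReal_mul, ENNReal.toReal_ofReal (by linarith)] at this
    change k i ≤ (1 + ε) * c i at this
    have hc0 : 0 ≤ c i := ENNReal.toReal_nonneg
    nlinarith [hk0 i, mul_nonneg hε0.le hε0.le, mul_nonneg (mul_nonneg hε0.le hε0.le) hc0]
  have hHle : H ≤ (∑ i ∈ Finset.range N, k i) + ε := by
    have hsub : frontier Ω ⊆ (⋃ n ∈ Finset.range N, K n) ∪
        (frontier Ω \ ⋃ n ∈ Finset.range N, K n) := by
      intro x hx
      by_cases hxU : x ∈ ⋃ n ∈ Finset.range N, K n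
      · left; exact hxU
      · right; exact ⟨hx, hxU⟩
    have h1 := (measure_mono (μ := μH[1]) hsub).trans (measure_union_le _ _)
    have h2 := h1.trans (add_le_add (measure_biUnion_finset_le (Finset.range N) K) hη.le)
    have hSf : ∑ i ∈ Finset.range N, μH[1] (K i) ≠ ⊤ := ENNReal.sum_ne_top.2 (fun i _ => hKf i)
    have h3 := ENNReal.toReal_mono (ENNReal.add_ne_top.2 ⟨hSf, ENNReal.ofReal_ne_top⟩) h2
    rw [ENNReal.toReal_add hSf ENNReal.ofReal_ne_top, ENNReal.toReal_sum (fun i _ => hKf i),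
      ENNReal.toReal_ofReal hε0.le] at h3
    exact h3
  -- weighted comparisons
  have hcmp : ∀ w : ℕ → ℝ, (∀ i, 0 ≤ w i) → ∀ M, 0 ≤ M → (∀ i, w i ≤ M) →
      (∑ i ∈ Finset.range N, w i * k i) - M * (ε * H) ≤ ∑ i ∈ Finset.range N, w i * c i := by
    intro w hw M hM hwM
    have h1 : ∑ i ∈ Finset.range N, (w i * k i - M * (ε * k i)) ≤
        ∑ i ∈ Finset.range N, w i * c i := by
      apply Finset.sum_le_sum
      intro i _
      have e1 := mul_le_mul_of_nonneg_left (hck i) (hw i)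
      have e2 := mul_le_mul_of_nonneg_right (hwM i) (mul_nonneg hε0.le (hk0 i))
      nlinarith
    rw [Finset.sum_sub_distrib, ← Finset.mul_sum, ← Finset.mul_sum] at h1
    have e3 := mul_le_mul_of_nonneg_left (mul_le_mul_of_nonneg_left hsumK hε0.le) hM
    linarith
  have hn0 : ∀ i, 0 ≤ nt (b₁ i) + nt (b₂ i) := fun i => add_nonneg (nt_nonneg _) (nt_nonneg _)
  have hn2 : ∀ i, nt (b₁ i) + nt (b₂ i) ≤ 2 := fun i => by
    cases b₁ i <;> cases b₂ i <;> norm_num [nt]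
  have ha1 : ∀ i, |nt (b₂ i) - nt (b₁ i)| ≤ 1 := fun i => by
    cases b₁ i <;> cases b₂ i <;> norm_num [nt]
  have hdec : ∑ i ∈ Finset.range N, (nt (b₁ i) + nt (b₂ i)) * k i =
      (∑ i ∈ Finset.range N, |nt (b₂ i) - nt (b₁ i)| * k i) +
        2 * ∑ i ∈ Finset.range N, nt (b₁ i) * nt (b₂ i) * k i := by
    rw [Finset.mul_sum, ← Finset.sum_add_distrib]
    apply Finset.sum_congr rfl
    intro i _
    cases b₁ i <;> cases b₂ i <;> norm_num [nt]
  have hcomp2 : ∑ i ∈ Finset.range N, (2 - (nt (b₁ i) + nt (b₂ i))) * k i =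
      2 * (∑ i ∈ Finset.range N, k i) - ∑ i ∈ Finset.range N, (nt (b₁ i) + nt (b₂ i)) * k i := by
    rw [Finset.mul_sum, ← Finset.sum_sub_distrib]
    apply Finset.sum_congr rfl
    intro i _
    ring
  have c1 := hcmp (fun i => nt (b₁ i) + nt (b₂ i)) hn0 2 (by norm_num) hn2
  have c2 := hcmp (fun i => 2 - (nt (b₁ i) + nt (b₂ i))) (fun i => by linarith [hn2 i]) 2
    (by norm_num) (fun i => by linarith [hn0 i])
  have c3 := hcmp (fun i => |nt (b₂ i) - nt (b₁ i)|) (fun i => abs_nonneg _) 1 (by norm_num) ha1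
  filter_upwards [vol_lower (N := N) hO hb hH hP hd, all_thick _ hΓ hH hc ε hε0,
    self_mem_nhdsWithin] with r hr1 hr2 hr0
  have hr0' : 0 < r := hr0
  obtain ⟨v1, v2⟩ := hr1
  have hH0 : 0 ≤ H := ENNReal.toReal_nonneg
  have hfin : volume (thickening r (frontier Ω)) ≠ ⊤ := hΓ.isBounded.thickening.measure_lt_top.ne
  have v3 : (volume (Ω ∩ thickening r (frontier Ω))).toReal +
      (volume (thickening r (frontier Ω) \ Ω)).toReal ≤ (2 * H + ε) * r := by
    rw [← ENNReal.toReal_add (ne_top_of_le_ne_top hfin (measure_mono inter_subset_right))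
      (ne_top_of_le_ne_top hfin (measure_mono sdiff_subset)), inter_comm,
      measure_inter_add_sdiff _ hO.measurableSet]
    exact ENNReal.toReal_le_of_le_ofReal (by positivity) hr2
  change r * ∑ i ∈ Finset.range N, (nt (b₁ i) + nt (b₂ i)) * c i ≤ _ at v1
  change r * ∑ i ∈ Finset.range N, (2 - (nt (b₁ i) + nt (b₂ i))) * c i ≤ _ at v2
  set V := (volume (Ω ∩ thickening r (frontier Ω))).toReal
  set W := (volume (thickening r (frontier Ω) \ Ω)).toReal
  have w1 : ∑ i ∈ Finset.range N, (nt (b₁ i) + nt (b₂ i)) * c i ≤ 1 / r * V := by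
    rw [one_div, ← div_eq_inv_mul, le_div_iff₀ hr0', mul_comm]; exact v1
  have w2 : 1 / r * V ≤ 2 * H + ε -
      ∑ i ∈ Finset.range N, (2 - (nt (b₁ i) + nt (b₂ i))) * c i := by
    rw [one_div, ← div_eq_inv_mul, div_le_iff₀ hr0', sub_mul]
    linarith
  rw [abs_le]
  constructor <;> nlinarith [mul_nonneg hε0.le hH0]


/-- The averaged limit of the lengths of interior parallels equals
`P(Ω) + 2𝓗¹(∂Ω ∩ Ω^{(1)})`. -/
theorem tendsto_average_Lfun (Ω : Set E2) (hO : IsOpen Ω) (hb : IsBounded Ω)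
    (hH : μH[1] (frontier Ω) < ⊤)
    (hc : {C | ∃ x ∈ frontier Ω, C = connectedComponentIn (frontier Ω) x}.Finite) :
    Tendsto (fun r => (1 / r) * ∫ t in (0:ℝ)..r, Lfun Ω t) (𝓝[>] 0)
      (𝓝 (perimeter Ω + 2 * (μH[1] (frontier Ω ∩ densityPts Ω 1)).toReal)) := by
  have hIntEq : ∀ᶠ r in 𝓝[>] (0:ℝ), (1 / r) * (volume (Ω ∩ thickening r (frontier Ω))).toReal =
      (1 / r) * ∫ t in (0:ℝ)..r, Lfun Ω t := by
    filter_upwards [self_mem_nhdsWithin] with r hr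
    rw [Lfun_integral' Ω hO hb r hr]
  refine Tendsto.congr' hIntEq ?_
  rw [Metric.tendsto_nhds]
  intro e he
  set H := (μH[1] (frontier Ω)).toReal with hHdef
  have hH0 : 0 ≤ H := ENNReal.toReal_nonneg
  have hpos : 0 < 3 * H + 6 := by linarith
  have hm : 0 < min (1 / 2) (e / (2 * (3 * H + 6))) := lt_min (by norm_num) (by positivity)
  filter_upwards [main_est Ω hO hb hH.ne hc _ hm (min_le_left _ _)] with r hr
  rw [Real.dist_eq]
  refine hr.trans_lt ?_
  rw [← hHdef]
  have h1 := mul_le_mul_of_nonneg_right (min_le_right (1 / 2) (e / (2 * (3 * H + 6)))) hpos.le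
  have h2 : e / (2 * (3 * H + 6)) * (3 * H + 6) = e / 2 := by
    field_simp
  linarith
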